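/- Let n>1 and let 𝔸 be a homogeneous linear constant-coefficient differential operator of order k on ℝⁿ from V to W which is ℂ-elliptic (equivalently, by the paper, has finite-dimensional null-space). Then there exists a constant c>0 such that for every u ∈ C^∞(cl(B), V) one has (∫_B |D^{k−1}u(x)|^{n/(n−1)} dx)^{(n−1)/n} ≤ c ( ∫_B |𝔸u(x)| dx + ∫_B |u(x)| dx ). -/

import Mathlib

noncomputable section

open MeasureTheory Metric
open scoped ENNReal RealInnerProductSpace

/-- Euclidean space `ℝⁿ`. -/
abbrev Euc (n : ℕ) : Type := EuclideanSpace ℝ (Fin n)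

/-- The coefficient datum of a homogeneous `k`-th order linear constant-coefficient
differential operator `𝔸` from `V` to `W` on `ℝⁿ`: a linear map acting on the space of
(values of) `k`-th derivatives, so that `𝔸 u (x) = A (D^k u (x))`. -/
abbrev OpCoeff (n k : ℕ) (V W : Type*) [NormedAddCommGroup V] [NormedSpace ℝ V]
    [NormedAddCommGroup W] [NormedSpace ℝ W] : Type _ :=
  ContinuousMultilinearMap ℝ (fun _ : Fin k => Euc n) V →L[ℝ] W

variable {n k : ℕ} {V W : Type*}
  [NormedAddCommGroup V] [InnerProductSpace ℝ V] [FiniteDimensional ℝ V]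
  [NormedAddCommGroup W] [InnerProductSpace ℝ W] [FiniteDimensional ℝ W]

/-- `𝔸 u`, the operator applied to `u : ℝⁿ → V`. -/
def opApply (A : OpCoeff n k V W) (u : Euc n → V) (x : Euc n) : W :=
  A (iteratedFDeriv ℝ k u x)

/-- The symmetric tensor `v ⊗^k ξ`, i.e. the `k`-linear map `(e₁,…,e_k) ↦ (∏ᵢ ⟪ξ,eᵢ⟫) • v`. -/
def symTensor (n k : ℕ) {V : Type*} [NormedAddCommGroup V] [NormedSpace ℝ V]
    (ξ : Euc n) (v : V) : ContinuousMultilinearMap ℝ (fun _ : Fin k => Euc n) V :=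
  (ContinuousMultilinearMap.mkPiRing ℝ (Fin k) v).compContinuousLinearMap
    (fun _ => innerSL ℝ ξ)

/-- The (real) symbol `𝔸[ξ] v = A (v ⊗^k ξ)`. -/
def symbol (A : OpCoeff n k V W) (ξ : Euc n) (v : V) : W :=
  A (symTensor n k ξ v)

/-- Ellipticity: `𝔸[ξ]` is injective for every real `ξ ≠ 0`. -/
def IsElliptic (A : OpCoeff n k V W) : Prop :=
  ∀ ξ : Euc n, ξ ≠ 0 → Function.Injective (symbol A ξ)

/-- Cancellation: `⋂_{ξ ≠ 0} 𝔸[ξ](V) = {0}`. -/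
def IsCancelling (A : OpCoeff n k V W) : Prop :=
  (⋂ ξ ∈ {ξ : Euc n | ξ ≠ 0}, Set.range (symbol A ξ)) = {0}

/-- The scalar `ℝ`-multilinear map `(e₁,…,e_k) ↦ ∏ᵢ (⟪η₁,eᵢ⟫ + i ⟪η₂,eᵢ⟫) ∈ ℂ`,
the building block for the complexified symbol at `ξ = η₁ + i η₂`. -/
def cxKernel (n k : ℕ) (η₁ η₂ : Euc n) :
    ContinuousMultilinearMap ℝ (fun _ : Fin k => Euc n) ℂ :=
  ((ContinuousMultilinearMap.mkPiRing ℂ (Fin k) (1 : ℂ)).restrictScalars ℝ).compContinuousLinearMap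
    (fun _ => Complex.ofRealCLM.comp (innerSL ℝ η₁) + Complex.I • Complex.ofRealCLM.comp (innerSL ℝ η₂))

/-- Real part of the complexified tensor `(v₁ + i v₂) ⊗^k (η₁ + i η₂)`. -/
def cxSymTensorRe (n k : ℕ) {V : Type*} [NormedAddCommGroup V] [NormedSpace ℝ V]
    (η₁ η₂ : Euc n) (v₁ v₂ : V) : ContinuousMultilinearMap ℝ (fun _ : Fin k => Euc n) V :=
  (Complex.reCLM.compContinuousMultilinearMap (cxKernel n k η₁ η₂)).smulRight v₁
    - (Complex.imCLM.compContinuousMultilinearMap (cxKernel n k η₁ η₂)).smulRight v₂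

/-- Imaginary part of the complexified tensor `(v₁ + i v₂) ⊗^k (η₁ + i η₂)`. -/
def cxSymTensorIm (n k : ℕ) {V : Type*} [NormedAddCommGroup V] [NormedSpace ℝ V]
    (η₁ η₂ : Euc n) (v₁ v₂ : V) : ContinuousMultilinearMap ℝ (fun _ : Fin k => Euc n) V :=
  (Complex.imCLM.compContinuousMultilinearMap (cxKernel n k η₁ η₂)).smulRight v₁
    + (Complex.reCLM.compContinuousMultilinearMap (cxKernel n k η₁ η₂)).smulRight v₂

/-- ℂ-ellipticity: the complexified symbol `𝔸[η₁ + i η₂]` is injective on `V + iV` for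
every nonzero complex frequency `η₁ + i η₂`. -/
def IsCElliptic (A : OpCoeff n k V W) : Prop :=
  ∀ η₁ η₂ : Euc n, ∀ v₁ v₂ : V, (η₁, η₂) ≠ 0 →
    A (cxSymTensorRe n k η₁ η₂ v₁ v₂) = 0 → A (cxSymTensorIm n k η₁ η₂ v₁ v₂) = 0 →
      v₁ = 0 ∧ v₂ = 0

/-- The null-space of `𝔸`: smooth maps `u : ℝⁿ → V` with `𝔸 u = 0`. -/
def nullSpace (A : OpCoeff n k V W) : Set (Euc n → V) :=
  {u | ContDiff ℝ (⊤ : ℕ∞) u ∧ ∀ x, opApply A u x = 0}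

section
open MvPolynomial

theorem hc_mul {n : ℕ} {i j : ℕ} {a b : MvPolynomial (Fin n) ℝ} (ha : a.IsHomogeneous i) :
    homogeneousComponent (i + j) (a * b) = a * homogeneousComponent j b := by
  have hb : b = ∑ l ∈ Finset.range (max (b.totalDegree + 1) (j + 1)), homogeneousComponent l b := by
    conv_lhs => rw [← sum_homogeneousComponent b]
    apply Finset.sum_subset
    · intro l hl; simp at hl ⊢; omega
    · intro l _ hl
      apply homogeneousComponent_eq_zero
      simp at hl; omega
  conv_lhs => rw [hb]
  rw [Finset.mul_sum, map_sum, Finset.sum_eq_single j]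
  · rw [homogeneousComponent_of_mem (ha.mul (homogeneousComponent_isHomogeneous j b)), if_pos rfl]
  · intro l _ hl
    rw [homogeneousComponent_of_mem (ha.mul (homogeneousComponent_isHomogeneous l b)), if_neg]
    omega
  · intro hj
    simp at hj

/-- The ideal of multipliers `p` such that `p • 1` factors through `P`. -/
def multIdeal {n d q : ℕ} (P : Matrix (Fin q) (Fin d) (MvPolynomial (Fin n) ℝ)) :
    Ideal (MvPolynomial (Fin n) ℝ) where
  carrier := {p | ∃ Q : Matrix (Fin d) (Fin q) (MvPolynomial (Fin n) ℝ),
    Q * P = p • (1 : Matrix (Fin d) (Fin d) (MvPolynomial (Fin n) ℝ))}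
  zero_mem' := ⟨0, by simp⟩
  add_mem' := by
    rintro a b ⟨Q, hQ⟩ ⟨R, hR⟩
    exact ⟨Q + R, by rw [Matrix.add_mul, hQ, hR, add_smul]⟩
  smul_mem' := by
    rintro c p ⟨Q, hQ⟩
    exact ⟨c • Q, by rw [Matrix.smul_mul, hQ, smul_smul, smul_eq_mul]⟩

theorem exists_real_leftinv {d q : ℕ} (M : Matrix (Fin q) (Fin d) ℂ)
    (hM : ∀ v : Fin d → ℂ, M.mulVec v = 0 → v = 0) :
    ∃ B : Matrix (Fin d) (Fin q) ℝ, ((B.map (algebraMap ℝ ℂ)) * M).det ≠ 0 := by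
  obtain ⟨g, hg⟩ := LinearMap.exists_leftInverse_of_injective (Matrix.mulVecLin M)
    (by rw [LinearMap.ker_eq_bot']; intro v hv; exact hM v hv)
  set G : Matrix (Fin d) (Fin q) ℂ := LinearMap.toMatrix' g with hG
  have hGM : G * M = 1 := by
    have := congrArg LinearMap.toMatrix' hg
    rw [LinearMap.toMatrix'_comp, LinearMap.toMatrix'_id, ← Matrix.toLin'_apply',
      LinearMap.toMatrix'_toLin'] at this
    exact this
  set B1 : Matrix (Fin d) (Fin q) ℝ := G.map Complex.re
  set B2 : Matrix (Fin d) (Fin q) ℝ := G.map Complex.im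
  set M1 := (B1.map (algebraMap ℝ ℂ)) * M
  set M2 := (B2.map (algebraMap ℝ ℂ)) * M
  have hG2 : G = B1.map (algebraMap ℝ ℂ) + Complex.I • B2.map (algebraMap ℝ ℂ) := by
    ext i j
    simp [B1, B2, mul_comm Complex.I, Complex.re_add_im]
  set p : Polynomial ℂ := (M1.map Polynomial.C + (Polynomial.X : Polynomial ℂ) • M2.map Polynomial.C).det
  have hp : ∀ t : ℂ, p.eval t = (M1 + t • M2).det := by
    intro t
    have : p.eval t = Polynomial.evalRingHom t p := rfl
    rw [this, RingHom.map_det]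
    congr 1
    ext i j
    simp
    ring
  have hp0 : p ≠ 0 := by
    intro h
    have := hp Complex.I
    rw [h] at this
    have h2 : M1 + Complex.I • M2 = 1 := by
      rw [← hGM, hG2, Matrix.add_mul, Matrix.smul_mul]
    rw [h2] at this
    simp at this
  have hinf : (Set.range (algebraMap ℝ ℂ)).Infinite :=
    Set.infinite_range_of_injective (algebraMap ℝ ℂ).injective
  obtain ⟨t, ⟨r, rfl⟩, ht⟩ : ∃ t ∈ Set.range (algebraMap ℝ ℂ), p.eval t ≠ 0 := by
    by_contra hcon
    push Not at hcon
    exact hp0 (Polynomial.eq_zero_of_infinite_isRoot p (hinf.mono hcon))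
  refine ⟨B1 + r • B2, ?_⟩
  rw [hp] at ht
  convert ht using 2
  have : (B1 + r • B2).map (algebraMap ℝ ℂ)
      = B1.map (algebraMap ℝ ℂ) + (algebraMap ℝ ℂ r) • B2.map (algebraMap ℝ ℂ) := by
    ext i j; simp
  rw [this, Matrix.add_mul, Matrix.smul_mul]

theorem X_mem_radical {n d q : ℕ} (P : Matrix (Fin q) (Fin d) (MvPolynomial (Fin n) ℝ))
    (hell : ∀ ζ : Fin n → ℂ, ζ ≠ 0 → ∀ v : Fin d → ℂ,
      (∀ b, ∑ a, aeval ζ (P b a) * v a = 0) → v = 0) (j : Fin n) :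
    (X j : MvPolynomial (Fin n) ℝ) ∈ (multIdeal P).radical := by
  rw [← vanishingIdeal_zeroLocus_eq_radical (K := ℂ), mem_vanishingIdeal_iff]
  intro ζ hζ
  rw [mem_zeroLocus_iff] at hζ
  by_contra hne
  have hζ0 : ζ ≠ 0 := by
    rintro rfl
    simp at hne
  obtain ⟨B, hB⟩ := exists_real_leftinv (P.map (aeval ζ)) (by
    intro v hv
    refine hell ζ hζ0 v fun b => ?_
    simpa [Matrix.mulVec, dotProduct] using congrFun hv b)
  set BC : Matrix (Fin d) (Fin q) (MvPolynomial (Fin n) ℝ) := B.map C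
  have hmem : (BC * P).det ∈ multIdeal P :=
    ⟨(BC * P).adjugate * BC, by rw [Matrix.mul_assoc, Matrix.adjugate_mul]⟩
  apply hB
  have := hζ _ hmem
  have e : aeval ζ (BC * P).det = ((aeval ζ : MvPolynomial (Fin n) ℝ →ₐ[ℝ] ℂ) : MvPolynomial (Fin n) ℝ →+* ℂ) (BC * P).det := rfl
  rw [e, RingHom.map_det] at this
  rw [← this]
  congr 1
  ext i j
  simp [BC, Matrix.mul_apply]

theorem alg_main {n k d q : ℕ} (P : Matrix (Fin q) (Fin d) (MvPolynomial (Fin n) ℝ))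
    (hP : ∀ b a, (P b a).IsHomogeneous k)
    (hell : ∀ ζ : Fin n → ℂ, ζ ≠ 0 → ∀ v : Fin d → ℂ,
      (∀ b, ∑ a, aeval ζ (P b a) * v a = 0) → v = 0) :
    ∃ K : ℕ, ∀ j : ℕ, K ≤ j + k → ∀ α : Fin (j + k) → Fin n,
      ∃ Q : Matrix (Fin d) (Fin q) (MvPolynomial (Fin n) ℝ),
        (∀ a b, (Q a b).IsHomogeneous j) ∧
        Q * P = (∏ i, X (α i) : MvPolynomial (Fin n) ℝ) •
          (1 : Matrix (Fin d) (Fin d) (MvPolynomial (Fin n) ℝ)) := by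
  set J : Ideal (MvPolynomial (Fin n) ℝ) := Ideal.span (Set.range X)
  have hJ : J ≤ (multIdeal P).radical := by
    rw [Ideal.span_le]
    rintro _ ⟨j, rfl⟩
    exact X_mem_radical P hell j
  obtain ⟨K, hK⟩ := Ideal.exists_pow_le_of_le_radical_of_fg hJ ⟨Finset.univ.image X, by simp [J]⟩
  refine ⟨K, fun j hj α => ?_⟩
  have hmem : (∏ i, X (α i) : MvPolynomial (Fin n) ℝ) ∈ multIdeal P := by
    apply hK
    apply Ideal.pow_le_pow_right hj
    have := Ideal.prod_mem_prod (s := Finset.univ) (I := fun _ : Fin (j+k) => J) (x := fun i => X (α i))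
      (fun i _ => Ideal.subset_span ⟨α i, rfl⟩)
    simpa using this
  obtain ⟨Q, hQ⟩ := hmem
  refine ⟨Q.map (homogeneousComponent j), fun a b => homogeneousComponent_isHomogeneous _ _, ?_⟩
  ext1 a a'
  have h1 := congrFun (congrFun hQ a) a'
  have h2 := congrArg (homogeneousComponent (k + j)) h1
  rw [Matrix.mul_apply] at h2 ⊢
  rw [map_sum] at h2
  have h3 : ∀ b, homogeneousComponent (k + j) (Q a b * P b a') =
      (Q.map (homogeneousComponent j)) a b * P b a' := by
    intro b
    rw [mul_comm, hc_mul (hP b a'), mul_comm]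
    rfl
  simp only [h3] at h2
  rw [h2]
  have hh : (∏ i, X (α i) : MvPolynomial (Fin n) ℝ).IsHomogeneous (k + j) := by
    have := IsHomogeneous.prod Finset.univ (fun i : Fin (j+k) => (X (α i) : MvPolynomial (Fin n) ℝ))
      (fun _ => 1) (fun i _ => isHomogeneous_X _ _)
    simpa [add_comm] using this
  by_cases haa : a = a'
  · subst haa
    simp only [Matrix.smul_apply, Matrix.one_apply_eq, smul_eq_mul, mul_one]
    rw [homogeneousComponent_of_mem hh, if_pos rfl]
  · simp [haa]

/-- Cancellation: covectors annihilating some `P(ξ)`, `ξ ≠ 0`, span everything. -/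
theorem alg_span {n k d q : ℕ} (hn : 1 < n) (hk : 1 ≤ k)
    (P : Matrix (Fin q) (Fin d) (MvPolynomial (Fin n) ℝ))
    (hP : ∀ b a, (P b a).IsHomogeneous k)
    (hell : ∀ ζ : Fin n → ℂ, ζ ≠ 0 → ∀ v : Fin d → ℂ,
      (∀ b, ∑ a, aeval ζ (P b a) * v a = 0) → v = 0) :
    Submodule.span ℝ {w : Fin q → ℝ | ∃ ξ : Fin n → ℝ, ξ ≠ 0 ∧
      ∀ a, ∑ b, w b * eval ξ (P b a) = 0} = ⊤ := by
  obtain ⟨K, hK⟩ := alg_main P hP hell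
  set S := Submodule.span ℝ {w : Fin q → ℝ | ∃ ξ : Fin n → ℝ, ξ ≠ 0 ∧
      ∀ a, ∑ b, w b * eval ξ (P b a) = 0} with hS
  by_contra hne
  obtain ⟨f, hf0, hfS⟩ := Submodule.exists_le_ker_of_lt_top S (lt_top_iff_ne_top.2 hne)
  -- represent f by a vector
  set l : Fin q → ℝ := fun b => f (Pi.single b 1) with hl
  have hfl : ∀ w, f w = ∑ b, w b * l b := by
    intro w
    conv_lhs => rw [← Finset.univ_sum_single w]
    rw [map_sum]
    refine Finset.sum_congr rfl fun b _ => ?_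
    have : (Pi.single b (w b) : Fin q → ℝ) = w b • Pi.single b 1 := by
      rw [← Pi.single_smul]; simp
    rw [this, map_smul, smul_eq_mul]
  have hrange : ∀ ξ : Fin n → ℝ, ξ ≠ 0 → ∃ v : Fin d → ℝ, (P.map (eval ξ)).mulVec v = l := by
    intro ξ hξ
    by_contra hcon
    push Not at hcon
    have hnot : l ∉ LinearMap.range (Matrix.mulVecLin (P.map (eval ξ))) := by
      rintro ⟨v, hv⟩; exact hcon v hv
    obtain ⟨g, hg1, hg2⟩ := Submodule.exists_le_ker_of_notMem hnot
    set w : Fin q → ℝ := fun b => g (Pi.single b 1) with hw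
    have hgw : ∀ y, g y = ∑ b, y b * w b := by
      intro y
      conv_lhs => rw [← Finset.univ_sum_single y]
      rw [map_sum]
      refine Finset.sum_congr rfl fun b _ => ?_
      have : (Pi.single b (y b) : Fin q → ℝ) = y b • Pi.single b 1 := by
        rw [← Pi.single_smul]; simp
      rw [this, map_smul, smul_eq_mul]
    have hwS : w ∈ S := by
      apply Submodule.subset_span
      refine ⟨ξ, hξ, fun a => ?_⟩
      have : g ((P.map (eval ξ)).mulVec (Pi.single a 1)) = 0 := hg2 ⟨Pi.single a 1, rfl⟩
      rw [hgw] at this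
      rw [← this]
      refine Finset.sum_congr rfl fun b _ => ?_
      simp [mul_comm]
    have h0 := hfS hwS
    rw [LinearMap.mem_ker, hfl] at h0
    apply hg1
    rw [hgw, ← h0]
    exact Finset.sum_congr rfl fun b _ => mul_comm _ _
  have hn0 : 0 < n := by omega
  let i0 : Fin n := ⟨0, hn0⟩
  let i1 : Fin n := ⟨1, hn⟩
  have h01 : i0 ≠ i1 := by simp [i0, i1]
  obtain ⟨Q0, hQ0h, hQ0⟩ := hK K (by omega) (fun _ => i0)
  obtain ⟨Q1, hQ1h, hQ1⟩ := hK K (by omega) (fun _ => i1)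
  let g : Fin n → Polynomial ℝ := fun i => if i = i0 then Polynomial.X else if i = i1 then 1 else 0
  have hg : ∀ s i, (g i).eval s = if i = i0 then s else if i = i1 then 1 else 0 := by
    intro s i
    simp only [g]; split_ifs <;> simp
  let pt : ℝ → Fin n → ℝ := fun s i => (g i).eval s
  have hpt0 : ∀ s, pt s i0 = s := by intro s; simp [pt, hg]
  have hpt1 : ∀ s, pt s i1 = 1 := by intro s; simp [pt, hg, h01.symm]
  have hev : ∀ s (F : MvPolynomial (Fin n) ℝ), eval (pt s) F = (aeval g F).eval s := by
    intro s F
    have := congrArg (fun φ => φ F) (MvPolynomial.algHom_ext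
      (f := (MvPolynomial.aeval (pt s) : MvPolynomial (Fin n) ℝ →ₐ[ℝ] ℝ))
      (g := (Polynomial.aeval s : Polynomial ℝ →ₐ[ℝ] ℝ).comp (aeval g)) (by intro i; simp [pt, Polynomial.aeval_def, Polynomial.eval₂_eq_eval_map]))
    simpa [MvPolynomial.aeval_eq_eval, Polynomial.aeval_def, Polynomial.eval₂_eq_eval_map] using this
  have key : ∀ (Q : Matrix (Fin d) (Fin q) (MvPolynomial (Fin n) ℝ)) (i : Fin n)
      (hQ : Q * P = (∏ _j : Fin (K + k), X i : MvPolynomial (Fin n) ℝ) • (1 : Matrix (Fin d) (Fin d) _))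
      (ξ : Fin n → ℝ) (v : Fin d → ℝ) (_ : (P.map (eval ξ)).mulVec v = l) (a : Fin d),
      ξ i ^ (K + k) * v a = ∑ b, eval ξ (Q a b) * l b := by
    intro Q i hQ ξ v hv a
    have h1 : (Q.map (eval ξ)) * (P.map (eval ξ)) = (ξ i ^ (K+k)) • (1 : Matrix (Fin d) (Fin d) ℝ) := by
      have := congrArg (fun M : Matrix (Fin d) (Fin d) (MvPolynomial (Fin n) ℝ) => M.map (eval ξ)) hQ
      rw [← Matrix.map_mul]
      refine this.trans ?_
      ext x y
      by_cases hxy : x = y <;> simp [hxy]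
    have h2 := congrArg (fun M => M.mulVec v) h1
    rw [← Matrix.mulVec_mulVec, hv, Matrix.smul_mulVec, Matrix.one_mulVec] at h2
    have := congrFun h2 a
    simp only [Pi.smul_apply, smul_eq_mul] at this
    rw [← this]
    rfl
  have hpoly : ∀ a, ∑ b, aeval g (Q1 a b) * Polynomial.C (l b) = 0 := by
    intro a
    set p : Polynomial ℝ := ∑ b, aeval g (Q1 a b) * Polynomial.C (l b)
    set r : Polynomial ℝ := ∑ b, aeval g (Q0 a b) * Polynomial.C (l b)
    have hr : r.natDegree ≤ K := by
      apply Polynomial.natDegree_sum_le_of_forall_le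
      intro b _
      refine (Polynomial.natDegree_mul_C_le _ _).trans ?_
      have := aeval_natDegree_le (m := K) (n := 1) (Q0 a b) (hQ0h a b).totalDegree_le g (by
        intro i; simp only [g]; split_ifs <;> simp)
      simpa using this
    have heq : Polynomial.X ^ (K + k) * p = r := by
      apply Polynomial.funext
      intro s
      obtain ⟨v, hv⟩ := hrange (pt s) (by
        intro h; have := congrFun h i1; rw [hpt1] at this; simp at this)
      have e0 := key Q0 i0 hQ0 _ v hv a
      have e1 := key Q1 i1 hQ1 _ v hv a
      rw [hpt0] at e0
      rw [hpt1, one_pow, one_mul] at e1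
      rw [e1] at e0
      simp only [hev] at e0
      simpa [p, r, Polynomial.eval_finsetSum] using e0
    by_contra hp0
    have := Polynomial.natDegree_X_pow_mul (n := K + k) hp0
    rw [heq] at this
    omega
  obtain ⟨v, hv⟩ := hrange (pt 0) (by
    intro h; have := congrFun h i1; rw [hpt1] at this; simp at this)
  have hv0 : v = 0 := by
    ext a
    have e1 := key Q1 i1 hQ1 _ v hv a
    rw [hpt1, one_pow, one_mul] at e1
    rw [e1]
    have := congrArg (Polynomial.eval 0) (hpoly a)
    simp only [hev]
    simpa [Polynomial.eval_finsetSum] using this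
  have hl0 : l = 0 := by rw [← hv, hv0, Matrix.mulVec_zero]
  apply hf0
  ext b
  have := congrFun hl0 b
  simpa [hl] using this

/-- Tangential decomposition. -/
theorem alg_tangent {n k : ℕ} (e : Fin n → ℝ) (p : MvPolynomial (Fin n) ℝ)
    (hp : p.IsHomogeneous (k + 1)) (he : eval e p = 0) :
    ∃ S : Fin n → MvPolynomial (Fin n) ℝ, (∀ i, (S i).IsHomogeneous k) ∧
      p = ∑ i, (X i - C (e i) * ∑ j, C (e j) * X j) * S i := by
  set Y : MvPolynomial (Fin n) ℝ := ∑ j, C (e j) * X j with hY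
  have hYh : Y.IsHomogeneous 1 := by
    apply IsHomogeneous.sum
    intro j _
    simpa using (isHomogeneous_C (Fin n) (e j)).mul (isHomogeneous_X ℝ j)
  have hgen : ∀ r : MvPolynomial (Fin n) ℝ, ∃ S : Fin n → MvPolynomial (Fin n) ℝ,
      r - aeval (fun i => C (e i) * Y) r = ∑ i, (X i - C (e i) * Y) * S i := by
    intro r
    induction r using MvPolynomial.induction_on with
    | C a => exact ⟨0, by simp [MvPolynomial.algebraMap_eq]⟩
    | add f g hf hg =>
      obtain ⟨S, hS⟩ := hf
      obtain ⟨T, hT⟩ := hg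
      refine ⟨S + T, ?_⟩
      simp only [map_add, Pi.add_apply, mul_add, Finset.sum_add_distrib, ← hS, ← hT]
      ring
    | mul_X f i hf =>
      obtain ⟨S, hS⟩ := hf
      refine ⟨fun j => S j * (C (e i) * Y) + if j = i then f else 0, ?_⟩
      simp only [map_mul, aeval_X, mul_add, Finset.sum_add_distrib, mul_ite, mul_zero,
        Finset.sum_ite_eq', Finset.mem_univ, if_true, ← mul_assoc, ← Finset.sum_mul]
      rw [← hS]
      ring
  obtain ⟨S, hS⟩ := hgen p
  have hz : aeval (fun i => C (e i) * Y) p = 0 := by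
    have : ∀ m ∈ p.support, m.degree = k + 1 := by
      intro m hm
      have := hp (mem_support_iff.1 hm)
      rw [Finsupp.degree_eq_weight_one (R := ℕ)]; exact this
    have h1 : aeval (fun i => C (e i) * Y) p = C (eval e p) * Y ^ (k + 1) := by
      rw [aeval_def, eval₂_eq, eval_eq, map_sum, Finset.sum_mul]
      refine Finset.sum_congr rfl fun m hm => ?_
      have h2 : ∏ i ∈ m.support, (C (e i) * Y) ^ m i =
          C (∏ i ∈ m.support, e i ^ m i) * Y ^ (k + 1) := by
        simp only [mul_pow, Finset.prod_mul_distrib, map_prod, map_pow]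
        rw [Finset.prod_pow_eq_pow_sum, ← this m hm]
        rfl
      rw [h2, map_mul, algebraMap_eq, mul_assoc]
    rw [h1, he]; simp
  rw [hz, sub_zero] at hS
  refine ⟨fun i => homogeneousComponent k (S i), fun i => homogeneousComponent_isHomogeneous _ _, ?_⟩
  have h1 := congrArg (homogeneousComponent (1 + k)) hS
  rw [homogeneousComponent_of_mem hp, if_pos (add_comm _ _), map_sum] at h1
  rw [h1]
  refine Finset.sum_congr rfl fun i _ => ?_
  apply hc_mul
  apply IsHomogeneous.sub (isHomogeneous_X _ _)
  simpa using (isHomogeneous_C (Fin n) (e i)).mul hYh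

end

noncomputable section
open MeasureTheory Metric MvPolynomial
open scoped ENNReal RealInnerProductSpace ContDiff

/-- Smooth real functions. -/
def Sm (n : ℕ) : Submodule ℝ (Euc n → ℝ) where
  carrier := {f | ContDiff ℝ ∞ f}
  add_mem' := fun {f g} (hf : ContDiff ℝ ∞ f) (hg : ContDiff ℝ ∞ g) => hf.add hg
  zero_mem' := (contDiff_const : ContDiff ℝ ∞ fun _ : Euc n => (0:ℝ))
  smul_mem' := fun c f (hf : ContDiff ℝ ∞ f) => hf.const_smul c

theorem sm_cd {n : ℕ} (φ : Sm n) : ContDiff ℝ ∞ φ.1 := φ.2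

theorem sm_cont {n : ℕ} (φ : Sm n) : Continuous φ.1 := (sm_cd φ).continuous

theorem sm_diff {n : ℕ} (φ : Sm n) : Differentiable ℝ φ.1 :=
  (sm_cd φ).differentiable (by simp)

/-- Directional derivative. -/
def pdv {n : ℕ} (v : Euc n) : Sm n →ₗ[ℝ] Sm n where
  toFun φ := ⟨fun x => fderiv ℝ φ.1 x v, by
    have h : ContDiff ℝ ∞ (fderiv ℝ φ.1) := (sm_cd φ).fderiv_right (by simp)
    exact h.clm_apply contDiff_const⟩
  map_add' φ ψ := by
    ext x
    have := fderiv_add (sm_diff φ x) (sm_diff ψ x)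
    change fderiv ℝ (φ.1 + ψ.1) x v = _
    rw [this]; rfl
  map_smul' c φ := by
    ext x
    have := fderiv_const_smul (sm_diff φ x) c
    change fderiv ℝ (c • φ.1) x v = _
    rw [this]; rfl

theorem pdv_apply {n : ℕ} (v : Euc n) (φ : Sm n) (x : Euc n) :
    (pdv v φ).1 x = fderiv ℝ φ.1 x v := rfl

theorem pdv_comm {n : ℕ} (v w : Euc n) : (pdv v) * (pdv w) = (pdv w : Module.End ℝ (Sm n)) * (pdv v) := by
  ext φ x
  change fderiv ℝ (fun y => fderiv ℝ φ.1 y w) x v = fderiv ℝ (fun y => fderiv ℝ φ.1 y v) x w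
  have h : ContDiff ℝ ∞ (fderiv ℝ φ.1) := (sm_cd φ).fderiv_right (by simp)
  have hd : DifferentiableAt ℝ (fderiv ℝ φ.1) x := (h.differentiable (by simp)) x
  rw [fderiv_clm_apply hd (differentiableAt_const _), fderiv_clm_apply hd (differentiableAt_const _)]
  have hs : IsSymmSndFDerivAt ℝ φ.1 x := (sm_cd φ).contDiffAt.isSymmSndFDerivAt (by simp; exact WithTop.coe_le_coe.2 le_top)
  simpa using hs v w

/-- coordinate vector -/
def ev {n : ℕ} (i : Fin n) : Euc n := EuclideanSpace.single i 1

open scoped IsMulCommutative in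
theorem dOp_exists (n : ℕ) : ∃ D : MvPolynomial (Fin n) ℝ →ₐ[ℝ] Module.End ℝ (Sm n),
    ∀ i, D (X i) = pdv (ev i) := by
  let s : Set (Module.End ℝ (Sm n)) := Set.range fun i : Fin n => pdv (ev i)
  have hc : ∀ a ∈ s, ∀ b ∈ s, a * b = b * a := by
    rintro _ ⟨i, rfl⟩ _ ⟨j, rfl⟩
    exact pdv_comm _ _
  have : IsMulCommutative (Algebra.adjoin ℝ s) := Algebra.isMulCommutative_adjoin ℝ hc
  let g : Fin n → Algebra.adjoin ℝ s := fun i => ⟨pdv (ev i), Algebra.subset_adjoin ⟨i, rfl⟩⟩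
  refine ⟨(Algebra.adjoin ℝ s).val.comp (aeval g), fun i => ?_⟩
  simp [g]

/-- Constant coefficient differential operator. -/
def dOp {n : ℕ} : MvPolynomial (Fin n) ℝ →ₐ[ℝ] Module.End ℝ (Sm n) := (dOp_exists n).choose

theorem dOp_X {n : ℕ} (i : Fin n) : dOp (X i) = pdv (ev i) := (dOp_exists n).choose_spec i

theorem dOp_mul {n : ℕ} (p q : MvPolynomial (Fin n) ℝ) (φ : Sm n) :
    dOp (p * q) φ = dOp p (dOp q φ) := by rw [map_mul]; rfl

theorem dOp_add {n : ℕ} (p q : MvPolynomial (Fin n) ℝ) (φ : Sm n) :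
    dOp (p + q) φ = dOp p φ + dOp q φ := by rw [map_add]; rfl

theorem dOp_C {n : ℕ} (c : ℝ) (φ : Sm n) :
    dOp (C c) φ = c • φ := by
  have : (C c : MvPolynomial (Fin n) ℝ) = algebraMap ℝ _ c := rfl
  rw [this, AlgHom.commutes]; rfl

theorem dOp_sum {n : ℕ} {ι : Type*} (s : Finset ι) (p : ι → MvPolynomial (Fin n) ℝ) (φ : Sm n) :
    dOp (∑ i ∈ s, p i) φ = ∑ i ∈ s, dOp (p i) φ := by
  rw [map_sum, LinearMap.sum_apply]

theorem sm_sum_apply {n : ℕ} {ι : Type*} (s : Finset ι) (p : ι → Sm n) (x : Euc n) :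
    (∑ i ∈ s, p i).1 x = ∑ i ∈ s, (p i).1 x := by
  have : (∑ i ∈ s, p i).1 = ∑ i ∈ s, (p i).1 := map_sum (Sm n).subtype p s
  rw [this, Finset.sum_apply]

theorem pdv_add {n : ℕ} (v w : Euc n) : pdv (v + w) = pdv v + pdv w := by
  ext φ x; simp [pdv_apply]

theorem pdv_smul {n : ℕ} (c : ℝ) (w : Euc n) : pdv (c • w) = c • pdv w := by
  ext φ x; simp [pdv_apply]

theorem dOp_lin {n : ℕ} (h : Euc n) : dOp (∑ i, C (h i) * X i) = pdv h := by
  have h1 : h = ∑ i, h i • ev i := by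
    ext j; simp [ev, Finset.sum_apply, Pi.single_apply]
  have h2 : pdv h = ∑ i, h i • pdv (ev i) := by
    conv_lhs => rw [h1]
    let L : Euc n →ₗ[ℝ] Module.End ℝ (Sm n) := ⟨⟨pdv, pdv_add⟩, pdv_smul⟩
    have : ∀ v, L v = pdv v := fun _ => rfl
    simp only [← this, map_sum, map_smul]
  rw [h2, map_sum]
  refine Finset.sum_congr rfl fun i _ => ?_
  rw [map_mul, dOp_X]
  ext φ x
  simp [pdv_apply]

end

noncomputable section
open MeasureTheory Metric MvPolynomial
open scoped ENNReal RealInnerProductSpace ContDiff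

/-- Smooth kernels, compactly supported in the second variable. -/
structure IsKer {n : ℕ} (c : Euc n) (r : ℝ) (Θ : Euc n → Euc n → ℝ) : Prop where
  smooth : ContDiff ℝ ∞ (Function.uncurry Θ)
  supp : ∀ x z, z ∉ closedBall c r → Θ x z = 0

theorem ker_cd {n : ℕ} {c : Euc n} {r : ℝ} {Θ : Euc n → Euc n → ℝ} (h : IsKer c r Θ) (x : Euc n) :
    ContDiff ℝ ∞ (Θ x) :=
  h.smooth.comp (contDiff_const.prodMk contDiff_id : ContDiff ℝ ∞ fun z : Euc n => (x, z))

theorem ker_cs {n : ℕ} {c : Euc n} {r : ℝ} {Θ : Euc n → Euc n → ℝ} (h : IsKer c r Θ) (x : Euc n) :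
    HasCompactSupport (Θ x) :=
  HasCompactSupport.intro (isCompact_closedBall c r) (h.supp x)

theorem ker_int {n : ℕ} {c : Euc n} {r : ℝ} {Θ : Euc n → Euc n → ℝ} (h : IsKer c r Θ) (x : Euc n)
    {g : Euc n → ℝ} (hg : Continuous g) : Integrable (fun z => Θ x z * g z) :=
  Continuous.integrable_of_hasCompactSupport ((ker_cd h x).continuous.mul hg) (ker_cs h x).mul_right

theorem ker_add {n : ℕ} {c : Euc n} {r : ℝ} {Θ Θ' : Euc n → Euc n → ℝ} (h : IsKer c r Θ)
    (h' : IsKer c r Θ') : IsKer c r (fun x z => Θ x z + Θ' x z) where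
  smooth := h.smooth.add h'.smooth
  supp x z hz := by simp [h.supp x z hz, h'.supp x z hz]

theorem ker_sum {n : ℕ} {c : Euc n} {r : ℝ} {ι : Type*} (s : Finset ι)
    {Θ : ι → Euc n → Euc n → ℝ} (h : ∀ i ∈ s, IsKer c r (Θ i)) :
    IsKer c r (fun x z => ∑ i ∈ s, Θ i x z) where
  smooth := by
    have : Function.uncurry (fun x z => ∑ i ∈ s, Θ i x z) = fun p => ∑ i ∈ s, Function.uncurry (Θ i) p := by
      ext p; rfl
    rw [this]
    exact ContDiff.sum fun i hi => (h i hi).smooth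
  supp x z hz := Finset.sum_eq_zero fun i hi => (h i hi).supp x z hz

theorem ker_smul {n : ℕ} {c : Euc n} {r : ℝ} {Θ : Euc n → Euc n → ℝ} (h : IsKer c r Θ)
    (a : ℝ) : IsKer c r (fun x z => a * Θ x z) where
  smooth := contDiff_const.mul h.smooth
  supp x z hz := by simp [h.supp x z hz]

theorem ker_zero {n : ℕ} (c : Euc n) (r : ℝ) : IsKer c r (fun _ _ => 0) where
  smooth := contDiff_const
  supp _ _ _ := rfl

theorem ker_coord {n : ℕ} {c : Euc n} {r : ℝ} {Θ : Euc n → Euc n → ℝ} (h : IsKer c r Θ)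
    (i : Fin n) : IsKer c r (fun x z => Θ x z * (x - z) i) where
  smooth := by
    refine h.smooth.mul ?_
    have h1 : ContDiff ℝ ∞ (fun p : Euc n × Euc n => p.1 - p.2) := contDiff_fst.sub contDiff_snd
    exact (EuclideanSpace.proj (𝕜 := ℝ) i).contDiff.comp h1
  supp x z hz := by simp [h.supp x z hz]

theorem ker_coords {n : ℕ} {c : Euc n} {r : ℝ} {Θ : Euc n → Euc n → ℝ} (h : IsKer c r Θ)
    {j : ℕ} (α : Fin j → Fin n) : IsKer c r (fun x z => Θ x z * ∏ l, (x - z) (α l)) where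
  smooth := by
    refine h.smooth.mul ?_
    have h1 : ContDiff ℝ ∞ (fun p : Euc n × Euc n => p.1 - p.2) := contDiff_fst.sub contDiff_snd
    exact contDiff_prod fun l _ => (EuclideanSpace.proj (𝕜 := ℝ) (α l)).contDiff.comp h1
  supp x z hz := by simp [h.supp x z hz]

theorem ker_deriv {n : ℕ} {c : Euc n} {r : ℝ} {Θ : Euc n → Euc n → ℝ} (h : IsKer c r Θ)
    (v : Euc n) : IsKer c r (fun x z => fderiv ℝ (Θ x) z v) where
  smooth := by
    have h1 : ContDiff ℝ ∞ (fun p : Euc n × Euc n => fderiv ℝ (Θ p.1) p.2) := by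
      refine ContDiff.fderiv (f := fun p : Euc n × Euc n => Θ p.1) (m := ∞) ?_ contDiff_snd (by simp)
      exact h.smooth.comp ((contDiff_fst.comp contDiff_fst).prodMk contDiff_snd)
    exact h1.clm_apply contDiff_const
  supp x z hz := by
    have : Θ x =ᶠ[nhds z] fun _ => 0 := by
      filter_upwards [isClosed_closedBall.isOpen_compl.mem_nhds hz] with y hy
      exact h.supp x y hy
    rw [this.fderiv_eq]; simp

theorem ker_bound {n : ℕ} {c : Euc n} {r : ℝ} {Θ : Euc n → Euc n → ℝ} (h : IsKer c r Θ) :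
    ∃ C : ℝ, 0 ≤ C ∧ ∀ x ∈ closedBall (0 : Euc n) 1, ∀ z, |Θ x z| ≤ C := by
  obtain ⟨C, hC⟩ := ((isCompact_closedBall (0 : Euc n) 1).prod (isCompact_closedBall c r)).exists_bound_of_continuousOn
    h.smooth.continuous.continuousOn
  refine ⟨max C 0, le_max_right _ _, fun x hx z => ?_⟩
  by_cases hz : z ∈ closedBall c r
  · exact (hC (x, z) ⟨hx, hz⟩).trans (le_max_left _ _)
  · rw [h.supp x z hz]; simp

theorem seg_cont {n : ℕ} (x : Euc n) (ρ : ℝ) : Continuous fun z : Euc n => x + ρ • (z - x) := by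
  fun_prop

theorem ker_parts {n : ℕ} {c : Euc n} {r : ℝ} {Θ : Euc n → Euc n → ℝ} (h : IsKer c r Θ)
    (v : Euc n) (φ : Sm n) (x : Euc n) (ρ : ℝ) :
    ρ * ∫ z, Θ x z * (pdv v φ).1 (x + ρ • (z - x)) =
      ∫ z, (-1 * fderiv ℝ (Θ x) z v) * φ.1 (x + ρ • (z - x)) := by
  have hd : ∀ z, HasFDerivAt (fun z => φ.1 (x + ρ • (z - x)))
      (ρ • fderiv ℝ φ.1 (x + ρ • (z - x))) z := by
    intro z
    have h1 : HasFDerivAt (fun z : Euc n => x + ρ • (z - x)) (ρ • ContinuousLinearMap.id ℝ (Euc n)) z :=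
      (((hasFDerivAt_id z).sub_const x).const_smul ρ).const_add x
    have h2 := (sm_diff φ (x + ρ • (z - x))).hasFDerivAt.comp z h1
    have h3 : (fderiv ℝ φ.1 (x + ρ • (z - x))).comp (ρ • ContinuousLinearMap.id ℝ (Euc n)) =
        ρ • fderiv ℝ φ.1 (x + ρ • (z - x)) := by
      ext w; simp
    rw [h3] at h2
    exact h2
  have key := integral_mul_fderiv_eq_neg_fderiv_mul_of_integrable (μ := volume) (v := v)
    (f := Θ x) (g := fun z => φ.1 (x + ρ • (z - x)))
    (ker_int (ker_deriv h v) x ((sm_cont φ).comp (seg_cont x ρ)))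
    (by
      have := (ker_int h x ((sm_cont (pdv v φ)).comp (seg_cont x ρ))).const_mul ρ
      refine this.congr (Filter.Eventually.of_forall fun z => ?_)
      simp only [(hd z).fderiv, Function.comp, pdv_apply]
      simp; ring)
    (ker_int h x ((sm_cont φ).comp (seg_cont x ρ)))
    (fun z _ => (ker_cd h x).differentiable (by simp) z) (fun z _ => (hd z).differentiableAt)
  rw [← integral_const_mul]
  simp only [neg_mul, one_mul, integral_neg]
  rw [← key]
  refine integral_congr_ae (Filter.Eventually.of_forall fun z => ?_)
  simp only [(hd z).fderiv, pdv_apply]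
  simp; ring

/-- integration by parts predicate -/
def GoodP {n : ℕ} (c : Euc n) (r : ℝ) (N : ℕ) (p : MvPolynomial (Fin n) ℝ) : Prop :=
  ∀ Θ, IsKer c r Θ → ∃ Θ', IsKer c r Θ' ∧ ∀ (φ : Sm n) (x : Euc n) (ρ : ℝ),
    ρ ^ N * ∫ z, Θ x z * (dOp p φ).1 (x + ρ • (z - x)) = ∫ z, Θ' x z * φ.1 (x + ρ • (z - x))

theorem goodP_sum {n : ℕ} {c : Euc n} {r : ℝ} {N : ℕ} {ι : Type*} (s : Finset ι)
    (p : ι → MvPolynomial (Fin n) ℝ)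
    (h : ∀ i ∈ s, GoodP c r N (p i)) : GoodP c r N (∑ i ∈ s, p i) := by
  intro Θ hΘ
  have : ∀ i, ∃ Θ', IsKer c r Θ' ∧ (i ∈ s → ∀ (φ : Sm n) (x : Euc n) (ρ : ℝ),
    ρ ^ N * ∫ z, Θ x z * (dOp (p i) φ).1 (x + ρ • (z - x)) = ∫ z, Θ' x z * φ.1 (x + ρ • (z - x))) := by
    intro i
    by_cases hi : i ∈ s
    · obtain ⟨Θ', h1, h2⟩ := h i hi Θ hΘ
      exact ⟨Θ', h1, fun _ => h2⟩
    · exact ⟨_, ker_zero c r, fun h => absurd h hi⟩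
  choose Θ' h1 h2 using this
  refine ⟨_, ker_sum s fun i _ => h1 i, fun φ x ρ => ?_⟩
  simp only [dOp_sum, sm_sum_apply, Finset.mul_sum, Finset.sum_mul]
  rw [integral_finsetSum, integral_finsetSum, Finset.mul_sum]
  · exact Finset.sum_congr rfl fun i hi => h2 i hi φ x ρ
  · intro i _; exact ker_int (h1 i) x ((sm_cont φ).comp (seg_cont x ρ))
  · intro i _; exact ker_int hΘ x ((sm_cont (dOp (p i) φ)).comp (seg_cont x ρ))

theorem goodP_C {n : ℕ} {c : Euc n} {r : ℝ} {N : ℕ} (a : ℝ)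
    {p : MvPolynomial (Fin n) ℝ}
    (h : GoodP c r N p) : GoodP c r N (C a * p) := by
  intro Θ hΘ
  obtain ⟨Θ', h1, h2⟩ := h _ hΘ
  refine ⟨_, ker_smul h1 a, fun φ x ρ => ?_⟩
  have e1 : ∀ z, Θ x z * (dOp (C a * p) φ).1 (x + ρ • (z - x)) =
      a * (Θ x z * (dOp p φ).1 (x + ρ • (z - x))) := by
    intro z; rw [dOp_mul, dOp_C]
    change _ * (a * _) = _
    ring
  simp only [e1, mul_assoc, integral_const_mul]
  rw [← h2]; ring

theorem goodP_one {n : ℕ} {c : Euc n} {r : ℝ} : GoodP c r 0 (1 : MvPolynomial (Fin n) ℝ) := by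
  intro Θ hΘ
  exact ⟨Θ, hΘ, fun φ x ρ => by simp⟩

theorem goodP_X {n : ℕ} {c : Euc n} {r : ℝ} {N : ℕ} (i : Fin n)
    {p : MvPolynomial (Fin n) ℝ}
    (h : GoodP c r N p) : GoodP c r (N + 1) (X i * p) := by
  intro Θ hΘ
  obtain ⟨Θ', h1, h2⟩ := h _ (ker_smul (ker_deriv hΘ (ev i)) (-1))
  refine ⟨Θ', h1, fun φ x ρ => ?_⟩
  rw [← h2, pow_succ, mul_assoc, ← ker_parts hΘ, dOp_mul, dOp_X]

theorem goodP_monomial {n : ℕ} {c : Euc n} {r : ℝ} {N : ℕ} : ∀ (s : Fin n →₀ ℕ),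
    s.degree = N → GoodP c r N (monomial s (1:ℝ)) := by
  induction N with
  | zero =>
    intro s hs
    have : s = 0 := (Finsupp.degree_eq_zero_iff s).1 hs
    subst this
    exact goodP_one
  | succ N ih =>
    intro s hs
    have : ∃ i, s i ≠ 0 := by
      by_contra! h
      have : s = 0 := by ext i; simp [h i]
      subst this; simp at hs
    obtain ⟨i, hi⟩ := this
    have hs' : s = Finsupp.single i 1 + (s - Finsupp.single i 1) := by
      ext j
      by_cases hj : i = j
      · subst hj; simp; omega
      · simp [Finsupp.single_apply, hj]
    have hm : monomial s (1:ℝ) = X i * monomial (s - Finsupp.single i 1) (1:ℝ) := by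
      conv_lhs => rw [hs']
      rw [X, monomial_mul]; simp
    rw [hm]
    refine goodP_X i (ih _ ?_)
    have := congrArg Finsupp.degree hs'
    simp only [map_add, Finsupp.degree_single] at this
    omega

theorem goodP_hom {n : ℕ} (c : Euc n) (r : ℝ) {N : ℕ} {p : MvPolynomial (Fin n) ℝ}
    (hp : p.IsHomogeneous N) : GoodP c r N p := by
  rw [p.as_sum]
  refine goodP_sum _ _ fun s hs => ?_
  have : monomial s (coeff s p) = C (coeff s p) * monomial s (1:ℝ) := by
    rw [C_mul_monomial, mul_one]
  rw [this]
  refine goodP_C _ (goodP_monomial s ?_)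
  have := hp (mem_support_iff.1 hs)
  rw [Finsupp.degree_eq_weight_one (R := ℕ)]; exact this

end

noncomputable section
open MeasureTheory Metric MvPolynomial
open scoped ENNReal RealInnerProductSpace ContDiff

/-- linear form -/
def linP {n : ℕ} (h : Euc n) : MvPolynomial (Fin n) ℝ := ∑ i, C (h i) * X i

theorem dOp_linP_pow {n : ℕ} (h : Euc n) (l : ℕ) (φ : Sm n) (y : Euc n) :
    (dOp (linP h ^ l) φ).1 y = ∑ α : Fin l → Fin n, (∏ i, h (α i)) * (dOp (∏ i, X (α i)) φ).1 y := by
  have : linP h ^ l = ∑ α : Fin l → Fin n, C (∏ i, h (α i)) * ∏ i, X (α i) := by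
    rw [linP, Fintype.sum_pow]
    refine Finset.sum_congr rfl fun α _ => ?_
    rw [Finset.prod_mul_distrib, map_prod]
  rw [this, dOp_sum, sm_sum_apply]
  refine Finset.sum_congr rfl fun α _ => ?_
  rw [dOp_mul, dOp_C]; rfl

theorem seg_deriv {n : ℕ} (φ : Sm n) (x z : Euc n) (l : ℕ) (ρ : ℝ) :
    HasDerivAt (fun ρ : ℝ => (dOp (linP (x - z) ^ l) φ).1 (x + ρ • (z - x)))
      (-(dOp (linP (x - z) ^ (l + 1)) φ).1 (x + ρ • (z - x))) ρ := by
  set ψ := dOp (linP (x - z) ^ l) φ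
  have h1 : HasDerivAt (fun ρ : ℝ => x + ρ • (z - x)) (z - x) ρ := by
    simpa using ((hasDerivAt_id ρ).smul_const (z - x)).const_add x
  have h2 := (sm_diff ψ (x + ρ • (z - x))).hasFDerivAt.comp_hasDerivAt ρ h1
  have h3 : dOp (linP (x - z) ^ (l + 1)) φ = pdv (x - z) ψ := by
    rw [pow_succ', dOp_mul]
    have : dOp (linP (x - z)) = pdv (x - z) := dOp_lin _
    rw [this]
  rw [h3, pdv_apply]
  have h4 : -(fderiv ℝ ψ.1 (x + ρ • (z - x))) (x - z) = (fderiv ℝ ψ.1 (x + ρ • (z - x))) (z - x) := by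
    rw [← map_neg, neg_sub]
  rw [h4]
  exact h2

theorem seg_sum_deriv {n : ℕ} (φ : Sm n) (x z : Euc n) (j : ℕ) (ρ : ℝ) :
    HasDerivAt (fun ρ : ℝ => ∑ l ∈ Finset.range (j + 1),
        (ρ ^ l / (l.factorial : ℝ)) * (dOp (linP (x - z) ^ l) φ).1 (x + ρ • (z - x)))
      (-((ρ ^ j / (j.factorial : ℝ)) * (dOp (linP (x - z) ^ (j + 1)) φ).1 (x + ρ • (z - x)))) ρ := by
  induction j with
  | zero => simpa using seg_deriv φ x z 0 ρ
  | succ j ih =>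
    have h1 : HasDerivAt (fun ρ : ℝ => ρ ^ (j + 1) / ((j + 1).factorial : ℝ))
        (ρ ^ j / (j.factorial : ℝ)) ρ := by
      have := (hasDerivAt_pow (j + 1) ρ).div_const ((j + 1).factorial : ℝ)
      refine this.congr_deriv ?_
      rw [Nat.factorial_succ]; push_cast
      have : (j.factorial : ℝ) ≠ 0 := by positivity
      field_simp
    have h2 := ih.add (h1.mul (seg_deriv φ x z (j + 1) ρ))
    have h3 : (fun ρ : ℝ => ∑ l ∈ Finset.range (j + 1 + 1),
        (ρ ^ l / (l.factorial : ℝ)) * (dOp (linP (x - z) ^ l) φ).1 (x + ρ • (z - x))) =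
        (fun ρ : ℝ => ∑ l ∈ Finset.range (j + 1),
        (ρ ^ l / (l.factorial : ℝ)) * (dOp (linP (x - z) ^ l) φ).1 (x + ρ • (z - x))) +
        ((fun ρ : ℝ => ρ ^ (j + 1) / ((j + 1).factorial : ℝ)) *
          fun ρ : ℝ => (dOp (linP (x - z) ^ (j + 1)) φ).1 (x + ρ • (z - x))) := by
      ext ρ; simp [Finset.sum_range_succ]
    rw [h3]
    refine h2.congr_deriv ?_
    ring

theorem seg_cont2 {n : ℕ} (x z : Euc n) : Continuous fun ρ : ℝ => x + ρ • (z - x) := by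
  fun_prop

theorem taylor {n : ℕ} (φ : Sm n) (x z : Euc n) (j : ℕ) :
    φ.1 x = (∑ l ∈ Finset.range (j + 1),
        (1 / (l.factorial : ℝ)) * (dOp (linP (x - z) ^ l) φ).1 z) +
      ∫ ρ in (0:ℝ)..1, (ρ ^ j / (j.factorial : ℝ)) *
        (dOp (linP (x - z) ^ (j + 1)) φ).1 (x + ρ • (z - x)) := by
  have hc : Continuous fun ρ : ℝ => (ρ ^ j / (j.factorial : ℝ)) *
        (dOp (linP (x - z) ^ (j + 1)) φ).1 (x + ρ • (z - x)) :=
    ((continuous_pow j).div_const _).mul ((sm_cont _).comp (seg_cont2 x z))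
  have h := intervalIntegral.integral_eq_sub_of_hasDerivAt (a := 0) (b := 1)
    (fun ρ _ => seg_sum_deriv φ x z j ρ) (hc.neg.intervalIntegrable 0 1)
  rw [intervalIntegral.integral_neg] at h
  have h0 : ∑ l ∈ Finset.range (j + 1), ((0:ℝ) ^ l / (l.factorial : ℝ)) *
      (dOp (linP (x - z) ^ l) φ).1 (x + (0:ℝ) • (z - x)) = φ.1 x := by
    rw [Finset.sum_eq_single 0]
    · simp
    · intro l _ hl; simp [hl]
    · simp
  rw [h0] at h
  simp only [one_pow, one_smul, add_sub_cancel] at h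
  linarith

theorem exists_bump {n : ℕ} (c : Euc n) {r : ℝ} (hr : 0 < r) :
    ∃ θ : Euc n → ℝ, IsKer c r (fun _ z => θ z) ∧ ∫ z, θ z = 1 := by
  let f : ContDiffBump c := ⟨r / 2, r, by positivity, by linarith⟩
  refine ⟨f.normed volume, ⟨?_, ?_⟩, f.integral_normed⟩
  · exact (f.contDiff_normed (n := (⊤ : ℕ∞))).comp contDiff_snd
  · intro x z hz
    have : z ∉ Function.support (f.normed volume) := by
      rw [f.support_normed_eq]
      intro h; exact hz (ball_subset_closedBall h)
    simpa using this

theorem ker_swap {n : ℕ} {c : Euc n} {r : ℝ} {Θ : Euc n → Euc n → ℝ} (h : IsKer c r Θ) (x : Euc n)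
    {g : ℝ → Euc n → ℝ} (hg : Continuous (Function.uncurry g)) :
    ∫ z, Θ x z * (∫ ρ in (0:ℝ)..1, g ρ z) = ∫ ρ in (0:ℝ)..1, ∫ z, Θ x z * g ρ z := by
  simp only [← intervalIntegral.integral_const_mul]
  have hI : Integrable (Function.uncurry fun (ρ : ℝ) (z : Euc n) => Θ x z * g ρ z)
      ((volume.restrict (Set.uIoc 0 1)).prod volume) := by
    have h1 : ContinuousOn (Function.uncurry fun (ρ : ℝ) (z : Euc n) => Θ x z * g ρ z)
        (Set.Icc (0:ℝ) 1 ×ˢ closedBall c r) :=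
      (((ker_cd h x).continuous.comp continuous_snd).mul hg).continuousOn
    have h2 := h1.integrableOn_compact (μ := (volume : Measure ℝ).prod (volume : Measure (Euc n)))
      (isCompact_Icc.prod (isCompact_closedBall c r))
    rw [IntegrableOn, ← Measure.prod_restrict] at h2
    have h3 : Integrable (Function.uncurry fun (ρ : ℝ) (z : Euc n) => Θ x z * g ρ z)
      ((volume.restrict (Set.Icc (0:ℝ) 1)).prod volume) := by
      have h4 : IntegrableOn (Function.uncurry fun (ρ : ℝ) (z : Euc n) => Θ x z * g ρ z)
         (Set.univ ×ˢ closedBall c r) ((volume.restrict (Set.Icc (0:ℝ) 1)).prod volume) := by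
        rw [IntegrableOn, ← Measure.prod_restrict]
        simpa using h2
      rw [← integrableOn_univ]
      refine h4.of_forall_sdiff_eq_zero MeasurableSet.univ ?_
      rintro ⟨ρ, z⟩ ⟨_, hz⟩
      have : z ∉ closedBall c r := by simpa using hz
      simp [h.supp x z this]
    refine h3.mono_measure ?_
    refine Measure.prod_mono ?_ le_rfl
    refine Measure.restrict_mono ?_ le_rfl
    rw [Set.uIoc_of_le zero_le_one]; exact Set.Ioc_subset_Icc_self
  exact (intervalIntegral_integral_swap hI).symm

theorem ker_param_cont {n : ℕ} {c : Euc n} {r : ℝ} {Θ : Euc n → Euc n → ℝ} (h : IsKer c r Θ) (x : Euc n)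
    {g : ℝ → Euc n → ℝ} (hg : Continuous (Function.uncurry g)) :
    Continuous fun ρ => ∫ z, Θ x z * g ρ z := by
  have : (fun ρ => ∫ z, Θ x z * g ρ z) = fun ρ => ∫ z in closedBall c r, Θ x z * g ρ z := by
    ext ρ
    rw [setIntegral_eq_integral_of_forall_compl_eq_zero]
    intro z hz; simp [h.supp x z hz]
  rw [this]
  refine continuous_parametric_integral_of_continuous ?_ (isCompact_closedBall c r)
  exact ((ker_cd h x).continuous.comp continuous_snd).mul hg

/-- components of the operator -/
def fOp {n d q : ℕ} (P : Matrix (Fin q) (Fin d) (MvPolynomial (Fin n) ℝ)) (u : Fin d → Sm n)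
    (b : Fin q) : Sm n := ∑ a, dOp (P b a) (u a)

/-- complex ellipticity of a polynomial matrix -/
def EllP {n d q : ℕ} (P : Matrix (Fin q) (Fin d) (MvPolynomial (Fin n) ℝ)) : Prop :=
  ∀ ζ : Fin n → ℂ, ζ ≠ 0 → ∀ v : Fin d → ℂ, (∀ b, ∑ a, aeval ζ (P b a) * v a = 0) → v = 0

theorem alg_main' {n k d q : ℕ} (P : Matrix (Fin q) (Fin d) (MvPolynomial (Fin n) ℝ))
    (hP : ∀ b a, (P b a).IsHomogeneous (k + 1)) (hell : EllP P) :
    ∃ j : ℕ, ∀ (α : Fin (j + 1) → Fin n) (β : Fin k → Fin n) (a : Fin d),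
      ∃ Q : Fin q → MvPolynomial (Fin n) ℝ, (∀ b, (Q b).IsHomogeneous j) ∧
        ∀ u : Fin d → Sm n, dOp (∏ i, X (α i)) (dOp (∏ i, X (β i)) (u a)) =
          ∑ b, dOp (Q b) (fOp P u b) := by
  obtain ⟨K, hK⟩ := alg_main P hP hell
  refine ⟨K, fun α β a => ?_⟩
  obtain ⟨Q, hQ, hQP⟩ := hK K (by omega) (fun i => Fin.append α β (Fin.cast (by omega) i))
  refine ⟨Q a, hQ a, fun u => ?_⟩
  have hprod : (∏ i : Fin (K + (k + 1)), X (Fin.append α β (Fin.cast (by omega) i)) : MvPolynomial (Fin n) ℝ)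
      = (∏ i, X (α i)) * ∏ i, X (β i) := by
    have e : (∏ i : Fin (K + 1 + k), (X (Fin.append α β i) : MvPolynomial (Fin n) ℝ))
      = (∏ i, X (α i)) * ∏ i, X (β i) := by
      rw [Fin.prod_univ_add]; simp
    rw [← e]
    exact Fin.prod_congr' (fun i => (X (Fin.append α β i) : MvPolynomial (Fin n) ℝ)) (by omega)
  rw [hprod] at hQP
  have h2 : ∀ a', ∑ b, Q a b * P b a' = if a = a' then (∏ i, X (α i)) * ∏ i, X (β i) else 0 := by
    intro a'
    have := congrFun (congrFun hQP a) a'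
    rw [Matrix.mul_apply] at this
    rw [this]
    simp [Matrix.one_apply]
  simp only [fOp, map_sum, ← dOp_mul]
  rw [Finset.sum_comm]
  simp only [← dOp_sum, h2]
  rw [Finset.sum_eq_single a]
  · simp
  · intro a' _ h; simp [Ne.symm h]
  · simp

theorem rep {n k d q : ℕ} (P : Matrix (Fin q) (Fin d) (MvPolynomial (Fin n) ℝ))
    (hP : ∀ b a, (P b a).IsHomogeneous (k + 1)) (hell : EllP P)
    (c : Euc n) {r : ℝ} (hr : 0 < r) (β : Fin k → Fin n) (a : Fin d) :
    ∃ (Θ0 : Euc n → Euc n → ℝ) (Θ1 : Fin q → Euc n → Euc n → ℝ), IsKer c r Θ0 ∧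
      (∀ b, IsKer c r (Θ1 b)) ∧ ∀ (u : Fin d → Sm n) (x : Euc n),
      (dOp (∏ i, X (β i)) (u a)).1 x = (∫ z, Θ0 x z * (u a).1 z) +
        ∑ b, ∫ ρ in (0:ℝ)..1, ∫ z, Θ1 b x z * (fOp P u b).1 (x + ρ • (z - x)) := by
  obtain ⟨j, hj⟩ := alg_main' P hP hell
  obtain ⟨θ, hθ, hθ1⟩ := exists_bump c hr
  have hker : ∀ {l : ℕ} (α : Fin l → Fin n), IsKer c r (fun x z => θ z * ∏ i, (x - z) (α i)) :=
    fun α => ker_coords hθ α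
  have hX : ∀ {l : ℕ} (α : Fin l → Fin n),
      ((∏ i, X (α i)) : MvPolynomial (Fin n) ℝ).IsHomogeneous l := by
    intro l α
    have := IsHomogeneous.prod Finset.univ (fun i => (X (α i) : MvPolynomial (Fin n) ℝ)) (fun _ => 1)
      (fun i _ => isHomogeneous_X ℝ (α i))
    simpa using this
  have h0 : ∀ (l : ℕ) (α : Fin l → Fin n), ∃ Θ', IsKer c r Θ' ∧ ∀ (φ : Sm n) (x : Euc n),
      ∫ z, (θ z * ∏ i, (x - z) (α i)) * (dOp (∏ i, X (α i)) (dOp (∏ i, X (β i)) φ)).1 z =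
        ∫ z, Θ' x z * φ.1 z := by
    intro l α
    obtain ⟨Θ', h1, h2⟩ := goodP_hom c r ((hX α).mul (hX β)) _ (hker α)
    refine ⟨Θ', h1, fun φ x => ?_⟩
    have := h2 φ x 1
    simpa [dOp_mul] using this
  choose Θ0 hΘ0 h0 using h0
  choose Q hQ hQf using fun α => hj α β a
  choose Θ1 hΘ1 h1 using fun α b => goodP_hom c r (hQ α b) _ (hker α)
  refine ⟨fun x z => ∑ l ∈ Finset.range (j + 1), (1 / (l.factorial : ℝ)) * ∑ α : Fin l → Fin n, Θ0 l α x z,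
    fun b x z => (1 / (j.factorial : ℝ)) * ∑ α, Θ1 α b x z,
    ker_sum _ fun l _ => ker_smul (ker_sum _ fun α _ => hΘ0 l α) _,
    fun b => ker_smul (ker_sum _ fun α _ => hΘ1 α b) _, fun u x => ?_⟩
  set φ := dOp (∏ i, X (β i)) (u a) with hφ
  have hcg : ∀ ψ : Sm n, Continuous (Function.uncurry fun (ρ : ℝ) (z : Euc n) => ψ.1 (x + ρ • (z - x))) := by
    intro ψ
    refine (sm_cont ψ).comp ?_
    change Continuous fun p : ℝ × Euc n => x + p.1 • (p.2 - x)
    fun_prop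
  have hcG : Continuous (Function.uncurry fun (ρ : ℝ) (z : Euc n) => (ρ ^ j / (j.factorial : ℝ)) *
        (dOp (linP (x - z) ^ (j + 1)) φ).1 (x + ρ • (z - x))) := by
    simp only [dOp_linP_pow]
    refine Continuous.mul (f := fun p : ℝ × Euc n => p.1 ^ j / (j.factorial : ℝ)) (by fun_prop) ?_
    refine continuous_finsetSum _ fun α _ => ?_
    refine Continuous.mul (f := fun p : ℝ × Euc n => ∏ i, (x - p.2) (α i)) ?_ (hcg _)
    refine continuous_finsetProd _ fun i _ => ?_
    exact (EuclideanSpace.proj (𝕜 := ℝ) (α i)).continuous.comp (continuous_const.sub continuous_snd)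
  have hS : Continuous fun z => ∑ l ∈ Finset.range (j + 1),
        (1 / (l.factorial : ℝ)) * (dOp (linP (x - z) ^ l) φ).1 z := by
    simp only [dOp_linP_pow]
    refine continuous_finsetSum _ fun l _ => continuous_const.mul ?_
    refine continuous_finsetSum _ fun α _ => ?_
    refine Continuous.mul (f := fun z : Euc n => ∏ i, (x - z) (α i)) ?_ (sm_cont _)
    refine continuous_finsetProd _ fun i _ => ?_
    exact (EuclideanSpace.proj (𝕜 := ℝ) (α i)).continuous.comp (continuous_const.sub continuous_id)
  have hI : Continuous fun z => ∫ ρ in (0:ℝ)..1, (ρ ^ j / (j.factorial : ℝ)) *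
        (dOp (linP (x - z) ^ (j + 1)) φ).1 (x + ρ • (z - x)) := by
    refine intervalIntegral.continuous_parametric_intervalIntegral_of_continuous' (μ := volume) ?_ 0 1
    exact hcG.comp continuous_swap
  have e1 : φ.1 x = ∫ z, θ z * φ.1 x := by rw [integral_mul_const, hθ1, one_mul]
  have e2 : ∀ z, θ z * φ.1 x = θ z * (∑ l ∈ Finset.range (j + 1),
        (1 / (l.factorial : ℝ)) * (dOp (linP (x - z) ^ l) φ).1 z) +
      θ z * ∫ ρ in (0:ℝ)..1, (ρ ^ j / (j.factorial : ℝ)) *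
        (dOp (linP (x - z) ^ (j + 1)) φ).1 (x + ρ • (z - x)) := by
    intro z; rw [← mul_add, ← taylor]
  rw [e1]
  simp only [e2]
  rw [integral_add (ker_int hθ x hS) (ker_int hθ x hI), ker_swap hθ x hcG]
  congr 1
  · have e3 : ∀ z, θ z * (∑ l ∈ Finset.range (j + 1),
        (1 / (l.factorial : ℝ)) * (dOp (linP (x - z) ^ l) φ).1 z) =
        ∑ l ∈ Finset.range (j + 1), (1 / (l.factorial : ℝ)) * ∑ α : Fin l → Fin n,
          (θ z * ∏ i, (x - z) (α i)) * (dOp (∏ i, X (α i)) φ).1 z := by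
      intro z
      rw [Finset.mul_sum]
      refine Finset.sum_congr rfl fun l _ => ?_
      rw [dOp_linP_pow, Finset.mul_sum, Finset.mul_sum, Finset.mul_sum]
      refine Finset.sum_congr rfl fun α _ => ?_
      ring
    simp only [e3, Finset.sum_mul, mul_assoc (1 / _ : ℝ)]
    rw [integral_finsetSum, integral_finsetSum]
    · refine Finset.sum_congr rfl fun l _ => ?_
      rw [integral_const_mul, integral_const_mul, integral_finsetSum, integral_finsetSum]
      · congr 1
        exact Finset.sum_congr rfl fun α _ => h0 l α (u a) x
      · intro α _; exact ker_int (hΘ0 l α) x (sm_cont _)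
      · intro α _; exact ker_int (hker α) x (sm_cont _)
    · intro l _
      refine Integrable.const_mul ?_ _
      exact integrable_finsetSum _ fun α _ => ker_int (hΘ0 l α) x (sm_cont _)
    · intro l _
      refine Integrable.const_mul ?_ _
      exact integrable_finsetSum _ fun α _ => ker_int (hker α) x (sm_cont _)
  · have hk1 : ∀ b, IsKer c r (fun x z => (1 / (j.factorial : ℝ)) * ∑ α, Θ1 α b x z) :=
      fun b => ker_smul (ker_sum _ fun α _ => hΘ1 α b) _
    rw [← intervalIntegral.integral_finsetSum]
    swap
    · intro b _
      exact (ker_param_cont (hk1 b) x (hcg (fOp P u b))).intervalIntegrable 0 1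
    refine intervalIntegral.integral_congr fun ρ _ => ?_
    have e4 : ∀ z, θ z * (ρ ^ j / (j.factorial : ℝ) * (dOp (linP (x - z) ^ (j + 1)) φ).1 (x + ρ • (z - x))) =
        ∑ b, ∑ α : Fin (j + 1) → Fin n, ((1 / (j.factorial : ℝ)) * ρ ^ j) *
          ((θ z * ∏ i, (x - z) (α i)) * (dOp (Q α b) (fOp P u b)).1 (x + ρ • (z - x))) := by
      intro z
      rw [Finset.sum_comm, dOp_linP_pow, Finset.mul_sum, Finset.mul_sum]
      refine Finset.sum_congr rfl fun α _ => ?_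
      rw [hφ, hQf α u, sm_sum_apply, Finset.mul_sum, Finset.mul_sum, Finset.mul_sum]
      refine Finset.sum_congr rfl fun b _ => ?_
      ring
    simp only [e4]
    have hin : ∀ b α, Integrable fun z => ((1 / (j.factorial : ℝ)) * ρ ^ j) *
          ((θ z * ∏ i, (x - z) (α i)) * (dOp (Q α b) (fOp P u b)).1 (x + ρ • (z - x))) :=
      fun b α => (ker_int (hker α) x ((sm_cont _).comp (seg_cont x ρ))).const_mul _
    rw [integral_finsetSum _ fun b _ => integrable_finsetSum _ fun α _ => hin b α]
    refine Finset.sum_congr rfl fun b _ => ?_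
    rw [integral_finsetSum _ fun α _ => hin b α]
    simp only [mul_assoc (1 / _ : ℝ), Finset.sum_mul]
    have hin2 : ∀ α, Integrable fun z => Θ1 α b x z * (fOp P u b).1 (x + ρ • (z - x)) :=
      fun α => ker_int (hΘ1 α b) x ((sm_cont _).comp (seg_cont x ρ))
    rw [integral_const_mul, integral_finsetSum _ fun α _ => hin2 α, Finset.mul_sum]
    refine Finset.sum_congr rfl fun α _ => ?_
    rw [integral_const_mul, integral_const_mul]
    congr 1
    exact h1 α b (fOp P u b) x ρ

end

noncomputable section
open MeasureTheory Metric MvPolynomial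
open scoped ENNReal RealInnerProductSpace

theorem mink_core {T Y : Type*} [MeasurableSpace T] [MeasurableSpace Y] {μ : Measure T} {ν : Measure Y}
    [SFinite μ] [SFinite ν] {p : ℝ} (hp : 1 < p) {h : T → Y → ℝ≥0∞}
    (hm : Measurable (Function.uncurry h)) {κ : T → ℝ≥0∞} (hκ : Measurable κ)
    (hb : ∀ t, ∫⁻ x, h t x ^ p ∂ν ≤ κ t ^ p) (hpos : ∀ t, κ t ≠ 0) (hfin : ∫⁻ t, κ t ∂μ ≠ ∞) :
    ∫⁻ x, (∫⁻ t, h t x ∂μ) ^ p ∂ν ≤ (∫⁻ t, κ t ∂μ) ^ p := by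
  have hp0 : 0 < p := by linarith
  have hpq := Real.HolderConjugate.conjExponent hp
  set q := p.conjExponent with hq
  have hq0 : 0 < q := hpq.symm.pos
  have hpq1 : p / q = p - 1 := hpq.div_conj_eq_sub_one
  have hae : ∀ᵐ t ∂μ, κ t < ∞ := ae_lt_top hκ hfin
  have hmx : ∀ x, Measurable fun t => h t x := fun x => hm.comp (measurable_id.prodMk measurable_const)
  have step : ∀ x, (∫⁻ t, h t x ∂μ) ^ p ≤
      (∫⁻ t, h t x ^ p * κ t ^ (1 - p) ∂μ) * (∫⁻ t, κ t ∂μ) ^ (p - 1) := by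
    intro x
    have h1 : ∫⁻ t, h t x ∂μ = ∫⁻ t, ((fun t => h t x * κ t ^ (-(1 / q))) * fun t => κ t ^ (1 / q)) t ∂μ := by
      refine lintegral_congr_ae ?_
      filter_upwards [hae] with t ht
      simp only [Pi.mul_apply]
      rw [mul_assoc, ← ENNReal.rpow_add _ _ (hpos t) ht.ne]
      simp
    have h2 := ENNReal.lintegral_mul_le_Lp_mul_Lq μ hpq
      (f := fun t => h t x * κ t ^ (-(1 / q))) (g := fun t => κ t ^ (1 / q))
      ((hmx x).mul (hκ.pow_const _)).aemeasurable (hκ.pow_const _).aemeasurable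
    rw [h1]
    refine (ENNReal.rpow_le_rpow h2 hp0.le).trans ?_
    rw [ENNReal.mul_rpow_of_nonneg _ _ hp0.le, ← ENNReal.rpow_mul, ← ENNReal.rpow_mul]
    have e1 : 1 / p * p = 1 := by field_simp
    have e2 : 1 / q * p = p - 1 := by rw [← hpq1]; ring
    rw [e1, e2, ENNReal.rpow_one]
    apply le_of_eq
    congr 1
    · refine lintegral_congr fun t => ?_
      rw [ENNReal.mul_rpow_of_nonneg _ _ hp0.le, ← ENNReal.rpow_mul]
      congr 2
      rw [neg_mul, e2]; ring
    · congr 1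
      refine lintegral_congr fun t => ?_
      rw [← ENNReal.rpow_mul]
      have : 1 / q * q = 1 := by field_simp
      rw [this, ENNReal.rpow_one]
  have hM : Measurable (Function.uncurry fun (x : Y) (t : T) => h t x ^ p * κ t ^ (1 - p)) :=
    ((hm.comp measurable_swap).pow_const _).mul ((hκ.comp measurable_snd).pow_const _)
  calc ∫⁻ x, (∫⁻ t, h t x ∂μ) ^ p ∂ν
      ≤ ∫⁻ x, (∫⁻ t, h t x ^ p * κ t ^ (1 - p) ∂μ) * (∫⁻ t, κ t ∂μ) ^ (p - 1) ∂ν := lintegral_mono step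
    _ = (∫⁻ x, ∫⁻ t, h t x ^ p * κ t ^ (1 - p) ∂μ ∂ν) * (∫⁻ t, κ t ∂μ) ^ (p - 1) := by
        rw [lintegral_mul_const]
        exact hM.lintegral_prod_right'
    _ = (∫⁻ t, ∫⁻ x, h t x ^ p * κ t ^ (1 - p) ∂ν ∂μ) * (∫⁻ t, κ t ∂μ) ^ (p - 1) := by
        rw [lintegral_lintegral_swap hM.aemeasurable]
    _ ≤ (∫⁻ t, κ t ∂μ) * (∫⁻ t, κ t ∂μ) ^ (p - 1) := by
        gcongr ?_ * _
        refine lintegral_mono_ae ?_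
        filter_upwards [hae] with t ht
        rw [lintegral_mul_const]
        · calc _ ≤ κ t ^ p * κ t ^ (1 - p) := by gcongr; exact hb t
            _ = κ t := by
              rw [← ENNReal.rpow_add _ _ (hpos t) ht.ne]; simp
        · exact (hm.comp (measurable_const.prodMk measurable_id)).pow_const _
    _ = (∫⁻ t, κ t ∂μ) ^ p := by
        conv_lhs => rw [← ENNReal.rpow_one (∫⁻ t, κ t ∂μ)]
        rw [← ENNReal.rpow_mul, ← ENNReal.rpow_add_of_nonneg _ _ (by norm_num) (by linarith)]
        congr 1; ring

theorem mink {T Y : Type*} [MeasurableSpace T] [MeasurableSpace Y] {μ : Measure T} {ν : Measure Y}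
    [SigmaFinite μ] [SFinite ν] {p : ℝ} (hp : 1 < p) {h : T → Y → ℝ≥0∞}
    (hm : Measurable (Function.uncurry h)) {κ : T → ℝ≥0∞} (hκ : Measurable κ)
    (hb : ∀ t, ∫⁻ x, h t x ^ p ∂ν ≤ κ t ^ p) :
    ∫⁻ x, (∫⁻ t, h t x ∂μ) ^ p ∂ν ≤ (∫⁻ t, κ t ∂μ) ^ p := by
  have hp0 : 0 < p := by linarith
  by_cases hfin : ∫⁻ t, κ t ∂μ = ∞
  · rw [hfin, ENNReal.top_rpow_of_pos hp0]; exact le_top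
  rw [← ENNReal.rpow_inv_le_iff hp0]
  refine ENNReal.le_of_forall_pos_le_add fun ε hε _ => ?_
  obtain ⟨w, hw0, hwm, hw⟩ := exists_pos_lintegral_lt_of_sigmaFinite μ (ε := ε) (by exact_mod_cast hε.ne')
  have hwm' : Measurable fun t => (w t : ℝ≥0∞) := hwm.coe_nnreal_ennreal
  have hadd : ∫⁻ t, (κ t + w t) ∂μ = ∫⁻ t, κ t ∂μ + ∫⁻ t, w t ∂μ := lintegral_add_left hκ _
  have := mink_core (μ := μ) (ν := ν) hp hm (κ := fun t => κ t + w t) (hκ.add hwm')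
    (fun t => (hb t).trans (ENNReal.rpow_le_rpow le_self_add hp0.le))
    (fun t => by simp [(hw0 t).ne']) (by
      rw [hadd]; exact ENNReal.add_ne_top.2 ⟨hfin, (hw.trans ENNReal.coe_lt_top).ne⟩)
  rw [← ENNReal.rpow_inv_le_iff hp0] at this
  refine this.trans ?_
  rw [hadd]; gcongr

theorem lint_smul {m : ℕ} (f : (Fin m → ℝ) → ℝ≥0∞) {c : ℝ} (hc : 0 < c) :
    ∫⁻ x, f (c • x) = ENNReal.ofReal (c ^ m)⁻¹ * ∫⁻ x, f x := by
  have h1 := Measure.map_addHaar_smul (volume : Measure (Fin m → ℝ)) hc.ne'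
  have h2 : ∫⁻ x, f x ∂(Measure.map (c • ·) (volume : Measure (Fin m → ℝ))) = ∫⁻ x, f (c • x) :=
    lintegral_map_equiv f (MeasurableEquiv.smul₀ c hc.ne')
  rw [← h2, h1, lintegral_smul_measure, abs_of_pos (by positivity)]
  simp

theorem lint_smul1 (f : ℝ → ℝ≥0∞) {c : ℝ} (hc : 0 < c) :
    ∫⁻ x, f (c * x) = ENNReal.ofReal c⁻¹ * ∫⁻ x, f x := by
  have h1 := Measure.map_addHaar_smul (volume : Measure ℝ) hc.ne'
  have h2 : ∫⁻ x, f x ∂(Measure.map (c • ·) (volume : Measure ℝ)) = ∫⁻ x, f (c * x) :=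
    lintegral_map_equiv f (MeasurableEquiv.smul₀ c hc.ne')
  rw [← h2, h1, lintegral_smul_measure, abs_of_pos (by positivity)]
  simp

theorem max_ker (m : ℕ) {q : ℝ} (hq : (m : ℝ) < q) : ∃ C : ℝ≥0∞, C ≠ ∞ ∧ ∀ (τ : ℝ), 0 ≤ τ → ∀ y : Fin m → ℝ,
    ∫⁻ x : Fin m → ℝ, ENNReal.ofReal (max τ ‖x - y‖) ^ (-q) ≤ C * ENNReal.ofReal τ ^ ((m : ℝ) - q) := by
  have hq0 : 0 < q := lt_of_le_of_lt (Nat.cast_nonneg m) hq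
  have hfin : ∫⁻ x : Fin m → ℝ, ENNReal.ofReal ((1 + ‖x‖) ^ (-q)) < ∞ :=
    finite_integral_one_add_norm (by simpa using hq)
  have hb : ∀ x : Fin m → ℝ, ENNReal.ofReal (max 1 ‖x‖) ^ (-q) ≤
      ENNReal.ofReal (2 ^ q) * ENNReal.ofReal ((1 + ‖x‖) ^ (-q)) := by
    intro x
    have hx := norm_nonneg x
    have h1 : 0 < max 1 ‖x‖ := lt_of_lt_of_le one_pos (le_max_left _ _)
    rw [ENNReal.ofReal_rpow_of_pos h1, ← ENNReal.ofReal_mul (by positivity)]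
    apply ENNReal.ofReal_le_ofReal
    rw [Real.rpow_neg h1.le, Real.rpow_neg (by positivity), ← div_eq_mul_inv, inv_eq_one_div,
      div_le_div_iff₀ (by positivity) (by positivity), one_mul, ← Real.mul_rpow (by norm_num) h1.le]
    apply Real.rpow_le_rpow (by positivity) _ hq0.le
    have := le_max_left 1 ‖x‖
    have := le_max_right 1 ‖x‖
    linarith
  set I : ℝ≥0∞ := ∫⁻ x : Fin m → ℝ, ENNReal.ofReal (max 1 ‖x‖) ^ (-q) with hI
  have hIfin : I ≠ ∞ := by
    refine (lt_of_le_of_lt (lintegral_mono hb) ?_).ne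
    rw [lintegral_const_mul' _ _ ENNReal.ofReal_ne_top]
    exact ENNReal.mul_lt_top ENNReal.ofReal_lt_top hfin
  refine ⟨I + 1, by simp [hIfin], fun τ hτ y => ?_⟩
  rcases hτ.eq_or_lt with rfl | hτ
  · rw [ENNReal.ofReal_zero, ENNReal.zero_rpow_of_neg (by linarith), ENNReal.mul_top (by simp)]
    exact le_top
  rw [lintegral_sub_right_eq_self (fun x : Fin m → ℝ => ENNReal.ofReal (max τ ‖x‖) ^ (-q)) y]
  have h1 := lint_smul (fun x : Fin m → ℝ => ENNReal.ofReal (max τ ‖x‖) ^ (-q)) hτ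
  have h2 : ∀ x : Fin m → ℝ, ENNReal.ofReal (max τ ‖τ • x‖) ^ (-q) =
      ENNReal.ofReal τ ^ (-q) * ENNReal.ofReal (max 1 ‖x‖) ^ (-q) := by
    intro x
    have h3 : max τ ‖τ • x‖ = τ * max 1 ‖x‖ := by
      rw [norm_smul, Real.norm_of_nonneg hτ.le, mul_max_of_nonneg _ _ hτ.le, mul_one]
    rw [h3, ENNReal.ofReal_mul hτ.le, ENNReal.mul_rpow_of_ne_top (by simp) (by simp)]
  simp only [h2] at h1
  have hτe0 : ENNReal.ofReal τ ≠ 0 := by simpa using hτ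
  rw [lintegral_const_mul' _ _ (by
    refine ENNReal.rpow_ne_top_of_ne_zero hτe0 (by simp)), ← hI] at h1
  have h4 : ∫⁻ x : Fin m → ℝ, ENNReal.ofReal (max τ ‖x‖) ^ (-q) =
      ENNReal.ofReal τ ^ (m : ℝ) * (ENNReal.ofReal τ ^ (-q) * I) := by
    rw [h1, ← mul_assoc, ENNReal.rpow_natCast, ← ENNReal.ofReal_pow hτ.le, ← ENNReal.ofReal_mul (by positivity),
      mul_inv_cancel₀ (by positivity)]
    simp
  rw [h4, ← mul_assoc, ← ENNReal.rpow_add _ _ hτe0 (by simp), mul_comm, ← sub_eq_add_neg]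
  gcongr
  exact le_self_add

end

noncomputable section
open MeasureTheory Metric MvPolynomial
open scoped ENNReal RealInnerProductSpace

/-- the one dimensional kernel -/
def mk1 (δ : ℝ) (a : ℝ≥0∞) (τ : ℝ) : ℝ≥0∞ :=
  min (a * ENNReal.ofReal |τ| ^ (-δ)) (ENNReal.ofReal |τ| ^ (-1 - δ))

theorem mk1_mono {δ : ℝ} {a b : ℝ≥0∞} (h : a ≤ b) (τ : ℝ) : mk1 δ a τ ≤ mk1 δ b τ := by
  unfold mk1; gcongr

theorem mk1_meas (δ : ℝ) : Measurable (Function.uncurry (mk1 δ)) := by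
  unfold mk1
  refine Measurable.min (f := fun p : ℝ≥0∞ × ℝ => p.1 * ENNReal.ofReal |p.2| ^ (-δ))
    (g := fun p : ℝ≥0∞ × ℝ => ENNReal.ofReal |p.2| ^ (-1 - δ)) ?_ ?_ <;> fun_prop

theorem mk1_one_fin {δ : ℝ} (h0 : 0 < δ) (h1 : δ < 1) : ∫⁻ τ, mk1 δ 1 τ ≠ ∞ := by
  let g : ℝ → ℝ≥0∞ := (Set.Ioc (0:ℝ) 1).indicator fun τ => ENNReal.ofReal (τ ^ (-δ))
  have hgm : Measurable g := Measurable.indicator (by fun_prop) measurableSet_Ioc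
  have hg : ∫⁻ τ, g τ ≠ ∞ := by
    rw [lintegral_indicator measurableSet_Ioc]
    have := (intervalIntegral.intervalIntegrable_rpow' (a := 0) (b := 1) (r := -δ) (by linarith))
    rw [intervalIntegrable_iff_integrableOn_Ioc_of_le zero_le_one] at this
    exact (this.lintegral_lt_top).ne
  have hg' : ∫⁻ τ, g (-τ) ≠ ∞ := by
    rw [lintegral_neg_eq_self]; exact hg
  have hfin : ∫⁻ x : ℝ, ENNReal.ofReal ((1 + ‖x‖) ^ (-(1 + δ))) ≠ ∞ :=
    (finite_integral_one_add_norm (E := ℝ) (r := 1 + δ) (by simpa using h0)).ne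
  have hb : ∀ᵐ τ : ℝ, mk1 δ 1 τ ≤ (g τ + g (-τ)) +
      ENNReal.ofReal (2 ^ (1 + δ)) * ENNReal.ofReal ((1 + ‖τ‖) ^ (-(1 + δ))) := by
    have : ∀ᵐ τ : ℝ, τ ≠ 0 := by simp [ae_iff, measure_singleton]
    filter_upwards [this] with τ hτ
    have hpos : 0 < |τ| := abs_pos.2 hτ
    by_cases h : |τ| ≤ 1
    · refine le_trans ?_ le_self_add
      unfold mk1
      refine (min_le_left _ _).trans ?_
      rw [one_mul, ENNReal.ofReal_rpow_of_pos hpos]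
      rcases lt_or_gt_of_ne hτ with h2 | h2
      · refine le_trans ?_ le_add_self
        rw [abs_of_neg h2] at h ⊢
        simp only [g]
        rw [Set.indicator_of_mem]
        exact ⟨by linarith, h⟩
      · refine le_trans ?_ le_self_add
        rw [abs_of_pos h2] at h ⊢
        simp only [g]
        rw [Set.indicator_of_mem]
        exact ⟨by linarith, h⟩
    · refine le_trans ?_ le_add_self
      push Not at h
      unfold mk1
      refine (min_le_right _ _).trans ?_
      rw [ENNReal.ofReal_rpow_of_pos hpos, ← ENNReal.ofReal_mul (by positivity)]
      apply ENNReal.ofReal_le_ofReal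
      rw [Real.norm_eq_abs, show -1 - δ = -(1 + δ) by ring, Real.rpow_neg hpos.le,
        Real.rpow_neg (by positivity), ← div_eq_mul_inv, inv_eq_one_div,
        div_le_div_iff₀ (by positivity) (by positivity), one_mul, ← Real.mul_rpow (by norm_num) hpos.le]
      apply Real.rpow_le_rpow (by positivity) _ (by linarith)
      linarith
  refine (lt_of_le_of_lt (lintegral_mono_ae hb) ?_).ne
  have hmm : Measurable fun τ => g τ + g (-τ) := hgm.add (hgm.comp measurable_neg)
  rw [lintegral_add_left hmm, lintegral_add_left hgm,
    lintegral_const_mul' _ _ ENNReal.ofReal_ne_top]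
  exact ENNReal.add_lt_top.2 ⟨ENNReal.add_lt_top.2 ⟨hg.lt_top, hg'.lt_top⟩,
    ENNReal.mul_lt_top ENNReal.ofReal_lt_top hfin.lt_top⟩

theorem mk1_int {δ : ℝ} (h0 : 0 < δ) (h1 : δ < 1) : ∃ C : ℝ≥0∞, C ≠ ∞ ∧ C ≠ 0 ∧
    ∀ a, ∫⁻ τ, mk1 δ a τ ≤ C * a ^ δ := by
  refine ⟨(∫⁻ τ, mk1 δ 1 τ) + 1, by simp [mk1_one_fin h0 h1], by simp, fun a => ?_⟩
  by_cases ha0 : a = 0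
  · subst ha0; simp [mk1]
  by_cases hat : a = ∞
  · subst hat; simp [ENNReal.top_rpow_of_pos h0]
  have hb : 0 < a.toReal := ENNReal.toReal_pos ha0 hat
  have hs := lint_smul1 (mk1 δ 1) hb
  have h2 : ∀ τ, mk1 δ a τ = a ^ (1 + δ) * mk1 δ 1 (a.toReal * τ) := by
    intro τ
    unfold mk1
    rw [abs_mul, abs_of_pos hb, ENNReal.ofReal_mul hb.le, ENNReal.ofReal_toReal hat, one_mul]
    have e1 : a ^ (1 + δ) * (a * ENNReal.ofReal |τ|) ^ (-δ) = a * ENNReal.ofReal |τ| ^ (-δ) := by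
      rw [ENNReal.mul_rpow_of_ne_top hat (by simp), ← mul_assoc, ← ENNReal.rpow_add _ _ ha0 hat]
      simp
    have e2 : a ^ (1 + δ) * (a * ENNReal.ofReal |τ|) ^ (-1 - δ) = ENNReal.ofReal |τ| ^ (-1 - δ) := by
      rw [ENNReal.mul_rpow_of_ne_top hat (by simp), ← mul_assoc, ← ENNReal.rpow_add _ _ ha0 hat]
      rw [show 1 + δ + (-1 - δ) = 0 by ring]; simp
    rw [(show Monotone fun y : ℝ≥0∞ => a ^ (1 + δ) * y from fun x y h => by dsimp only; gcongr).map_min, e1, e2]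
  have hatop : a ^ (1 + δ) ≠ ∞ := ENNReal.rpow_ne_top_of_nonneg (by linarith) hat
  simp only [h2]
  rw [lintegral_const_mul' _ _ hatop, hs, ENNReal.ofReal_inv_of_pos hb, ENNReal.ofReal_toReal hat,
    ← ENNReal.rpow_neg_one, ← mul_assoc, ← ENNReal.rpow_add _ _ ha0 hat, mul_comm]
  rw [show 1 + δ + -1 = δ by ring]
  gcongr
  exact le_self_add

theorem oneD {δ : ℝ} (h0 : 0 < δ) (h1 : δ < 1) : ∃ C : ℝ≥0∞, C ≠ ∞ ∧
    ∀ a : ℝ → ℝ≥0∞, Measurable a → (∃ N : ℝ≥0∞, N ≠ ∞ ∧ ∀ t, a t ≤ N) →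
      ∫⁻ s, (∫⁻ t, mk1 δ (a t) (t - s)) ^ (1 / δ) ≤ C * ∫⁻ t, a t := by
  obtain ⟨C₀, hC, hC0, hIntg⟩ := mk1_int h0 h1
  refine ⟨2 * (2 * C₀) ^ (1 / δ - 1) * C₀, ?_, fun a ha ⟨N, hN, haN⟩ => ?_⟩
  · refine ENNReal.mul_ne_top (ENNReal.mul_ne_top (by simp) ?_) hC
    refine ENNReal.rpow_ne_top_of_nonneg ?_ (ENNReal.mul_ne_top (by simp) hC)
    rw [sub_nonneg, one_le_div h0]; exact h1.le
  have hp1 : 0 ≤ 1 / δ - 1 := by rw [sub_nonneg, one_le_div h0]; exact h1.le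
  have hmm : Measurable (Function.uncurry fun (s t : ℝ) => mk1 δ (a t) (t - s)) :=
    (mk1_meas δ).comp ((ha.comp measurable_snd).prodMk (measurable_snd.sub measurable_fst))
  have hms : ∀ s, Measurable fun t => mk1 δ (a t) (t - s) := fun s =>
    hmm.comp (measurable_const.prodMk measurable_id)
  have htr : ∀ b s, ∫⁻ t, mk1 δ b (t - s) ≤ C₀ * b ^ δ := by
    intro b s
    rw [lintegral_sub_right_eq_self (mk1 δ b) s]; exact hIntg b
  have key : ∀ s, (∫⁻ t, mk1 δ (a t) (t - s)) ^ (1 / δ) ≤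
      2 * (2 * C₀) ^ (1 / δ - 1) * ∫⁻ t, a t ^ (1 - δ) * mk1 δ (a t) (t - s) := by
    intro s
    set G := ∫⁻ t, mk1 δ (a t) (t - s) with hG
    have hGfin : G ≠ ∞ := by
      have : G ≤ C₀ * N ^ δ := (lintegral_mono fun t => mk1_mono (haN t) _).trans (htr N s)
      exact (this.trans_lt (ENNReal.mul_lt_top hC.lt_top (ENNReal.rpow_lt_top_of_nonneg h0.le hN))).ne
    set lam : ℝ≥0∞ := (G / (2 * C₀)) ^ (1 / δ) with hlam
    have h2C : 2 * C₀ ≠ 0 := by simp [hC0]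
    have h2Ct : 2 * C₀ ≠ ∞ := ENNReal.mul_ne_top (by simp) hC
    have hl1 : lam ^ δ = G / (2 * C₀) := by
      rw [hlam, ← ENNReal.rpow_mul]
      have : 1 / δ * δ = 1 := by field_simp
      rw [this, ENNReal.rpow_one]
    have hl2 : 2 * C₀ * lam ^ δ = G := by
      rw [hl1, ENNReal.mul_div_cancel h2C h2Ct]
    have hS : MeasurableSet {t | a t ≤ lam} := measurableSet_le ha measurable_const
    have hsplit := lintegral_add_compl (μ := volume) (fun t => mk1 δ (a t) (t - s)) hS
    have hlow : ∫⁻ t in {t | a t ≤ lam}, mk1 δ (a t) (t - s) ≤ C₀ * lam ^ δ := by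
      calc _ ≤ ∫⁻ t in {t | a t ≤ lam}, mk1 δ lam (t - s) :=
            setLIntegral_mono' hS fun t ht => mk1_mono ht _
        _ ≤ ∫⁻ t, mk1 δ lam (t - s) := setLIntegral_le_lintegral _ _
        _ ≤ _ := htr lam s
    set Hh := ∫⁻ t in {t | a t ≤ lam}ᶜ, mk1 δ (a t) (t - s) with hHh
    have hGH : C₀ * lam ^ δ ≤ Hh := by
      have hfin : C₀ * lam ^ δ ≠ ∞ := by
        intro h
        have : G = ∞ := by rw [← hl2, mul_assoc, h]; simp
        exact hGfin this
      have : C₀ * lam ^ δ + C₀ * lam ^ δ ≤ C₀ * lam ^ δ + Hh := by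
        calc C₀ * lam ^ δ + C₀ * lam ^ δ = G := by rw [← hl2]; ring
          _ = _ := hsplit.symm
          _ ≤ _ := by gcongr
      exact (ENNReal.add_le_add_iff_left hfin).1 this
    have hhigh : lam ^ (1 - δ) * Hh ≤ ∫⁻ t, a t ^ (1 - δ) * mk1 δ (a t) (t - s) := by
      rw [hHh, ← lintegral_const_mul _ (hms s)]
      refine le_trans ?_ (setLIntegral_le_lintegral {t | a t ≤ lam}ᶜ _)
      refine setLIntegral_mono' hS.compl fun t ht => ?_
      have ht' : ¬ a t ≤ lam := ht
      have : lam ≤ a t := (not_le.1 ht').le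
      gcongr
    calc G ^ (1 / δ) = G * G ^ (1 / δ - 1) := by
          conv_rhs => rw [← ENNReal.rpow_one G]
          rw [← ENNReal.rpow_mul, ← ENNReal.rpow_add_of_nonneg _ _ (by norm_num) (by linarith)]
          congr 1; ring
      _ = (2 * (C₀ * lam ^ δ)) * ((2 * C₀) ^ (1 / δ - 1) * lam ^ (1 - δ)) := by
          have hl3 : G ^ (1 / δ - 1) = (2 * C₀) ^ (1 / δ - 1) * lam ^ (1 - δ) := by
            have h4 : δ * (1 / δ - 1) = 1 - δ := by field_simp
            rw [← h4, ENNReal.rpow_mul, ← ENNReal.mul_rpow_of_nonneg _ _ hp1, hl2]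
          have hl4 : 2 * (C₀ * lam ^ δ) = G := by rw [← mul_assoc]; exact hl2
          rw [hl3, hl4]
      _ ≤ (2 * Hh) * ((2 * C₀) ^ (1 / δ - 1) * lam ^ (1 - δ)) := by gcongr
      _ = 2 * (2 * C₀) ^ (1 / δ - 1) * (lam ^ (1 - δ) * Hh) := by ring
      _ ≤ _ := by gcongr
  have hm2 : Measurable (Function.uncurry fun (s t : ℝ) => a t ^ (1 - δ) * mk1 δ (a t) (t - s)) :=
    ((ha.comp measurable_snd).pow_const _).mul hmm
  calc ∫⁻ s, (∫⁻ t, mk1 δ (a t) (t - s)) ^ (1 / δ)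
      ≤ ∫⁻ s, 2 * (2 * C₀) ^ (1 / δ - 1) * ∫⁻ t, a t ^ (1 - δ) * mk1 δ (a t) (t - s) := lintegral_mono key
    _ = 2 * (2 * C₀) ^ (1 / δ - 1) * ∫⁻ s, ∫⁻ t, a t ^ (1 - δ) * mk1 δ (a t) (t - s) := by
        rw [lintegral_const_mul]
        exact hm2.lintegral_prod_right'
    _ = 2 * (2 * C₀) ^ (1 / δ - 1) * ∫⁻ t, ∫⁻ s, a t ^ (1 - δ) * mk1 δ (a t) (t - s) := by
        rw [lintegral_lintegral_swap hm2.aemeasurable]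
    _ ≤ 2 * (2 * C₀) ^ (1 / δ - 1) * ∫⁻ t, C₀ * a t := by
        gcongr with t
        rw [lintegral_const_mul]
        · rw [lintegral_sub_left_eq_self (mk1 δ (a t)) t]
          calc a t ^ (1 - δ) * ∫⁻ s, mk1 δ (a t) s ≤ a t ^ (1 - δ) * (C₀ * a t ^ δ) := by
                gcongr; exact hIntg _
            _ = C₀ * (a t ^ (1 - δ) * a t ^ δ) := by ring
            _ = C₀ * a t := by
                rw [← ENNReal.rpow_add_of_nonneg _ _ (by linarith) h0.le]; simp
        · exact (mk1_meas δ).comp (measurable_const.prodMk (measurable_const.sub measurable_id))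
    _ = _ := by rw [lintegral_const_mul _ ha]; ring

theorem rho_int {N : ℝ} (hN : 1 < N) : ∃ C : ℝ≥0∞, C ≠ ∞ ∧ ∀ D : ℝ, 0 ≤ D →
    ∫⁻ ρ in Set.Ioc (0:ℝ) 1, (if D ≤ 2 * ρ then ENNReal.ofReal ρ ^ (-N) else 0) ≤
      C * ENNReal.ofReal D ^ (1 - N) := by
  refine ⟨ENNReal.ofReal (2 ^ (N - 1) / (N - 1)) + 1, by simp, fun D hD => ?_⟩
  rcases hD.eq_or_lt with rfl | hD
  · rw [ENNReal.ofReal_zero, ENNReal.zero_rpow_of_neg (by linarith), ENNReal.mul_top (by simp)]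
    exact le_top
  have hIntg : IntegrableOn (fun ρ : ℝ => ρ ^ (-N)) (Set.Ioi (D / 2)) :=
    integrableOn_Ioi_rpow_of_lt (by linarith) (by positivity)
  have hval := integral_Ioi_rpow_of_lt (a := -N) (c := D / 2) (by linarith) (by positivity)
  calc _ ≤ ∫⁻ ρ in Set.Ioc (0:ℝ) 1, (Set.Ici (D / 2)).indicator (fun ρ => ENNReal.ofReal (ρ ^ (-N))) ρ := by
        refine setLIntegral_mono' measurableSet_Ioc fun ρ hρ => ?_
        split_ifs with h
        · rw [Set.indicator_of_mem (by simp; linarith), ENNReal.ofReal_rpow_of_pos hρ.1]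
        · exact zero_le
    _ ≤ ∫⁻ ρ, (Set.Ici (D / 2)).indicator (fun ρ => ENNReal.ofReal (ρ ^ (-N))) ρ :=
        setLIntegral_le_lintegral _ _
    _ = ∫⁻ ρ in Set.Ioi (D / 2), ENNReal.ofReal (ρ ^ (-N)) := by
        rw [lintegral_indicator measurableSet_Ici]
        exact setLIntegral_congr Ioi_ae_eq_Ici.symm
    _ = ENNReal.ofReal (∫ ρ in Set.Ioi (D / 2), ρ ^ (-N)) := by
        rw [ofReal_integral_eq_lintegral_ofReal hIntg]
        filter_upwards [ae_restrict_mem measurableSet_Ioi] with ρ hρ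
        have : 0 < ρ := lt_trans (by positivity) hρ
        exact (Real.rpow_pos_of_pos this _).le
    _ = ENNReal.ofReal (2 ^ (N - 1) / (N - 1)) * ENNReal.ofReal D ^ (1 - N) := by
        rw [hval, ENNReal.ofReal_rpow_of_pos hD, ← ENNReal.ofReal_mul (by
          have : 0 < N - 1 := by linarith
          positivity)]
        congr 1
        rw [show -N + 1 = 1 - N by ring, Real.div_rpow hD.le (by norm_num),
          show (2:ℝ) ^ (1 - N) = (2 ^ (N - 1))⁻¹ by rw [← Real.rpow_neg (by norm_num)]; ring_nf]
        have : N - 1 ≠ 0 := by linarith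
        have : 1 - N ≠ 0 := by linarith
        field_simp
        ring
    _ ≤ _ := by gcongr; exact le_self_add

end

noncomputable section
open MeasureTheory Metric MvPolynomial
open scoped ENNReal RealInnerProductSpace

theorem maxk_meas {m : ℕ} (q : ℝ) : Measurable
    fun z : ℝ × (Fin m → ℝ) × (Fin m → ℝ) => ENNReal.ofReal (max z.1 ‖z.2.1 - z.2.2‖) ^ q := by
  have : Measurable fun z : ℝ × (Fin m → ℝ) × (Fin m → ℝ) => max z.1 ‖z.2.1 - z.2.2‖ :=
    (by fun_prop : Continuous fun z : ℝ × (Fin m → ℝ) × (Fin m → ℝ) => max z.1 ‖z.2.1 - z.2.2‖).measurable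
  exact (this.ennreal_ofReal).pow_const _

theorem sl1 {m : ℕ} {N : ℝ} (hN : 1 < N) : ∃ C : ℝ≥0∞, C ≠ ∞ ∧ ∀ (h : (Fin m → ℝ) → ℝ≥0∞),
    Measurable h → ∀ (x : Fin m → ℝ) (τ : ℝ), 0 ≤ τ →
    ∫⁻ ρ in Set.Ioc (0:ℝ) 1, ∫⁻ y, (if max τ ‖x - y‖ ≤ 2 * ρ then ENNReal.ofReal ρ ^ (-N) else 0) * h y
      ≤ C * ∫⁻ y, ENNReal.ofReal (max τ ‖x - y‖) ^ (1 - N) * h y := by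
  obtain ⟨C, hC, hb⟩ := rho_int hN
  refine ⟨C, hC, fun h hh x τ hτ => ?_⟩
  have hS : MeasurableSet {z : ℝ × (Fin m → ℝ) | max τ ‖x - z.2‖ ≤ 2 * z.1} :=
    (isClosed_le (by fun_prop) (by fun_prop)).measurableSet
  have hm : Measurable (Function.uncurry fun (ρ : ℝ) (y : Fin m → ℝ) =>
      (if max τ ‖x - y‖ ≤ 2 * ρ then ENNReal.ofReal ρ ^ (-N) else 0) * h y) := by
    refine Measurable.mul (Measurable.ite hS (by fun_prop) measurable_const) (hh.comp measurable_snd)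
  rw [lintegral_lintegral_swap hm.aemeasurable, ← lintegral_const_mul' _ _ hC]
  refine lintegral_mono fun y => ?_
  rw [lintegral_mul_const, ← mul_assoc]
  · gcongr
    exact hb _ (hτ.trans (le_max_left _ _))
  · exact Measurable.ite ((isClosed_le (by fun_prop) (by fun_prop)).measurableSet) (by fun_prop) measurable_const

theorem sl2 {m : ℕ} {p q : ℝ} (hp : 1 < p) (hq : (m : ℝ) < q * p) : ∃ C : ℝ≥0∞, C ≠ ∞ ∧
    ∀ (h : (Fin m → ℝ) → ℝ≥0∞), Measurable h → ∀ (τ : ℝ), 0 ≤ τ →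
    ∫⁻ x, (∫⁻ y, ENNReal.ofReal (max τ ‖x - y‖) ^ (-q) * h y) ^ p
      ≤ (C * ENNReal.ofReal τ ^ ((m - q * p) / p) * ∫⁻ y, h y) ^ p := by
  obtain ⟨C, hC, hb⟩ := max_ker m hq
  have hp0 : 0 < p := by linarith
  refine ⟨C ^ (1 / p), ENNReal.rpow_ne_top_of_nonneg (by positivity) hC, fun h hh τ hτ => ?_⟩
  have hm : Measurable (Function.uncurry fun (y x : Fin m → ℝ) =>
      ENNReal.ofReal (max τ ‖x - y‖) ^ (-q) * h y) := by
    refine Measurable.mul ((maxk_meas (-q)).comp (measurable_const.prodMk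
      (measurable_snd.prodMk measurable_fst))) (hh.comp measurable_fst)
  have := mink (μ := (volume : Measure (Fin m → ℝ))) (ν := (volume : Measure (Fin m → ℝ))) hp hm
    (κ := fun y => C ^ (1 / p) * ENNReal.ofReal τ ^ ((m - q * p) / p) * h y)
    (hh.const_mul _) (fun y => ?_)
  · rwa [lintegral_const_mul _ hh] at this
  · simp only [ENNReal.mul_rpow_of_nonneg _ _ hp0.le, ← ENNReal.rpow_mul]
    rw [lintegral_mul_const, show 1 / p * p = 1 by field_simp, show (m - q * p) / p * p = m - q * p by field_simp,
      ENNReal.rpow_one]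
    · gcongr
      have := hb τ hτ y
      rwa [show -(q * p) = -q * p by ring] at this
    · exact (maxk_meas (-q * p)).comp (measurable_const.prodMk (measurable_id.prodMk measurable_const))

theorem final_abs {m : ℕ} (hm1 : 1 ≤ m) : ∃ C : ℝ≥0∞, C ≠ ∞ ∧
    ∀ (hA hB : ℝ → (Fin m → ℝ) → ℝ≥0∞), Measurable (Function.uncurry hA) →
    Measurable (Function.uncurry hB) → ∀ T : ℝ≥0∞, T ≠ 0 → T ≠ ∞ →
    (∀ t, ∫⁻ y, hB t y ≤ T) → (∃ N : ℝ≥0∞, N ≠ ∞ ∧ ∀ t, ∫⁻ y, hA t y ≤ N) →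
    ∀ G : ℝ → (Fin m → ℝ) → ℝ≥0∞,
    (∀ s x, G s x ≤ ∫⁻ t, min (∫⁻ y, ENNReal.ofReal (max |t - s| ‖x - y‖) ^ (-(m : ℝ)) * hA t y)
      (∫⁻ y, ENNReal.ofReal (max |t - s| ‖x - y‖) ^ (-((m : ℝ) + 1)) * hB t y)) →
    ∫⁻ s, ∫⁻ x, G s x ^ (((m : ℝ) + 1) / m) ≤ C * (T ^ (((m : ℝ) + 1) / m) * (T⁻¹ * ∫⁻ t, ∫⁻ y, hA t y)) := by
  have hm0 : (0:ℝ) < m := by exact_mod_cast hm1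
  set p : ℝ := ((m : ℝ) + 1) / m with hpdef
  have hp : 1 < p := by rw [hpdef, lt_div_iff₀ hm0]; linarith
  have hp0 : 0 < p := by linarith
  set δ : ℝ := m / ((m : ℝ) + 1) with hδ
  have hδ0 : 0 < δ := by positivity
  have hδ1 : δ < 1 := by rw [hδ, div_lt_one (by positivity)]; linarith
  have hpd : 1 / δ = p := by rw [hδ, hpdef, one_div_div]
  have hmp : (m : ℝ) * p = m + 1 := by rw [hpdef]; field_simp
  obtain ⟨cA, hcA, hbA⟩ := sl2 (m := m) (p := p) (q := m) hp (by rw [hmp]; linarith)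
  obtain ⟨cB, hcB, hbB⟩ := sl2 (m := m) (p := p) (q := (m : ℝ) + 1) hp (by rw [add_mul, hmp]; linarith)
  have eA : ((m : ℝ) - m * p) / p = -δ := by rw [hmp, ← hpd]; field_simp; ring
  have eB : ((m : ℝ) - ((m : ℝ) + 1) * p) / p = -1 - δ := by
    rw [add_mul, hmp, hpdef, hδ]; field_simp; ring
  rw [eA] at hbA
  rw [eB] at hbB
  obtain ⟨c1, hc1, hone⟩ := oneD hδ0 hδ1
  rw [hpd] at hone
  refine ⟨(cA + cB) ^ p * c1, ENNReal.mul_ne_top (ENNReal.rpow_ne_top_of_nonneg hp0.le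
    (ENNReal.add_ne_top.2 ⟨hcA, hcB⟩)) hc1, ?_⟩
  intro hA hB hAm hBm T hT0 hTt hBT ⟨N, hN, hAN⟩ G hG
  set a : ℝ → ℝ≥0∞ := fun t => ∫⁻ y, hA t y with ha
  have ham : Measurable a := hAm.lintegral_prod_right'
  have haTm : Measurable fun t => T⁻¹ * a t := ham.const_mul _
  have hcT : (cA + cB) * T ≠ ∞ := ENNReal.mul_ne_top (ENNReal.add_ne_top.2 ⟨hcA, hcB⟩) hTt
  have step : ∀ s, ∫⁻ x, G s x ^ p ≤ ((cA + cB) * T) ^ p * (∫⁻ t, mk1 δ (T⁻¹ * a t) (t - s)) ^ p := by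
    intro s
    have mA : ∀ (q : ℝ) (h : ℝ → (Fin m → ℝ) → ℝ≥0∞), Measurable (Function.uncurry h) →
        Measurable (fun z : ℝ × (Fin m → ℝ) =>
        ∫⁻ y, ENNReal.ofReal (max |z.1 - s| ‖z.2 - y‖) ^ q * h z.1 y) := by
      intro q h hh
      refine Measurable.lintegral_prod_right' (f := fun w : (ℝ × (Fin m → ℝ)) × (Fin m → ℝ) =>
        ENNReal.ofReal (max |w.1.1 - s| ‖w.1.2 - w.2‖) ^ q * h w.1.1 w.2) ?_
      have h2 : Measurable fun w : (ℝ × (Fin m → ℝ)) × (Fin m → ℝ) => h w.1.1 w.2 :=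
        hh.comp (f := fun w : (ℝ × (Fin m → ℝ)) × (Fin m → ℝ) => (w.1.1, w.2)) (by fun_prop)
      exact Measurable.mul ((maxk_meas q).comp
        (f := fun w : (ℝ × (Fin m → ℝ)) × (Fin m → ℝ) => (|w.1.1 - s|, w.1.2, w.2)) (by fun_prop)) h2
    have hmk : Measurable fun t => mk1 δ (T⁻¹ * a t) (t - s) :=
      (mk1_meas δ).comp (haTm.prodMk (measurable_id.sub measurable_const))
    have := mink (μ := (volume : Measure ℝ)) (ν := (volume : Measure (Fin m → ℝ))) hp
      (h := fun t x => min (∫⁻ y, ENNReal.ofReal (max |t - s| ‖x - y‖) ^ (-(m : ℝ)) * hA t y)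
      (∫⁻ y, ENNReal.ofReal (max |t - s| ‖x - y‖) ^ (-((m : ℝ) + 1)) * hB t y))
      ((mA _ hA hAm).min (mA _ hB hBm))
      (κ := fun t => ((cA + cB) * T) * mk1 δ (T⁻¹ * a t) (t - s))
      (hmk.const_mul _) (fun t => ?_)
    · rw [lintegral_const_mul _ hmk, ENNReal.mul_rpow_of_nonneg _ _ hp0.le] at this
      refine le_trans (lintegral_mono fun x => ?_) this
      gcongr
      exact hG s x
    · have b1 := hbA (hA t) (hAm.comp measurable_prodMk_left) |t - s| (abs_nonneg _)
      have b2 := hbB (hB t) (hBm.comp measurable_prodMk_left) |t - s| (abs_nonneg _)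
      unfold mk1
      rcases le_total (T⁻¹ * a t * ENNReal.ofReal |t - s| ^ (-δ)) (ENNReal.ofReal |t - s| ^ (-1 - δ)) with h | h
      · rw [min_eq_left h]
        refine le_trans (lintegral_mono fun x => ?_) (b1.trans ?_)
        · gcongr; exact min_le_left _ _
        · refine ENNReal.rpow_le_rpow ?_ hp0.le
          calc cA * ENNReal.ofReal |t - s| ^ (-δ) * a t
              ≤ (cA + cB) * ENNReal.ofReal |t - s| ^ (-δ) * a t := by gcongr; exact le_self_add
            _ = (cA + cB) * (T * T⁻¹) * (a t * ENNReal.ofReal |t - s| ^ (-δ)) := by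
                rw [ENNReal.mul_inv_cancel hT0 hTt]; ring
            _ = _ := by ring
      · rw [min_eq_right h]
        refine le_trans (lintegral_mono fun x => ?_) (b2.trans ?_)
        · gcongr; exact min_le_right _ _
        · refine ENNReal.rpow_le_rpow ?_ hp0.le
          calc cB * ENNReal.ofReal |t - s| ^ (-1 - δ) * ∫⁻ y, hB t y
              ≤ (cA + cB) * ENNReal.ofReal |t - s| ^ (-1 - δ) * T := by
                gcongr
                · exact le_add_self
                · exact hBT t
            _ = _ := by ring
  have hfin := hone (fun t => T⁻¹ * a t) haTm ⟨T⁻¹ * N, ENNReal.mul_ne_top (ENNReal.inv_ne_top.2 hT0) hN,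
    fun t => by gcongr; exact hAN t⟩
  calc ∫⁻ s, ∫⁻ x, G s x ^ p ≤ ∫⁻ s, ((cA + cB) * T) ^ p * (∫⁻ t, mk1 δ (T⁻¹ * a t) (t - s)) ^ p :=
        lintegral_mono step
    _ = ((cA + cB) * T) ^ p * ∫⁻ s, (∫⁻ t, mk1 δ (T⁻¹ * a t) (t - s)) ^ p :=
        lintegral_const_mul' _ _ (ENNReal.rpow_ne_top_of_nonneg hp0.le hcT)
    _ ≤ ((cA + cB) * T) ^ p * (c1 * ∫⁻ t, T⁻¹ * a t) := by gcongr
    _ = _ := by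
        rw [lintegral_const_mul _ ham, ENNReal.mul_rpow_of_nonneg _ _ hp0.le]; ring

theorem cube_vol {m : ℕ} (y : Fin m → ℝ) {r : ℝ} (hr : 0 ≤ r) :
    ∫⁻ x : Fin m → ℝ, (if ‖x - y‖ ≤ r then (1 : ℝ≥0∞) else 0) = ENNReal.ofReal (2 * r) ^ m := by
  have : (fun x : Fin m → ℝ => if ‖x - y‖ ≤ r then (1 : ℝ≥0∞) else 0) =
      (closedBall y r).indicator 1 := by
    funext x; simp [Set.indicator, dist_eq_norm]
  rw [this, lintegral_indicator_one measurableSet_closedBall, Real.volume_pi_closedBall _ hr]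
  rw [ENNReal.ofReal_pow (by positivity)]; simp

theorem rho_int2 {m : ℕ} {τ : ℝ} (hτ : 0 < τ) :
    ∫⁻ ρ in Set.Ioc (0:ℝ) 1, (if τ ≤ 2 * ρ ∧ ρ ≤ 4 * τ then
      ENNReal.ofReal ρ ^ (-((m:ℝ) + 1)) * ENNReal.ofReal (2 * (2 * ρ)) ^ m else 0) ≤
      ENNReal.ofReal (8 * 4 ^ m) := by
  have hb : ∀ ρ : ℝ, (if τ ≤ 2 * ρ ∧ ρ ≤ 4 * τ then
      ENNReal.ofReal ρ ^ (-((m:ℝ) + 1)) * ENNReal.ofReal (2 * (2 * ρ)) ^ m else 0) ≤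
      (Set.Icc 0 (4 * τ)).indicator (fun _ => ENNReal.ofReal (4 ^ m * (2 / τ))) ρ := by
    intro ρ
    split_ifs with h
    · have hρ : 0 < ρ := by linarith [h.1]
      rw [Set.indicator_of_mem (show ρ ∈ Set.Icc 0 (4 * τ) from ⟨hρ.le, h.2⟩), ENNReal.ofReal_rpow_of_pos hρ, ← ENNReal.ofReal_pow (by positivity),
        ← ENNReal.ofReal_mul (by positivity)]
      apply ENNReal.ofReal_le_ofReal
      have e : ρ ^ (-((m:ℝ) + 1)) = (ρ ^ m)⁻¹ * ρ⁻¹ := by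
        rw [Real.rpow_neg hρ.le, Real.rpow_add hρ, Real.rpow_one, Real.rpow_natCast, mul_inv]
      rw [e, show 2 * (2 * ρ) = 4 * ρ by ring, mul_pow]
      have : ρ⁻¹ ≤ 2 / τ := by
        rw [inv_eq_one_div, div_le_div_iff₀ hρ hτ]; linarith [h.1]
      calc _ = 4 ^ m * ρ⁻¹ := by field_simp
        _ ≤ _ := by gcongr
    · exact zero_le
  refine (lintegral_mono hb).trans ((setLIntegral_le_lintegral _ _).trans ?_)
  rw [lintegral_indicator_const measurableSet_Icc, Real.volume_Icc, ← ENNReal.ofReal_mul (by positivity)]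
  apply ENNReal.ofReal_le_ofReal
  rw [sub_zero]
  have : 4 ^ m * (2 / τ) * (4 * τ) = 8 * 4 ^ m := by field_simp; ring
  exact this.le

theorem trace_abs {m : ℕ} (s : ℝ) (h : ℝ → (Fin m → ℝ) → ℝ≥0∞) (hh : Measurable (Function.uncurry h)) :
    ∫⁻ x : Fin m → ℝ, ∫⁻ ρ in Set.Ioc (0:ℝ) 1, ∫⁻ t, ∫⁻ y, ENNReal.ofReal ρ ^ (-((m:ℝ) + 1)) *
      ((if ‖x - y‖ ≤ 2 * ρ ∧ |t - s| ≤ 2 * ρ ∧ ρ ≤ 4 * |t - s| then 1 else 0) * h t y)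
     ≤ ENNReal.ofReal (8 * 4 ^ m) * ∫⁻ t, ∫⁻ y, h t y := by
  have hS : MeasurableSet {z : (Fin m → ℝ) × ℝ × ℝ × (Fin m → ℝ) |
      ‖z.1 - z.2.2.2‖ ≤ 2 * z.2.1 ∧ |z.2.2.1 - s| ≤ 2 * z.2.1 ∧ z.2.1 ≤ 4 * |z.2.2.1 - s|} := by
    have a1 : IsClosed {z : (Fin m → ℝ) × ℝ × ℝ × (Fin m → ℝ) | ‖z.1 - z.2.2.2‖ ≤ 2 * z.2.1} :=
      isClosed_le (by fun_prop) (by fun_prop)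
    have a2 : IsClosed {z : (Fin m → ℝ) × ℝ × ℝ × (Fin m → ℝ) | |z.2.2.1 - s| ≤ 2 * z.2.1} :=
      isClosed_le (by fun_prop) (by fun_prop)
    have a3 : IsClosed {z : (Fin m → ℝ) × ℝ × ℝ × (Fin m → ℝ) | z.2.1 ≤ 4 * |z.2.2.1 - s|} :=
      isClosed_le (by fun_prop) (by fun_prop)
    exact (a1.inter (a2.inter a3)).measurableSet
  have hm : Measurable fun z : (Fin m → ℝ) × ℝ × ℝ × (Fin m → ℝ) => ENNReal.ofReal z.2.1 ^ (-((m:ℝ) + 1)) *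
      ((if ‖z.1 - z.2.2.2‖ ≤ 2 * z.2.1 ∧ |z.2.2.1 - s| ≤ 2 * z.2.1 ∧ z.2.1 ≤ 4 * |z.2.2.1 - s| then 1 else 0) *
        h z.2.2.1 z.2.2.2) := by
    have h2 : Measurable fun z : (Fin m → ℝ) × ℝ × ℝ × (Fin m → ℝ) => h z.2.2.1 z.2.2.2 :=
      hh.comp (f := fun z : (Fin m → ℝ) × ℝ × ℝ × (Fin m → ℝ) => (z.2.2.1, z.2.2.2)) (by fun_prop)
    exact Measurable.mul (by fun_prop) (Measurable.mul (Measurable.ite hS measurable_const measurable_const) h2)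
  -- convert to product integrals
  let μ : Measure ℝ := volume.restrict (Set.Ioc (0:ℝ) 1)
  have e1 : ∀ x : Fin m → ℝ, ∫⁻ ρ in Set.Ioc (0:ℝ) 1, ∫⁻ t, ∫⁻ y, ENNReal.ofReal ρ ^ (-((m:ℝ) + 1)) *
      ((if ‖x - y‖ ≤ 2 * ρ ∧ |t - s| ≤ 2 * ρ ∧ ρ ≤ 4 * |t - s| then 1 else 0) * h t y)  =
      ∫⁻ t, ∫⁻ y, ∫⁻ ρ in Set.Ioc (0:ℝ) 1, ENNReal.ofReal ρ ^ (-((m:ℝ) + 1)) *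
      ((if ‖x - y‖ ≤ 2 * ρ ∧ |t - s| ≤ 2 * ρ ∧ ρ ≤ 4 * |t - s| then 1 else 0) * h t y) := by
    intro x
    rw [lintegral_lintegral_swap]
    · refine lintegral_congr fun t => ?_
      rw [lintegral_lintegral_swap]
      refine Measurable.aemeasurable (hm.comp (f := fun z : ℝ × (Fin m → ℝ) => (x, z.1, t, z.2)) (by fun_prop))
    · refine (Measurable.lintegral_prod_right' (f := fun w : (ℝ × ℝ) × (Fin m → ℝ) => _)
        (hm.comp (f := fun z : (ℝ × ℝ) × (Fin m → ℝ) => (x, z.1.1, z.1.2, z.2)) (by fun_prop))).aemeasurable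
  have e2 : ∫⁻ x : Fin m → ℝ, ∫⁻ t, ∫⁻ y, ∫⁻ ρ in Set.Ioc (0:ℝ) 1, ENNReal.ofReal ρ ^ (-((m:ℝ) + 1)) *
      ((if ‖x - y‖ ≤ 2 * ρ ∧ |t - s| ≤ 2 * ρ ∧ ρ ≤ 4 * |t - s| then 1 else 0) * h t y)  =
      ∫⁻ t, ∫⁻ y, ∫⁻ ρ in Set.Ioc (0:ℝ) 1, (∫⁻ x : Fin m → ℝ, ENNReal.ofReal ρ ^ (-((m:ℝ) + 1)) *
      ((if ‖x - y‖ ≤ 2 * ρ ∧ |t - s| ≤ 2 * ρ ∧ ρ ≤ 4 * |t - s| then 1 else 0) * h t y)) := by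
    rw [lintegral_lintegral_swap]
    · refine lintegral_congr fun t => ?_
      rw [lintegral_lintegral_swap]
      · refine lintegral_congr fun y => ?_
        rw [lintegral_lintegral_swap]
        exact Measurable.aemeasurable (hm.comp (f := fun z : (Fin m → ℝ) × ℝ => (z.1, z.2, t, y)) (by fun_prop))
      · exact (Measurable.lintegral_prod_right' (ν := μ) (f := fun w : ((Fin m → ℝ) × (Fin m → ℝ)) × ℝ => _)
          (hm.comp (f := fun z : ((Fin m → ℝ) × (Fin m → ℝ)) × ℝ => (z.1.1, z.2, t, z.1.2))
          (by fun_prop))).aemeasurable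
    · have a1 := Measurable.lintegral_prod_right' (ν := μ) (f := fun w : (((Fin m → ℝ) × ℝ) × (Fin m → ℝ)) × ℝ => _)
          (hm.comp (f := fun z : (((Fin m → ℝ) × ℝ) × (Fin m → ℝ)) × ℝ => (z.1.1.1, z.2, z.1.1.2, z.1.2))
          (by fun_prop))
      exact (Measurable.lintegral_prod_right' a1).aemeasurable
  refine (lintegral_congr e1).le.trans (e2.le.trans ?_)
  have hh1 : Measurable fun t => ∫⁻ y, h t y := hh.lintegral_prod_right'
  rw [← lintegral_const_mul _ hh1]
  have hne : ∀ᵐ t : ℝ, t ≠ s := by simp [ae_iff, measure_singleton]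
  refine lintegral_mono_ae ?_
  filter_upwards [hne] with t ht
  have hτ : 0 < |t - s| := abs_pos.2 (sub_ne_zero.2 ht)
  rw [← lintegral_const_mul' _ _ ENNReal.ofReal_ne_top]
  refine lintegral_mono fun y => ?_
  have e3 : ∀ᵐ ρ ∂μ, (∫⁻ x : Fin m → ℝ, ENNReal.ofReal ρ ^ (-((m:ℝ) + 1)) *
      ((if ‖x - y‖ ≤ 2 * ρ ∧ |t - s| ≤ 2 * ρ ∧ ρ ≤ 4 * |t - s| then 1 else 0) * h t y)) ≤
      (if |t - s| ≤ 2 * ρ ∧ ρ ≤ 4 * |t - s| then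
      ENNReal.ofReal ρ ^ (-((m:ℝ) + 1)) * ENNReal.ofReal (2 * (2 * ρ)) ^ m else 0) * h t y := by
    filter_upwards [ae_restrict_mem measurableSet_Ioc] with ρ hρ
    have hρ0 : 0 < ρ := hρ.1
    by_cases hc : |t - s| ≤ 2 * ρ ∧ ρ ≤ 4 * |t - s|
    · simp only [hc, and_true, and_self, if_true]
      have : ∀ x : Fin m → ℝ, ENNReal.ofReal ρ ^ (-((m:ℝ) + 1)) * ((if ‖x - y‖ ≤ 2 * ρ then 1 else 0) * h t y) =
          (ENNReal.ofReal ρ ^ (-((m:ℝ) + 1)) * h t y) * (if ‖x - y‖ ≤ 2 * ρ then 1 else 0) := fun x => by ring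
      simp only [this]
      rw [lintegral_const_mul, cube_vol y (by positivity)]
      · apply le_of_eq; ring
      · exact Measurable.ite ((isClosed_le (by fun_prop) (by fun_prop)).measurableSet) measurable_const measurable_const
    · have : ∀ x : Fin m → ℝ, ¬ (‖x - y‖ ≤ 2 * ρ ∧ |t - s| ≤ 2 * ρ ∧ ρ ≤ 4 * |t - s|) := fun x h => hc h.2
      simp [this]
  refine (lintegral_mono_ae e3).trans ?_
  rw [lintegral_mul_const]
  · gcongr
    exact rho_int2 hτ
  · refine Measurable.ite ?_ (by fun_prop) measurable_const
    have a2 : IsClosed {ρ : ℝ | |t - s| ≤ 2 * ρ} := isClosed_le (by fun_prop) (by fun_prop)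
    have a3 : IsClosed {ρ : ℝ | ρ ≤ 4 * |t - s|} := isClosed_le (by fun_prop) (by fun_prop)
    exact (a2.inter a3).measurableSet

end

noncomputable section
open MeasureTheory Metric MvPolynomial
open scoped ENNReal RealInnerProductSpace

/-- orthonormal coordinates with first axis `e` -/
structure Coord (m : ℕ) (e : Euc (m + 1)) where
  Φ : (ℝ × (Fin m → ℝ)) ≃L[ℝ] Euc (m + 1)
  mp : MeasurePreserving Φ volume volume
  inn : ∀ z, ⟪e, Φ z⟫ = z.1
  n1 : ∀ z, |z.1| ≤ ‖Φ z‖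
  n2 : ∀ z, ‖z.2‖ ≤ ‖Φ z‖

theorem exists_coord {m : ℕ} (e : Euc (m + 1)) (he : ‖e‖ = 1) : Nonempty (Coord m e) := by
  obtain ⟨b, hb⟩ := Orthonormal.exists_orthonormalBasis_extension_of_card_eq (𝕜 := ℝ) (E := Euc (m + 1))
    (ι := Fin (m + 1)) (by simp) (v := fun _ => e) (s := {0}) (by
      rw [orthonormal_iff_ite]
      intro i j
      have : i = j := Subsingleton.elim _ _
      simp [this, he])
  have hb0 : b 0 = e := hb 0 rfl
  let L : (ℝ × (Fin m → ℝ)) ≃L[ℝ] Euc (m + 1) :=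
    ((Fin.consEquivL ℝ (fun _ : Fin (m + 1) => ℝ)).trans
      (EuclideanSpace.equiv (Fin (m + 1)) ℝ).symm).trans b.repr.symm.toContinuousLinearEquiv
  have hL : ∀ z, L z = b.repr.symm (WithLp.toLp 2 (Fin.cons z.1 z.2)) := fun z => rfl
  have hn : ∀ z, ‖L z‖ = ‖(WithLp.toLp 2 (Fin.cons z.1 z.2) : Euc (m + 1))‖ := fun z => by
    rw [hL, LinearIsometryEquiv.norm_map]
  have hcoord : ∀ z i, |(Fin.cons z.1 z.2 : Fin (m + 1) → ℝ) i| ≤ ‖L z‖ := fun z i => by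
    rw [hn]
    exact PiLp.norm_apply_le (WithLp.toLp 2 (Fin.cons z.1 z.2) : Euc (m + 1)) i
  refine ⟨⟨L, ?_, fun z => ?_, fun z => ?_, fun z => ?_⟩⟩
  · have h1 := (volume_preserving_piFinSuccAbove (fun _ : Fin (m + 1) => ℝ) 0).symm
    have h2 := PiLp.volume_preserving_toLp (Fin (m + 1))
    have h3 := b.measurePreserving_repr_symm
    have h4 := h3.comp (h2.comp h1)
    have : (L : ℝ × (Fin m → ℝ) → Euc (m + 1)) = b.repr.symm ∘ (WithLp.toLp 2 ∘
        (MeasurableEquiv.piFinSuccAbove (fun _ : Fin (m + 1) => ℝ) 0).symm) := by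
      funext z
      rw [hL]
      simp only [Function.comp]
      congr 2
      exact (Fin.insertNth_zero' (β := ℝ) z.1 z.2).symm
    rw [this]
    exact h4
  · rw [← hb0, hL, ← OrthonormalBasis.repr_apply_apply]
    simp
  · simpa using hcoord z 0
  · refine (pi_norm_le_iff_of_nonneg (norm_nonneg _)).2 fun i => ?_
    simpa using hcoord z i.succ

variable {m : ℕ} {e : Euc (m + 1)}

theorem coord_lint (Q : Coord m e) {g : Euc (m + 1) → ℝ≥0∞} (hg : Measurable g) :
    ∫⁻ y, g y = ∫⁻ t, ∫⁻ y', g (Q.Φ (t, y')) := by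
  rw [← Q.mp.lintegral_comp hg]
  exact lintegral_prod (μ := (volume : Measure ℝ)) (ν := (volume : Measure (Fin m → ℝ))) _
    (hg.comp Q.Φ.continuous.measurable).aemeasurable

theorem coord_int (Q : Coord m e) {g : Euc (m + 1) → ℝ} (hg : Continuous g) (hs : HasCompactSupport g) :
    ∫ y, g y = ∫ t, ∫ y', g (Q.Φ (t, y')) := by
  have hi : Integrable g := hg.integrable_of_hasCompactSupport hs
  rw [← Q.mp.integral_comp Q.Φ.toHomeomorph.measurableEmbedding]
  have hi2 : Integrable (fun z : ℝ × (Fin m → ℝ) => g (Q.Φ z)) := by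
    refine (hg.comp Q.Φ.continuous).integrable_of_hasCompactSupport ?_
    exact hs.comp_homeomorph Q.Φ.toHomeomorph
  exact integral_prod (μ := (volume : Measure ℝ)) (ν := (volume : Measure (Fin m → ℝ))) _ hi2

theorem dil_int (g : Euc (m + 1) → ℝ) (x : Euc (m + 1)) {ρ : ℝ} (hρ : 0 < ρ) :
    ∫ z, g z = (ρ ^ (m + 1))⁻¹ * ∫ y, g (x + ρ⁻¹ • (y - x)) := by
  rw [integral_sub_right_eq_self (μ := (volume : Measure (Euc (m + 1)))) (fun y => g (x + ρ⁻¹ • y)) x,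
    Measure.integral_comp_smul (volume : Measure (Euc (m + 1))) (fun y => g (x + y)) ρ⁻¹]
  rw [integral_add_left_eq_self (μ := (volume : Measure (Euc (m + 1)))) g x]
  simp only [finrank_euclideanSpace, Fintype.card_fin, smul_eq_mul]
  rw [abs_of_pos (by positivity), inv_pow, inv_inv]
  field_simp

theorem ker_dil_cs {c : Euc (m + 1)} {r : ℝ} {Θ : Euc (m + 1) → Euc (m + 1) → ℝ} (h : IsKer c r Θ)
    (x : Euc (m + 1)) {ρ : ℝ} (hρ : 0 < ρ) (f : Euc (m + 1) → ℝ) :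
    HasCompactSupport fun y => Θ x (x + ρ⁻¹ • (y - x)) * f y := by
  refine HasCompactSupport.intro (isCompact_closedBall (x + ρ • (c - x)) (ρ * r)) fun y hy => ?_
  rw [h.supp, zero_mul]
  intro hmem
  apply hy
  rw [mem_closedBall, dist_eq_norm] at hmem ⊢
  have : y - (x + ρ • (c - x)) = ρ • (x + ρ⁻¹ • (y - x) - c) := by
    have h2 : ρ • (x + ρ⁻¹ • (y - x) - c) = ρ • (x - c) + (ρ * ρ⁻¹) • (y - x) := by module
    rw [h2, mul_inv_cancel₀ hρ.ne']; module
  rw [this, norm_smul, Real.norm_of_nonneg hρ.le]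
  gcongr

theorem ker_cont2 {c : Euc (m + 1)} {r : ℝ} {Θ : Euc (m + 1) → Euc (m + 1) → ℝ} (h : IsKer c r Θ) :
    Continuous (Function.uncurry Θ) := h.smooth.continuous

theorem J_rep (Q : Coord m e) {c : Euc (m + 1)} {r : ℝ} {Θ : Euc (m + 1) → Euc (m + 1) → ℝ}
    (h : IsKer c r Θ) {f : Euc (m + 1) → ℝ} (hf : Continuous f) (x : Euc (m + 1)) :
    ‖∫ ρ in (0:ℝ)..1, ∫ z, Θ x z * f (x + ρ • (z - x))‖ₑ ≤
      ∫⁻ ρ in Set.Ioc (0:ℝ) 1, ∫⁻ t, ENNReal.ofReal ρ ^ (-((m:ℝ) + 1)) *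
        ‖∫ y', Θ x (x + ρ⁻¹ • (Q.Φ (t, y') - x)) * f (Q.Φ (t, y'))‖ₑ := by
  rw [intervalIntegral.integral_of_le zero_le_one]
  refine (enorm_integral_le_lintegral_enorm _).trans ?_
  refine setLIntegral_mono' measurableSet_Ioc fun ρ hρ => ?_
  have hρ0 := hρ.1
  have e0 : ∀ y, x + ρ • (x + ρ⁻¹ • (y - x) - x) = y := fun y => by
    rw [add_sub_cancel_left, smul_smul, mul_inv_cancel₀ hρ0.ne']; simp
  rw [dil_int _ x hρ0]
  simp only [e0]
  rw [coord_int Q _ (ker_dil_cs h x hρ0 f)]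
  · rw [enorm_mul]
    have : ‖(ρ ^ (m + 1))⁻¹‖ₑ = ENNReal.ofReal ρ ^ (-((m:ℝ) + 1)) := by
      rw [Real.enorm_of_nonneg (by positivity), ENNReal.ofReal_rpow_of_pos hρ0, Real.rpow_neg hρ0.le]
      congr 2
      rw [← Real.rpow_natCast]; push_cast; rfl
    rw [this, lintegral_const_mul']
    · gcongr
      exact enorm_integral_le_lintegral_enorm _
    · exact ENNReal.rpow_ne_top_of_ne_zero (by simpa using hρ0) (by simp)
  · have h1 : Continuous fun y => Θ x (x + ρ⁻¹ • (y - x)) :=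
      (ker_cont2 h).comp (f := fun y => (x, x + ρ⁻¹ • (y - x))) (by fun_prop)
    exact h1.mul hf

theorem ker_supp_geo {c : Euc (m + 1)} {r : ℝ} (hc : ‖c‖ + r < 1) {x y : Euc (m + 1)} (hx : x ∈ ball (0 : Euc (m + 1)) 1)
    {ρ : ℝ} (hρ : ρ ∈ Set.Ioc (0:ℝ) 1) (hz : x + ρ⁻¹ • (y - x) ∈ closedBall c r) :
    y ∈ ball (0 : Euc (m + 1)) 1 ∧ ‖x - y‖ ≤ 2 * ρ := by
  have hρ0 := hρ.1
  set z := x + ρ⁻¹ • (y - x) with hzdef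
  have hz1 : ‖z‖ < 1 := by
    rw [mem_closedBall, dist_eq_norm] at hz
    calc ‖z‖ = ‖c + (z - c)‖ := by congr 1; abel
      _ ≤ ‖c‖ + ‖z - c‖ := norm_add_le _ _
      _ < 1 := by linarith
  have hx1 : ‖x‖ < 1 := by simpa using hx
  have hy : y = (1 - ρ) • x + ρ • z := by
    rw [hzdef, smul_add, smul_smul, mul_inv_cancel₀ hρ0.ne']; module
  constructor
  · have := (convex_ball (0 : Euc (m + 1)) 1) hx (by simpa using hz1 : z ∈ ball (0 : Euc (m + 1)) 1)
      (sub_nonneg.2 hρ.2) hρ0.le (by ring)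
    rwa [← hy] at this
  · have : x - y = ρ • (x - z) := by rw [hy]; module
    rw [this, norm_smul, Real.norm_of_nonneg hρ0.le, mul_comm]
    gcongr
    linarith [norm_sub_le x z]

theorem coord_dist (Q : Coord m e) (s t : ℝ) (x' y' : Fin m → ℝ) :
    |t - s| ≤ ‖Q.Φ (s, x') - Q.Φ (t, y')‖ ∧ ‖x' - y'‖ ≤ ‖Q.Φ (s, x') - Q.Φ (t, y')‖ := by
  rw [← map_sub]
  refine ⟨?_, Q.n2 ((s, x') - (t, y'))⟩
  rw [abs_sub_comm]
  exact Q.n1 ((s, x') - (t, y'))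

end

noncomputable section
open MeasureTheory Metric MvPolynomial
open scoped ENNReal RealInnerProductSpace

variable {m : ℕ} {e : Euc (m + 1)}

/-- enorm restricted to the unit ball -/
def bE (f : Euc (m + 1) → ℝ) (x : Euc (m + 1)) : ℝ≥0∞ :=
  (ball (0 : Euc (m + 1)) 1).indicator (fun x => ‖f x‖ₑ) x

theorem bE_meas {f : Euc (m + 1) → ℝ} (hf : Continuous f) : Measurable (bE f) :=
  hf.enorm.measurable.indicator measurableSet_ball

theorem bE_int (f : Euc (m + 1) → ℝ) : ∫⁻ x, bE f x = ∫⁻ x in ball (0 : Euc (m + 1)) 1, ‖f x‖ₑ :=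
  lintegral_indicator measurableSet_ball _

theorem bE_mem {f : Euc (m + 1) → ℝ} {x : Euc (m + 1)} (hx : x ∈ ball (0 : Euc (m + 1)) 1) :
    bE f x = ‖f x‖ₑ := Set.indicator_of_mem hx _

theorem bE_notMem {f : Euc (m + 1) → ℝ} {x : Euc (m + 1)} (hx : x ∉ ball (0 : Euc (m + 1)) 1) :
    bE f x = 0 := Set.indicator_of_notMem hx _

theorem bE_coord_meas (Q : Coord m e) {f : Euc (m + 1) → ℝ} (hf : Continuous f) :
    Measurable (Function.uncurry fun t y => bE f (Q.Φ (t, y))) :=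
  (bE_meas hf).comp Q.Φ.continuous.measurable

theorem bE_coord_int (Q : Coord m e) {f : Euc (m + 1) → ℝ} (hf : Continuous f) :
    ∫⁻ t, ∫⁻ y, bE f (Q.Φ (t, y)) = ∫⁻ x in ball (0 : Euc (m + 1)) 1, ‖f x‖ₑ := by
  rw [← bE_int, coord_lint Q (bE_meas hf)]

theorem ker_enorm {c : Euc (m + 1)} {r : ℝ} {Θ : Euc (m + 1) → Euc (m + 1) → ℝ} (h : IsKer c r Θ) :
    ∃ C : ℝ≥0∞, C ≠ ∞ ∧ ∀ x ∈ ball (0 : Euc (m + 1)) 1, ∀ z, ‖Θ x z‖ₑ ≤ C := by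
  obtain ⟨C, hC, hb⟩ := ker_bound h
  refine ⟨ENNReal.ofReal C, by simp, fun x hx z => ?_⟩
  rw [← ofReal_norm]
  exact ENNReal.ofReal_le_ofReal (hb x (ball_subset_closedBall hx) z)

theorem ker0 {c : Euc (m + 1)} {r : ℝ} (hc : ‖c‖ + r < 1) {Θ : Euc (m + 1) → Euc (m + 1) → ℝ} (h : IsKer c r Θ) :
    ∃ C : ℝ≥0∞, C ≠ ∞ ∧ ∀ x ∈ ball (0 : Euc (m + 1)) 1, ∀ g : Euc (m + 1) → ℝ,
      ‖∫ z, Θ x z * g z‖ₑ ≤ C * ∫⁻ z in ball (0 : Euc (m + 1)) 1, ‖g z‖ₑ := by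
  obtain ⟨C, hC, hb⟩ := ker_enorm h
  refine ⟨C, hC, fun x hx g => ?_⟩
  refine (enorm_integral_le_lintegral_enorm _).trans ?_
  rw [← bE_int, ← lintegral_const_mul' _ _ hC]
  refine lintegral_mono fun z => ?_
  rw [enorm_mul]
  by_cases hz : z ∈ closedBall c r
  · have : z ∈ ball (0 : Euc (m + 1)) 1 := by
      rw [mem_closedBall, dist_eq_norm] at hz
      rw [mem_ball_zero_iff]
      calc ‖z‖ = ‖c + (z - c)‖ := by congr 1; abel
        _ ≤ ‖c‖ + ‖z - c‖ := norm_add_le _ _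
        _ < 1 := by linarith
    rw [bE_mem this]
    gcongr
    exact hb x hx z
  · rw [h.supp x z hz]; simp

theorem trace_half (Q : Coord m e) {c : Euc (m + 1)} (hc : ‖c‖ ≤ 1 / 2) {Θ : Euc (m + 1) → Euc (m + 1) → ℝ}
    (h : IsKer c (1 / 4) Θ) : ∃ C : ℝ≥0∞, C ≠ ∞ ∧ ∀ s : ℝ,
      (∀ z ∈ closedBall c (1 / 4), 1 / 4 ≤ |⟪e, z⟫ - s|) → ∀ f : Euc (m + 1) → ℝ, Continuous f →
      ∫⁻ x', bE (fun x => ∫ ρ in (0:ℝ)..1, ∫ z, Θ x z * f (x + ρ • (z - x))) (Q.Φ (s, x')) ≤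
        C * ∫⁻ x in ball (0 : Euc (m + 1)) 1, ‖f x‖ₑ := by
  obtain ⟨C, hC, hb⟩ := ker_enorm h
  refine ⟨C * ENNReal.ofReal (8 * 4 ^ m), ENNReal.mul_ne_top hC ENNReal.ofReal_ne_top, fun s hs f hf => ?_⟩
  have hmain := trace_abs s (fun t y => C * bE f (Q.Φ (t, y))) ((bE_coord_meas Q hf).const_mul C)
  have e1 : ∫⁻ t, ∫⁻ y, C * bE f (Q.Φ (t, y)) = C * ∫⁻ x in ball (0 : Euc (m + 1)) 1, ‖f x‖ₑ := by
    simp only [lintegral_const_mul' _ _ hC]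
    rw [bE_coord_int Q hf]
  rw [e1] at hmain
  refine le_trans (lintegral_mono fun x' => ?_) (hmain.trans (le_of_eq (by ring)))
  by_cases hx : Q.Φ (s, x') ∈ ball (0 : Euc (m + 1)) 1
  swap
  · rw [bE_notMem hx]; exact zero_le
  rw [bE_mem hx]
  refine (J_rep Q h hf _).trans ?_
  refine setLIntegral_mono' measurableSet_Ioc fun ρ hρ => lintegral_mono fun t => ?_
  have hρ0 : 0 < ρ := hρ.1
  rw [lintegral_const_mul' _ _ (ENNReal.rpow_ne_top_of_ne_zero (by simpa using hρ0) (by simp))]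
  gcongr
  refine (enorm_integral_le_lintegral_enorm _).trans (lintegral_mono fun y => ?_)
  rw [enorm_mul]
  by_cases hz : Q.Φ (s, x') + ρ⁻¹ • (Q.Φ (t, y) - Q.Φ (s, x')) ∈ closedBall c (1 / 4)
  swap
  · rw [h.supp _ _ hz]; simp
  obtain ⟨hy, hd⟩ := ker_supp_geo (by linarith) hx hρ hz
  obtain ⟨d1, d2⟩ := coord_dist Q s t x' y
  have d3 : ρ ≤ 4 * |t - s| := by
    have := hs _ hz
    rw [inner_add_right, inner_smul_right, inner_sub_right, Q.inn, Q.inn, add_sub_cancel_left, abs_mul,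
      abs_of_pos (inv_pos.2 hρ0)] at this
    have h2 := mul_le_mul_of_nonneg_left this hρ0.le
    rw [← mul_assoc, mul_inv_cancel₀ hρ0.ne'] at h2
    linarith
  rw [if_pos ⟨d2.trans hd, d1.trans hd, d3⟩, one_mul, bE_mem hy]
  gcongr
  exact hb _ hx _

theorem bE_meas' {f : Euc (m + 1) → ℝ} (hf : Measurable f) : Measurable (bE f) :=
  hf.enorm.indicator measurableSet_ball

theorem ker_meas {c : Euc (m + 1)} {r : ℝ} {Θ : Euc (m + 1) → Euc (m + 1) → ℝ} (h : IsKer c r Θ)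
    {f : Euc (m + 1) → ℝ} (hf : Continuous f) :
    Measurable fun x => ∫ ρ in (0:ℝ)..1, ∫ z, Θ x z * f (x + ρ • (z - x)) := by
  simp only [intervalIntegral.integral_of_le zero_le_one]
  have h1 : Continuous fun w : (Euc (m + 1) × ℝ) × Euc (m + 1) =>
      Θ w.1.1 w.2 * f (w.1.1 + w.1.2 • (w.2 - w.1.1)) := by
    have := (ker_cont2 h).comp (f := fun w : (Euc (m + 1) × ℝ) × Euc (m + 1) => (w.1.1, w.2)) (by fun_prop)
    exact this.mul (hf.comp (by fun_prop))
  have h2 := h1.stronglyMeasurable.integral_prod_right' (ν := (volume : Measure (Euc (m + 1))))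
  exact (h2.integral_prod_right' (ν := volume.restrict (Set.Ioc (0:ℝ) 1))).measurable

/-- the right hand side -/
def Tn {d q : ℕ} (P : Matrix (Fin q) (Fin d) (MvPolynomial (Fin (m + 1)) ℝ)) (u : Fin d → Sm (m + 1)) : ℝ≥0∞ :=
  (∑ b, ∫⁻ x in ball (0 : Euc (m + 1)) 1, ‖(fOp P u b).1 x‖ₑ) +
    ∑ a, ∫⁻ x in ball (0 : Euc (m + 1)) 1, ‖(u a).1 x‖ₑ

theorem Tn_f {d q : ℕ} (P : Matrix (Fin q) (Fin d) (MvPolynomial (Fin (m + 1)) ℝ)) (u : Fin d → Sm (m + 1)) (b) :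
    ∫⁻ x in ball (0 : Euc (m + 1)) 1, ‖(fOp P u b).1 x‖ₑ ≤ Tn P u :=
  le_trans (Finset.single_le_sum (f := fun b => ∫⁻ x in ball (0 : Euc (m + 1)) 1, ‖(fOp P u b).1 x‖ₑ)
    (fun _ _ => zero_le) (Finset.mem_univ b)) le_self_add

theorem Tn_u {d q : ℕ} (P : Matrix (Fin q) (Fin d) (MvPolynomial (Fin (m + 1)) ℝ)) (u : Fin d → Sm (m + 1)) (a) :
    ∫⁻ x in ball (0 : Euc (m + 1)) 1, ‖(u a).1 x‖ₑ ≤ Tn P u :=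
  le_trans (Finset.single_le_sum (f := fun a => ∫⁻ x in ball (0 : Euc (m + 1)) 1, ‖(u a).1 x‖ₑ)
    (fun _ _ => zero_le) (Finset.mem_univ a)) le_add_self

theorem trace_c {k d q : ℕ} (P : Matrix (Fin q) (Fin d) (MvPolynomial (Fin (m + 1)) ℝ))
    (hP : ∀ b a, (P b a).IsHomogeneous (k + 1)) (hell : EllP P) (Q : Coord m e)
    (β : Fin k → Fin (m + 1)) (a : Fin d) {c : Euc (m + 1)} (hc : ‖c‖ ≤ 1 / 2) :
    ∃ C : ℝ≥0∞, C ≠ ∞ ∧ ∀ s : ℝ, (∀ z ∈ closedBall c (1 / 4), 1 / 4 ≤ |⟪e, z⟫ - s|) →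
      ∀ u : Fin d → Sm (m + 1),
      ∫⁻ x', bE (dOp (∏ i, X (β i)) (u a)).1 (Q.Φ (s, x')) ≤ C * Tn P u := by
  obtain ⟨Θ0, Θ1, h0, h1, hrep⟩ := rep P hP hell c (r := 1 / 4) (by norm_num) β a
  obtain ⟨C0, hC0, hb0⟩ := ker0 (by linarith) h0
  choose C1 hC1 hb1 using fun b => trace_half Q hc (h1 b)
  refine ⟨C0 * 2 ^ m + ∑ b, C1 b, ?_, fun s hs u => ?_⟩
  · refine ENNReal.add_ne_top.2 ⟨ENNReal.mul_ne_top hC0 (by simp), ENNReal.sum_ne_top.2 fun b _ => hC1 b⟩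
  have hfc : ∀ b, Continuous (fOp P u b).1 := fun b => sm_cont _
  have hpt : ∀ x', bE (dOp (∏ i, X (β i)) (u a)).1 (Q.Φ (s, x')) ≤
      (if ‖x' - 0‖ ≤ 1 then 1 else 0) * (C0 * Tn P u) +
      ∑ b, bE (fun x => ∫ ρ in (0:ℝ)..1, ∫ z, Θ1 b x z * (fOp P u b).1 (x + ρ • (z - x))) (Q.Φ (s, x')) := by
    intro x'
    by_cases hx : Q.Φ (s, x') ∈ ball (0 : Euc (m + 1)) 1
    swap
    · rw [bE_notMem hx]; exact zero_le
    have hx1 : ‖x' - 0‖ ≤ 1 := by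
      rw [sub_zero]
      exact (Q.n2 (s, x')).trans (by simpa using (mem_ball_zero_iff.1 hx).le)
    rw [bE_mem hx, hrep u, if_pos hx1, one_mul]
    refine (enorm_add_le _ _).trans ?_
    gcongr
    · refine (hb0 _ hx _).trans ?_
      gcongr
      exact Tn_u P u a
    · refine (enorm_sum_le _ _).trans (Finset.sum_le_sum fun b _ => ?_)
      rw [bE_mem hx]
  refine (lintegral_mono hpt).trans ?_
  have hmeas : ∀ b, Measurable fun x' => bE (fun x => ∫ ρ in (0:ℝ)..1, ∫ z, Θ1 b x z *
      (fOp P u b).1 (x + ρ • (z - x))) (Q.Φ (s, x')) := fun b =>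
    (bE_meas' (ker_meas (h1 b) (hfc b))).comp
      (Q.Φ.continuous.comp (by fun_prop : Continuous fun x' : Fin m → ℝ => (s, x'))).measurable
  have hind : Measurable fun x' : Fin m → ℝ => (if ‖x' - 0‖ ≤ 1 then (1 : ℝ≥0∞) else 0) :=
    Measurable.ite ((isClosed_le (by fun_prop) (by fun_prop)).measurableSet) measurable_const measurable_const
  rw [lintegral_add_left (hind.mul_const _), lintegral_mul_const _ hind, cube_vol _ zero_le_one,
    lintegral_finsetSum _ (fun b _ => hmeas b), add_mul, Finset.sum_mul]
  refine add_le_add ?_ (Finset.sum_le_sum fun b _ => ?_)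
  · simp only [mul_one]
    rw [show ENNReal.ofReal 2 = 2 by simp]
    apply le_of_eq; ring
  · refine (hb1 b s hs _ (hfc b)).trans ?_
    gcongr
    exact Tn_f P u b

theorem trace {k d q : ℕ} (P : Matrix (Fin q) (Fin d) (MvPolynomial (Fin (m + 1)) ℝ))
    (hP : ∀ b a, (P b a).IsHomogeneous (k + 1)) (hell : EllP P) (he : ‖e‖ = 1) (Q : Coord m e)
    (β : Fin k → Fin (m + 1)) (a : Fin d) :
    ∃ C : ℝ≥0∞, C ≠ ∞ ∧ ∀ s : ℝ, ∀ u : Fin d → Sm (m + 1),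
      ∫⁻ x', bE (dOp (∏ i, X (β i)) (u a)).1 (Q.Φ (s, x')) ≤ C * Tn P u := by
  have hin : ∀ (σ : ℝ) (z : Euc (m + 1)), z ∈ closedBall (σ • e) (1 / 4) → |⟪e, z⟫ - σ| ≤ 1 / 4 := by
    intro σ z hz
    rw [mem_closedBall, dist_eq_norm] at hz
    have : ⟪e, z⟫ - σ = ⟪e, z - σ • e⟫ := by
      rw [inner_sub_right, inner_smul_right, real_inner_self_eq_norm_sq, he]; ring
    rw [this]
    refine (abs_real_inner_le_norm _ _).trans ?_
    rw [he, one_mul]; exact hz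
  have hnorm : ∀ σ : ℝ, |σ| ≤ 1 / 2 → ‖σ • e‖ ≤ 1 / 2 := fun σ hσ => by
    rw [norm_smul, he, mul_one]; exact hσ
  obtain ⟨C1, hC1, hb1⟩ := trace_c P hP hell Q β a (hnorm (-(1/2)) (by rw [abs_neg, abs_of_pos] <;> norm_num))
  obtain ⟨C2, hC2, hb2⟩ := trace_c P hP hell Q β a (hnorm (1/2) (by rw [abs_of_pos]; norm_num))
  refine ⟨C1 + C2, ENNReal.add_ne_top.2 ⟨hC1, hC2⟩, fun s u => ?_⟩
  rcases le_total 0 s with hs | hs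
  · refine (hb1 s (fun z hz => ?_) u).trans (by gcongr; exact le_self_add)
    have := abs_le.1 (hin _ z hz)
    rw [abs_of_neg] <;> linarith [this.1, this.2]
  · refine (hb2 s (fun z hz => ?_) u).trans (by gcongr; exact le_add_self)
    have := abs_le.1 (hin _ z hz)
    rw [abs_of_pos] <;> linarith [this.1, this.2]

end

noncomputable section
open MeasureTheory Metric MvPolynomial
open scoped ENNReal RealInnerProductSpace

variable {m : ℕ} {e : Euc (m + 1)}

theorem slice_cs (Q : Coord m e) {g : Euc (m + 1) → ℝ} (hg : HasCompactSupport g) (t : ℝ) :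
    HasCompactSupport fun y' => g (Q.Φ (t, y')) := by
  refine HasCompactSupport.intro (K := (fun w => (Q.Φ.symm w).2) '' tsupport g)
    (hg.isCompact.image (by fun_prop)) fun y' hy => ?_
  by_contra h
  apply hy
  refine ⟨Q.Φ (t, y'), subset_tsupport _ h, by simp⟩

theorem slice_cont {c : Euc (m + 1)} {r : ℝ} {Θ : Euc (m + 1) → Euc (m + 1) → ℝ} (h : IsKer c r Θ) (Q : Coord m e)
    {g : Euc (m + 1) → ℝ} (hg : Continuous g) (x : Euc (m + 1)) (t ρ : ℝ) :
    Continuous fun y' => Θ x (x + ρ⁻¹ • (Q.Φ (t, y') - x)) * g (Q.Φ (t, y')) := by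
  have h1 : Continuous fun y' => Θ x (x + ρ⁻¹ • (Q.Φ (t, y') - x)) :=
    (ker_cont2 h).comp (f := fun y' => (x, x + ρ⁻¹ • (Q.Φ (t, y') - x))) (by fun_prop)
  exact h1.mul (hg.comp (by fun_prop))

theorem slice_int {c : Euc (m + 1)} {r : ℝ} {Θ : Euc (m + 1) → Euc (m + 1) → ℝ} (h : IsKer c r Θ) (Q : Coord m e)
    {g : Euc (m + 1) → ℝ} (hg : Continuous g) (x : Euc (m + 1)) (t : ℝ) {ρ : ℝ} (hρ : 0 < ρ) :
    Integrable fun y' => Θ x (x + ρ⁻¹ • (Q.Φ (t, y') - x)) * g (Q.Φ (t, y')) :=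
  (slice_cont h Q hg x t ρ).integrable_of_hasCompactSupport (slice_cs Q (ker_dil_cs h x hρ g) t)

theorem slice_bound {c : Euc (m + 1)} {r : ℝ} (hc : ‖c‖ + r < 1) {Θ : Euc (m + 1) → Euc (m + 1) → ℝ}
    (h : IsKer c r Θ) {C : ℝ≥0∞} (hb : ∀ x ∈ ball (0 : Euc (m + 1)) 1, ∀ z, ‖Θ x z‖ₑ ≤ C) (Q : Coord m e)
    (g : Euc (m + 1) → ℝ) (s t : ℝ) (x' : Fin m → ℝ) (hx : Q.Φ (s, x') ∈ ball (0 : Euc (m + 1)) 1)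
    {ρ : ℝ} (hρ : ρ ∈ Set.Ioc (0:ℝ) 1) :
    ‖∫ y', Θ (Q.Φ (s, x')) (Q.Φ (s, x') + ρ⁻¹ • (Q.Φ (t, y') - Q.Φ (s, x'))) * g (Q.Φ (t, y'))‖ₑ ≤
      ∫⁻ y, (if max |t - s| ‖x' - y‖ ≤ 2 * ρ then 1 else 0) * (C * bE g (Q.Φ (t, y))) := by
  refine (enorm_integral_le_lintegral_enorm _).trans (lintegral_mono fun y => ?_)
  rw [enorm_mul]
  by_cases hz : Q.Φ (s, x') + ρ⁻¹ • (Q.Φ (t, y) - Q.Φ (s, x')) ∈ closedBall c r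
  swap
  · rw [h.supp _ _ hz]; simp
  obtain ⟨hy, hd⟩ := ker_supp_geo hc hx hρ hz
  obtain ⟨d1, d2⟩ := coord_dist Q s t x' y
  rw [if_pos (max_le (d1.trans hd) (d2.trans hd)), one_mul, bE_mem hy]
  gcongr
  exact hb _ hx _

theorem slice_parts {c : Euc (m + 1)} {r : ℝ} {Θ : Euc (m + 1) → Euc (m + 1) → ℝ}
    (h : IsKer c r Θ) (Q : Coord m e) {v : Euc (m + 1)} (hv : ⟪e, v⟫ = 0) (φ : Sm (m + 1)) (x : Euc (m + 1))
    (t : ℝ) {ρ : ℝ} (hρ : 0 < ρ) :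
    ∫ y', Θ x (x + ρ⁻¹ • (Q.Φ (t, y') - x)) * (pdv v φ).1 (Q.Φ (t, y')) =
      -(ρ⁻¹ * ∫ y', fderiv ℝ (Θ x) (x + ρ⁻¹ • (Q.Φ (t, y') - x)) v * φ.1 (Q.Φ (t, y'))) := by
  set σ : Fin m → ℝ := (Q.Φ.symm v).2 with hσ
  have hσ2 : Q.Φ (0, σ) = v := by
    have : (0, σ) = Q.Φ.symm v := by
      refine Prod.ext ?_ rfl
      have := Q.inn (Q.Φ.symm v)
      rw [Q.Φ.apply_symm_apply, hv] at this
      exact this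
    rw [this, Q.Φ.apply_symm_apply]
  have hL : ∀ y', HasFDerivAt (fun y' : Fin m → ℝ => Q.Φ (t, y'))
      ((Q.Φ : (ℝ × (Fin m → ℝ)) →L[ℝ] Euc (m + 1)).comp (ContinuousLinearMap.inr ℝ ℝ (Fin m → ℝ))) y' := by
    intro y'
    exact (Q.Φ : (ℝ × (Fin m → ℝ)) →L[ℝ] Euc (m + 1)).hasFDerivAt.comp y' (hasFDerivAt_prodMk_right t y')
  have hd : ∀ y', HasFDerivAt (fun y' : Fin m → ℝ => φ.1 (Q.Φ (t, y'))) _ y' := fun y' =>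
    (sm_diff φ (Q.Φ (t, y'))).hasFDerivAt.comp y' (hL y')
  have hd2 : ∀ y', HasFDerivAt (fun y' : Fin m → ℝ => Θ x (x + ρ⁻¹ • (Q.Φ (t, y') - x))) _ y' := fun y' =>
    ((ker_cd h x).differentiable (by simp) (x + ρ⁻¹ • (Q.Φ (t, y') - x))).hasFDerivAt.comp y'
      ((((hL y').sub_const x).const_smul ρ⁻¹).const_add x)
  have e1 : ∀ y', fderiv ℝ (fun y' : Fin m → ℝ => φ.1 (Q.Φ (t, y'))) y' σ = (pdv v φ).1 (Q.Φ (t, y')) := by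
    intro y'
    rw [(hd y').fderiv, pdv_apply]
    simp [hσ2]
  have e2 : ∀ y', fderiv ℝ (fun y' : Fin m → ℝ => Θ x (x + ρ⁻¹ • (Q.Φ (t, y') - x))) y' σ =
      ρ⁻¹ * fderiv ℝ (Θ x) (x + ρ⁻¹ • (Q.Φ (t, y') - x)) v := by
    intro y'
    rw [(hd2 y').fderiv]
    simp [hσ2]
  have key := integral_mul_fderiv_eq_neg_fderiv_mul_of_integrable (μ := volume) (v := σ)
    (f := fun y' : Fin m → ℝ => Θ x (x + ρ⁻¹ • (Q.Φ (t, y') - x))) (g := fun y' => φ.1 (Q.Φ (t, y')))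
    (by
      simp only [e2, mul_assoc]
      exact (slice_int (ker_deriv h v) Q (sm_cont φ) x t hρ).const_mul _)
    (by
      simp only [e1]
      exact slice_int h Q (sm_cont (pdv v φ)) x t hρ)
    (slice_int h Q (sm_cont φ) x t hρ)
    (fun z _ => (hd2 z).differentiableAt) (fun z _ => (hd z).differentiableAt)
  simp only [e1, e2] at key
  rw [key, ← integral_const_mul]
  simp only [mul_assoc]

theorem main_dir {c : Euc (m + 1)} {r : ℝ} (hc : ‖c‖ + r < 1) {Θ : Euc (m + 1) → Euc (m + 1) → ℝ}
    (h : IsKer c r Θ) (hm1 : 1 ≤ m) (Q : Coord m e) {N : ℕ} (τ : Fin N → Euc (m + 1)) (hτ : ∀ i, ⟪e, τ i⟫ = 0) :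
    ∃ C : ℝ≥0∞, C ≠ ∞ ∧ ∀ (f : Sm (m + 1)) (H : Fin N → Sm (m + 1)), f = ∑ i, pdv (τ i) (H i) →
      ∀ s x', bE (fun x => ∫ ρ in (0:ℝ)..1, ∫ z, Θ x z * f.1 (x + ρ • (z - x))) (Q.Φ (s, x')) ≤
        ∫⁻ t, min (∫⁻ y, ENNReal.ofReal (max |t - s| ‖x' - y‖) ^ (-(m:ℝ)) * (C * bE f.1 (Q.Φ (t, y))))
          (∫⁻ y, ENNReal.ofReal (max |t - s| ‖x' - y‖) ^ (-((m:ℝ) + 1)) *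
            (C * ∑ i, bE (H i).1 (Q.Φ (t, y)))) := by
  obtain ⟨C0, hC0, hb0⟩ := ker_enorm h
  choose C1 hC1 hb1 using fun i => ker_enorm (ker_deriv h (τ i))
  have hm0 : (0:ℝ) < m := by exact_mod_cast hm1
  obtain ⟨D1, hD1, hs1⟩ := sl1 (m := m) (N := (m:ℝ) + 1) (by linarith)
  obtain ⟨D2, hD2, hs2⟩ := sl1 (m := m) (N := (m:ℝ) + 2) (by linarith)
  set E : ℝ≥0∞ := ∑ i, C1 i with hE
  have hEt : E ≠ ∞ := ENNReal.sum_ne_top.2 fun b _ => hC1 b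
  refine ⟨D1 * C0 + D2 * E, ENNReal.add_ne_top.2 ⟨ENNReal.mul_ne_top hD1 hC0, ENNReal.mul_ne_top hD2 hEt⟩,
    fun f H hfH s x' => ?_⟩
  by_cases hx : Q.Φ (s, x') ∈ ball (0 : Euc (m + 1)) 1
  swap
  · rw [bE_notMem hx]; exact zero_le
  rw [bE_mem hx]
  set x := Q.Φ (s, x') with hxdef
  refine (J_rep Q h (sm_cont f) x).trans ?_
  have hmeas : Measurable (Function.uncurry fun (ρ t : ℝ) => ENNReal.ofReal ρ ^ (-((m:ℝ) + 1)) *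
        ‖∫ y', Θ x (x + ρ⁻¹ • (Q.Φ (t, y') - x)) * f.1 (Q.Φ (t, y'))‖ₑ) := by
    have a1 : Measurable fun w : (ℝ × ℝ) × (Fin m → ℝ) =>
        Θ x (x + w.1.1⁻¹ • (Q.Φ (w.1.2, w.2) - x)) * f.1 (Q.Φ (w.1.2, w.2)) := by
      refine Measurable.mul ?_ ?_
      · refine (ker_cd h x).continuous.measurable.comp ?_
        have : Measurable fun w : (ℝ × ℝ) × (Fin m → ℝ) => Q.Φ (w.1.2, w.2) :=
          Continuous.measurable (by fun_prop)
        fun_prop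
      · exact Continuous.measurable ((sm_cont f).comp (by fun_prop))
    have a2 := a1.stronglyMeasurable.integral_prod_right' (ν := (volume : Measure (Fin m → ℝ)))
    exact ((measurable_fst.ennreal_ofReal).pow_const _).mul a2.measurable.enorm
  rw [lintegral_lintegral_swap hmeas.aemeasurable]
  refine lintegral_mono fun t => le_min ?_ ?_
  · have := hs1 (fun y => C0 * bE f.1 (Q.Φ (t, y)))
      (((bE_meas (sm_cont f)).comp (f := fun y => Q.Φ (t, y)) (Continuous.measurable (by fun_prop))).const_mul C0)
      x' |t - s| (abs_nonneg _)
    refine le_trans (setLIntegral_mono' measurableSet_Ioc fun ρ hρ => ?_) (this.trans ?_)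
    · have hne : ENNReal.ofReal ρ ^ (-((m:ℝ) + 1)) ≠ ∞ :=
        ENNReal.rpow_ne_top_of_ne_zero (by simpa using hρ.1) (by simp)
      refine (mul_le_mul_right (slice_bound hc h hb0 Q f.1 s t x' hx hρ) _).trans ?_
      rw [← lintegral_const_mul' _ _ hne]
      refine lintegral_mono fun y => ?_
      split_ifs <;> simp
    · rw [← lintegral_const_mul' _ _ hD1]
      refine lintegral_mono fun y => ?_
      simp only
      rw [show (1 - ((m:ℝ) + 1)) = -(m:ℝ) by ring, mul_left_comm, ← mul_assoc D1]
      gcongr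
      exact le_self_add
  · have hHm : ∀ i, Measurable fun y => bE (H i).1 (Q.Φ (t, y)) := fun i =>
      (bE_meas (sm_cont (H i))).comp (f := fun y => Q.Φ (t, y)) (Continuous.measurable (by fun_prop))
    have := hs2 (fun y => E * ∑ i, bE (H i).1 (Q.Φ (t, y)))
      ((Finset.measurable_sum _ fun i _ => hHm i).const_mul E)
      x' |t - s| (abs_nonneg _)
    refine le_trans (setLIntegral_mono' measurableSet_Ioc fun ρ hρ => ?_) (this.trans ?_)
    · have hρ0 := hρ.1
      have hne : ENNReal.ofReal ρ ^ (-((m:ℝ) + 2)) ≠ ∞ :=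
        ENNReal.rpow_ne_top_of_ne_zero (by simpa using hρ.1) (by simp)
      have k1 : ∫ y', Θ x (x + ρ⁻¹ • (Q.Φ (t, y') - x)) * f.1 (Q.Φ (t, y')) =
          ∑ i, -(ρ⁻¹ * ∫ y', fderiv ℝ (Θ x) (x + ρ⁻¹ • (Q.Φ (t, y') - x)) (τ i) * (H i).1 (Q.Φ (t, y'))) := by
        rw [hfH]
        simp only [sm_sum_apply, Finset.mul_sum]
        rw [integral_finsetSum _ fun i _ => slice_int h Q (sm_cont (pdv (τ i) (H i))) x t hρ0]
        exact Finset.sum_congr rfl fun i _ => slice_parts h Q (hτ i) (H i) x t hρ0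
      have k2 : ‖∫ y', Θ x (x + ρ⁻¹ • (Q.Φ (t, y') - x)) * f.1 (Q.Φ (t, y'))‖ₑ ≤
          ENNReal.ofReal ρ ^ (-1:ℝ) * ∫⁻ y, (if max |t - s| ‖x' - y‖ ≤ 2 * ρ then 1 else 0) *
            (E * ∑ i, bE (H i).1 (Q.Φ (t, y))) := by
        rw [k1]
        refine (enorm_sum_le _ _).trans ?_
        have k3 : ∀ i, ‖-(ρ⁻¹ * ∫ y', fderiv ℝ (Θ x) (x + ρ⁻¹ • (Q.Φ (t, y') - x)) (τ i) * (H i).1 (Q.Φ (t, y')))‖ₑ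
            ≤ ENNReal.ofReal ρ ^ (-1:ℝ) * ∫⁻ y, (if max |t - s| ‖x' - y‖ ≤ 2 * ρ then 1 else 0) *
            (C1 i * bE (H i).1 (Q.Φ (t, y))) := by
          intro i
          rw [enorm_neg, enorm_mul]
          have : ‖ρ⁻¹‖ₑ = ENNReal.ofReal ρ ^ (-1:ℝ) := by
            rw [Real.enorm_of_nonneg (by positivity), ENNReal.ofReal_inv_of_pos hρ0, ENNReal.rpow_neg_one]
          rw [this]
          exact mul_le_mul_right (slice_bound hc (ker_deriv h (τ i)) (hb1 i) Q (H i).1 s t x' hx hρ) _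
        refine (Finset.sum_le_sum fun i _ => k3 i).trans ?_
        rw [← Finset.mul_sum]
        refine mul_le_mul_right ?_ _
        rw [← lintegral_finsetSum]
        · refine lintegral_mono fun y => ?_
          rw [← Finset.mul_sum]
          refine mul_le_mul_right ?_ _
          rw [Finset.mul_sum]
          refine Finset.sum_le_sum fun i _ => mul_le_mul_left ?_ _
          exact Finset.single_le_sum (f := C1) (fun _ _ => zero_le) (Finset.mem_univ i)
        · intro i _
          refine Measurable.mul ?_ ((hHm i).const_mul _)
          exact Measurable.ite (isClosed_le (by fun_prop) (by fun_prop)).measurableSet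
            measurable_const measurable_const
      refine (mul_le_mul_right k2 _).trans ?_
      rw [← mul_assoc, ← ENNReal.rpow_add _ _ (by simpa using hρ0) ENNReal.ofReal_ne_top,
        show (-((m:ℝ) + 1) + -1) = -((m:ℝ) + 2) by ring, ← lintegral_const_mul' _ _ hne]
      refine lintegral_mono fun y => ?_
      split_ifs <;> simp
    · rw [← lintegral_const_mul' _ _ hD2]
      refine lintegral_mono fun y => ?_
      simp only
      rw [show (1 - ((m:ℝ) + 2)) = -((m:ℝ) + 1) by ring, mul_left_comm, ← mul_assoc D2]
      gcongr
      exact le_add_self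

end

noncomputable section
open MeasureTheory Metric MvPolynomial
open scoped ENNReal RealInnerProductSpace

theorem hom_eval {n k : ℕ} {p : MvPolynomial (Fin n) ℝ} (hp : p.IsHomogeneous k) (t : ℝ) (ξ : Fin n → ℝ) :
    eval (fun i => t * ξ i) p = t ^ k * eval ξ p := by
  rw [eval_eq', eval_eq', Finset.mul_sum]
  refine Finset.sum_congr rfl fun s hs => ?_
  have h1 : ∑ i, s i = k := by
    have := hp (mem_support_iff.1 hs)
    have h2 : s.degree = k := by rw [Finsupp.degree_eq_weight_one (R := ℕ)]; exact this
    rw [← h2, Finsupp.degree_eq_sum]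
  simp only [mul_pow, Finset.prod_mul_distrib, Finset.prod_pow_eq_pow_sum, h1]
  ring

theorem monomial_prod {n : ℕ} {N : ℕ} : ∀ (s : Fin n →₀ ℕ),
    s.degree = N → ∃ β : Fin N → Fin n, monomial s (1:ℝ) = ∏ i, X (β i) := by
  induction N with
  | zero =>
    intro s hs
    have : s = 0 := (Finsupp.degree_eq_zero_iff s).1 hs
    subst this
    exact ⟨Fin.elim0, by simp⟩
  | succ N ih =>
    intro s hs
    have : ∃ i, s i ≠ 0 := by
      by_contra! h
      have : s = 0 := by ext i; simp [h i]
      subst this; simp at hs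
    obtain ⟨i, hi⟩ := this
    have hs' : s = Finsupp.single i 1 + (s - Finsupp.single i 1) := by
      ext j
      by_cases hj : i = j
      · subst hj; simp; omega
      · simp [hj]
    have hm : monomial s (1:ℝ) = X i * monomial (s - Finsupp.single i 1) (1:ℝ) := by
      conv_lhs => rw [hs']
      rw [X, monomial_mul]; simp
    have hdeg : (s - Finsupp.single i 1).degree = N := by
      have := congrArg Finsupp.degree hs'
      simp only [map_add, Finsupp.degree_single] at this
      omega
    obtain ⟨β, hβ⟩ := ih _ hdeg
    refine ⟨Fin.cons i β, ?_⟩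
    rw [hm, hβ, Fin.prod_univ_succ]
    simp

variable {m : ℕ} {e : Euc (m + 1)}

theorem bE_sum {ι : Type*} (s : Finset ι) (f : ι → Sm (m + 1)) (x : Euc (m + 1)) :
    bE (∑ i ∈ s, f i).1 x ≤ ∑ i ∈ s, bE (f i).1 x := by
  by_cases hx : x ∈ ball (0 : Euc (m + 1)) 1
  · simp only [bE_mem hx, sm_sum_apply]
    exact enorm_sum_le _ _
  · rw [bE_notMem hx]; exact zero_le

theorem bE_smul (c : ℝ) (f : Sm (m + 1)) (x : Euc (m + 1)) :
    bE (c • f).1 x = ‖c‖ₑ * bE f.1 x := by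
  by_cases hx : x ∈ ball (0 : Euc (m + 1)) 1
  · simp only [bE_mem hx]
    exact enorm_mul c (f.1 x)
  · simp [bE_notMem hx]

theorem bE_slice_meas (Q : Coord m e) (f : Sm (m + 1)) (s : ℝ) : Measurable fun y => bE f.1 (Q.Φ (s, y)) :=
  (bE_meas (sm_cont f)).comp (f := fun y => Q.Φ (s, y)) (Continuous.measurable (by fun_prop))

theorem trace_hom {k d q : ℕ} (P : Matrix (Fin q) (Fin d) (MvPolynomial (Fin (m + 1)) ℝ))
    (hP : ∀ b a, (P b a).IsHomogeneous (k + 1)) (hell : EllP P) (he : ‖e‖ = 1) (Q : Coord m e)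
    (S : MvPolynomial (Fin (m + 1)) ℝ) (hS : S.IsHomogeneous k) (a : Fin d) :
    ∃ C : ℝ≥0∞, C ≠ ∞ ∧ ∀ s : ℝ, ∀ u : Fin d → Sm (m + 1),
      ∫⁻ x', bE (dOp S (u a)).1 (Q.Φ (s, x')) ≤ C * Tn P u := by
  have hmon : ∀ σ : S.support, ∃ C : ℝ≥0∞, C ≠ ∞ ∧ ∀ s : ℝ, ∀ u : Fin d → Sm (m + 1),
      ∫⁻ x', bE (dOp (monomial σ.1 (1:ℝ)) (u a)).1 (Q.Φ (s, x')) ≤ C * Tn P u := by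
    intro σ
    obtain ⟨β, hβ⟩ := monomial_prod (N := k) σ.1 (by
      have := hS (mem_support_iff.1 σ.2)
      rw [Finsupp.degree_eq_weight_one (R := ℕ)]; exact this)
    rw [hβ]
    exact trace P hP hell he Q β a
  choose Cm hC hb using hmon
  refine ⟨∑ σ : S.support, ‖coeff σ.1 S‖ₑ * Cm σ, ENNReal.sum_ne_top.2 fun σ _ =>
    ENNReal.mul_ne_top enorm_ne_top (hC σ), fun s u => ?_⟩
  have hSs : dOp S (u a) = ∑ σ : S.support, coeff σ.1 S • dOp (monomial σ.1 (1:ℝ)) (u a) := by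
    conv_lhs => rw [S.as_sum]
    rw [dOp_sum, ← Finset.sum_coe_sort]
    refine Finset.sum_congr rfl fun σ _ => ?_
    have : monomial σ.1 (coeff σ.1 S) = C (coeff σ.1 S) * monomial σ.1 (1:ℝ) := by
      rw [C_mul_monomial, mul_one]
    rw [this, dOp_mul, dOp_C]
  rw [hSs, Finset.sum_mul]
  refine (lintegral_mono fun x' => bE_sum _ _ _).trans ?_
  simp only [bE_smul]
  rw [lintegral_finsetSum _ fun σ _ => (bE_slice_meas Q _ s).const_mul _]
  refine Finset.sum_le_sum fun σ _ => ?_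
  rw [lintegral_const_mul' _ _ enorm_ne_top, mul_assoc]
  exact mul_le_mul_right (hb σ s u) _

/-- the singular operator -/
def Jop (Θ : Euc (m + 1) → Euc (m + 1) → ℝ) (f : Euc (m + 1) → ℝ) (x : Euc (m + 1)) : ℝ :=
  ∫ ρ in (0:ℝ)..1, ∫ z, Θ x z * f (x + ρ • (z - x))

theorem jop_add {c : Euc (m + 1)} {r : ℝ} {Θ : Euc (m + 1) → Euc (m + 1) → ℝ} (h : IsKer c r Θ)
    (f g : Sm (m + 1)) (x : Euc (m + 1)) : Jop Θ (f + g).1 x = Jop Θ f.1 x + Jop Θ g.1 x := by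
  have hIntg : ∀ f : Sm (m + 1), IntervalIntegrable (fun ρ => ∫ z, Θ x z * f.1 (x + ρ • (z - x))) volume 0 1 :=
    fun f => (ker_param_cont h x (g := fun ρ z => f.1 (x + ρ • (z - x)))
      ((sm_cont f).comp (by fun_prop))).intervalIntegrable _ _
  unfold Jop
  rw [← intervalIntegral.integral_add (hIntg f) (hIntg g)]
  congr 1; ext ρ
  refine Eq.trans ?_ (integral_add (ker_int h x ((sm_cont f).comp (seg_cont x ρ)))
    (ker_int h x ((sm_cont g).comp (seg_cont x ρ))))
  congr 1; ext z
  change Θ x z * (f.1 _ + g.1 _) = _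
  exact mul_add _ _ _

theorem jop_smul (Θ : Euc (m + 1) → Euc (m + 1) → ℝ)
    (c : ℝ) (f : Sm (m + 1)) (x : Euc (m + 1)) : Jop Θ (c • f).1 x = c * Jop Θ f.1 x := by
  unfold Jop
  rw [← intervalIntegral.integral_const_mul]
  congr 1; ext ρ
  rw [← integral_const_mul]
  congr 1; ext z
  change Θ x z * (c * f.1 _) = _
  ring

/-- the exponent -/
def pp (m : ℕ) : ℝ := ((m : ℝ) + 1) / m

theorem pp_gt {m : ℕ} (hm1 : 1 ≤ m) : 1 < pp m := by
  have hm0 : (0:ℝ) < m := by exact_mod_cast hm1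
  rw [pp, lt_div_iff₀ hm0]; linarith

/-- Lp norm on the unit ball -/
def lpn (f : Euc (m + 1) → ℝ) : ℝ≥0∞ := (∫⁻ x in ball (0 : Euc (m + 1)) 1, ‖f x‖ₑ ^ pp m) ^ (1 / pp m)

theorem lpn_add_le (hm1 : 1 ≤ m) {f g h : Euc (m + 1) → ℝ} (hf : Measurable f) (hg : Measurable g)
    (hh : ∀ x ∈ ball (0 : Euc (m + 1)) 1, ‖h x‖ₑ ≤ ‖f x‖ₑ + ‖g x‖ₑ) : lpn h ≤ lpn f + lpn g := by
  have hp := pp_gt hm1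
  refine le_trans (ENNReal.rpow_le_rpow ?_ (by positivity)) (ENNReal.lintegral_Lp_add_le
    (f := fun x => ‖f x‖ₑ) (g := fun x => ‖g x‖ₑ) hf.enorm.aemeasurable hg.enorm.aemeasurable hp.le)
  exact setLIntegral_mono' measurableSet_ball fun x hx => ENNReal.rpow_le_rpow (hh x hx) (by linarith)

theorem lpn_smul (hm1 : 1 ≤ m) (c : ℝ) (f : Euc (m + 1) → ℝ) : lpn (fun x => c * f x) = ‖c‖ₑ * lpn f := by
  have hp := pp_gt hm1
  have hp0 : 0 < pp m := by linarith
  unfold lpn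
  simp only [enorm_mul, ENNReal.mul_rpow_of_nonneg _ _ hp0.le]
  rw [lintegral_const_mul' _ _ (ENNReal.rpow_ne_top_of_nonneg hp0.le enorm_ne_top),
    ENNReal.mul_rpow_of_nonneg _ _ (by positivity), ← ENNReal.rpow_mul, mul_one_div_cancel hp0.ne', ENNReal.rpow_one]

theorem jop_bE_meas {c : Euc (m + 1)} {r : ℝ} {Θ : Euc (m + 1) → Euc (m + 1) → ℝ} (h : IsKer c r Θ)
    (f : Sm (m + 1)) : Measurable (Jop Θ f.1) := ker_meas h (sm_cont f)

/-- combination of the components -/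
def fw {d q : ℕ} (P : Matrix (Fin q) (Fin d) (MvPolynomial (Fin (m + 1)) ℝ)) (w : Fin q → ℝ)
    (u : Fin d → Sm (m + 1)) : Sm (m + 1) := ∑ b, w b • fOp P u b

/-- good combination -/
def GoodW {d q : ℕ} (P : Matrix (Fin q) (Fin d) (MvPolynomial (Fin (m + 1)) ℝ)) (w : Fin q → ℝ) : Prop :=
  ∀ Θ, IsKer (0 : Euc (m + 1)) (1 / 2) Θ → ∃ C : ℝ≥0∞, C ≠ ∞ ∧ ∀ u, lpn (Jop Θ (fw P w u).1) ≤ C * Tn P u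

theorem good_gen {k d q : ℕ} (hm1 : 1 ≤ m) (P : Matrix (Fin q) (Fin d) (MvPolynomial (Fin (m + 1)) ℝ))
    (hP : ∀ b a, (P b a).IsHomogeneous (k + 1)) (hell : EllP P) (w : Fin q → ℝ)
    (ξ : Fin (m + 1) → ℝ) (hξ : ξ ≠ 0) (hw : ∀ a, ∑ b, w b * eval ξ (P b a) = 0) : GoodW P w := by
  intro Θ hΘ
  set ξ' : Euc (m + 1) := WithLp.toLp 2 ξ with hξ'
  have hξ0 : ξ' ≠ 0 := by
    intro h0; apply hξ; ext i
    have := congrArg (fun v : Euc (m + 1) => v i) h0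
    simpa using this
  set e : Euc (m + 1) := ‖ξ'‖⁻¹ • ξ' with hedef
  have he : ‖e‖ = 1 := by
    rw [hedef, norm_smul, norm_inv, norm_norm, inv_mul_cancel₀ (norm_ne_zero_iff.2 hξ0)]
  obtain ⟨Q⟩ := exists_coord e he
  set pa : Fin d → MvPolynomial (Fin (m + 1)) ℝ := fun a => ∑ b, C (w b) * P b a with hpa
  have hpah : ∀ a, (pa a).IsHomogeneous (k + 1) := fun a => by
    refine IsHomogeneous.sum _ _ _ fun b _ => ?_
    have := (isHomogeneous_C (Fin (m + 1)) (w b)).mul (hP b a)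
    rwa [zero_add] at this
  have hpae : ∀ a, eval (fun i => e i) (pa a) = 0 := fun a => by
    have : (fun i => e i) = fun i => ‖ξ'‖⁻¹ * ξ i := by ext i; simp [hedef, hξ']
    rw [this, hom_eval (hpah a)]
    have h2 : eval ξ (pa a) = 0 := by simp [hpa, hw a]
    rw [h2, mul_zero]
  choose S hSh hSe using fun a => alg_tangent (fun i => e i) (pa a) (hpah a) (hpae a)
  set τ : Fin (m + 1) → Euc (m + 1) := fun i => ev i - e i • e with hτdef
  have hτ : ∀ i, ⟪e, τ i⟫ = 0 := fun i => by
    simp only [hτdef, inner_sub_right, inner_smul_right, real_inner_self_eq_norm_sq, he, ev]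
    simp [EuclideanSpace.inner_single_right]
  have hτd : ∀ i, dOp (X i - C (e i) * ∑ j, C (e j) * X j) = pdv (τ i) := fun i => by
    rw [map_sub, map_mul, dOp_lin, dOp_X, hτdef]
    simp only [sub_eq_add_neg, pdv_add]
    congr 1
    ext1 φ
    rw [← neg_smul, pdv_smul (-(e i)) e, LinearMap.neg_apply, Module.End.mul_apply, dOp_C, LinearMap.smul_apply,
      neg_smul]
  set H : (Fin d → Sm (m + 1)) → Fin (m + 1) → Sm (m + 1) := fun u i => ∑ a, dOp (S a i) (u a) with hH
  have hfH : ∀ u, fw P w u = ∑ i, pdv (τ i) (H u i) := by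
    intro u
    have h1 : fw P w u = ∑ a, dOp (pa a) (u a) := by
      simp only [fw, fOp, hpa, dOp_sum, dOp_mul, dOp_C, Finset.smul_sum]
      exact Finset.sum_comm
    rw [h1]
    simp only [hH, map_sum]
    rw [Finset.sum_comm]
    refine Finset.sum_congr rfl fun a _ => ?_
    conv_lhs => rw [hSe a]
    rw [dOp_sum]
    refine Finset.sum_congr rfl fun i _ => ?_
    rw [dOp_mul, hτd]
  obtain ⟨C0, hC0, hdir⟩ := main_dir (c := 0) (r := 1 / 2) (by norm_num) hΘ hm1 Q τ hτ
  choose Ct hCt hbt using fun i a => trace_hom P hP hell he Q (S a i) (hSh a i) a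
  obtain ⟨D, hD, hfin⟩ := final_abs hm1
  set Wc : ℝ≥0∞ := ∑ b, ‖w b‖ₑ with hWc
  have hWct : Wc ≠ ∞ := ENNReal.sum_ne_top.2 fun b _ => enorm_ne_top
  set Kt : ℝ≥0∞ := ∑ i, ∑ a, Ct i a with hKt
  have hKtt : Kt ≠ ∞ := ENNReal.sum_ne_top.2 fun i _ => ENNReal.sum_ne_top.2 fun a _ => hCt i a
  set K : ℝ≥0∞ := C0 * Wc + C0 * Kt + 1 with hK
  have hKtop : K ≠ ∞ := by
    simp only [hK, ne_eq, ENNReal.add_eq_top, not_or]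
    exact ⟨⟨ENNReal.mul_ne_top hC0 hWct, ENNReal.mul_ne_top hC0 hKtt⟩, ENNReal.one_ne_top⟩
  have hK1 : 1 ≤ K := le_add_self
  have hp := pp_gt hm1
  have hp0 : 0 < pp m := by linarith
  have hD1 : (D + 1) ^ (1 / pp m) ≠ ∞ :=
    ENNReal.rpow_ne_top_of_nonneg (by positivity) (ENNReal.add_ne_top.2 ⟨hD, ENNReal.one_ne_top⟩)
  have hD10 : (D + 1) ^ (1 / pp m) ≠ 0 := by
    have : 1 ≤ (D + 1) ^ (1 / pp m) := ENNReal.one_le_rpow le_add_self (by positivity)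
    exact (lt_of_lt_of_le one_pos this).ne'
  refine ⟨(D + 1) ^ (1 / pp m) * K, ENNReal.mul_ne_top hD1 hKtop, fun u => ?_⟩
  by_cases htop : Tn P u = ∞
  · rw [htop, ENNReal.mul_top]
    · exact le_top
    · exact mul_ne_zero hD10 (lt_of_lt_of_le one_pos hK1).ne'
  have hA1 : ∫⁻ t, ∫⁻ y, C0 * bE (fw P w u).1 (Q.Φ (t, y)) ≤ K * Tn P u := by
    simp only [lintegral_const_mul' _ _ hC0]
    rw [bE_coord_int Q (sm_cont _), ← bE_int]
    have : ∫⁻ x, bE (fw P w u).1 x ≤ Wc * Tn P u := by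
      refine (lintegral_mono fun x => bE_sum _ _ _).trans ?_
      simp only [bE_smul]
      rw [lintegral_finsetSum _ fun σ _ => (bE_meas (sm_cont _)).const_mul _, hWc, Finset.sum_mul]
      refine Finset.sum_le_sum fun b _ => ?_
      rw [lintegral_const_mul' _ _ enorm_ne_top, bE_int]
      exact mul_le_mul_right (Tn_f P u b) _
    refine (mul_le_mul_right this _).trans ?_
    rw [← mul_assoc]
    refine mul_le_mul_left ?_ _
    rw [hK, add_assoc]
    exact le_self_add
  have hB1 : ∀ t, ∫⁻ y, C0 * ∑ i, bE (H u i).1 (Q.Φ (t, y)) ≤ K * Tn P u := by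
    intro t
    rw [lintegral_const_mul' _ _ hC0]
    have : ∫⁻ y, ∑ i, bE (H u i).1 (Q.Φ (t, y)) ≤ Kt * Tn P u := by
      rw [lintegral_finsetSum _ fun σ _ => bE_slice_meas Q _ t, hKt, Finset.sum_mul]
      refine Finset.sum_le_sum fun i _ => ?_
      refine (lintegral_mono fun y => bE_sum _ _ _).trans ?_
      rw [lintegral_finsetSum _ fun σ _ => bE_slice_meas Q _ t, Finset.sum_mul]
      exact Finset.sum_le_sum fun a _ => hbt i a t u
    refine (mul_le_mul_right this _).trans ?_
    rw [← mul_assoc]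
    refine mul_le_mul_left ?_ _
    rw [hK, add_assoc]
    exact le_add_left le_self_add
  have hN : ∃ N : ℝ≥0∞, N ≠ ∞ ∧ ∀ t, ∫⁻ y, C0 * bE (fw P w u).1 (Q.Φ (t, y)) ≤ N := by
    obtain ⟨M, hM⟩ := (isCompact_closedBall (0 : Euc (m + 1)) 1).exists_bound_of_continuousOn
      (sm_cont (fw P w u)).continuousOn
    refine ⟨C0 * ENNReal.ofReal M * ENNReal.ofReal (2 * 1) ^ m, ENNReal.mul_ne_top
      (ENNReal.mul_ne_top hC0 ENNReal.ofReal_ne_top) (ENNReal.pow_ne_top ENNReal.ofReal_ne_top), fun t => ?_⟩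
    rw [← cube_vol (0 : Fin m → ℝ) zero_le_one,
      ← lintegral_const_mul' _ _ (ENNReal.mul_ne_top hC0 ENNReal.ofReal_ne_top)]
    refine lintegral_mono fun y => ?_
    by_cases hx : Q.Φ (t, y) ∈ ball (0 : Euc (m + 1)) 1
    swap
    · rw [bE_notMem hx, mul_zero]; exact zero_le
    have hx1 : ‖y - 0‖ ≤ 1 := by
      rw [sub_zero]
      exact (Q.n2 (t, y)).trans (by simpa using (mem_ball_zero_iff.1 hx).le)
    rw [if_pos hx1, mul_one, bE_mem hx, ← ofReal_norm]
    exact mul_le_mul_right (ENNReal.ofReal_le_ofReal (hM _ (ball_subset_closedBall hx))) _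
  have hmA : Measurable (Function.uncurry fun t y => C0 * bE (fw P w u).1 (Q.Φ (t, y))) :=
    (bE_coord_meas Q (sm_cont (fw P w u))).const_mul C0
  have hmB : Measurable (Function.uncurry fun t y => C0 * ∑ i, bE (H u i).1 (Q.Φ (t, y))) :=
    (Finset.measurable_sum _ fun i _ => bE_coord_meas Q (sm_cont (H u i))).const_mul C0
  have hfinal := fun T hT0 hTt hTB => hfin _ _ hmA hmB T hT0 hTt hTB hN
    (fun s x' => bE (Jop Θ (fw P w u).1) (Q.Φ (s, x'))) (hdir (fw P w u) (H u) (hfH u))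
  have hlp : ∫⁻ x in ball (0 : Euc (m + 1)) 1, ‖Jop Θ (fw P w u).1 x‖ₑ ^ pp m =
      ∫⁻ s, ∫⁻ x', bE (Jop Θ (fw P w u).1) (Q.Φ (s, x')) ^ pp m := by
    rw [← coord_lint Q (g := fun x => bE (Jop Θ (fw P w u).1) x ^ pp m)
      ((bE_meas' (jop_bE_meas hΘ _)).pow_const _), ← lintegral_indicator measurableSet_ball]
    congr 1; ext x
    by_cases hx : x ∈ ball (0 : Euc (m + 1)) 1
    · rw [Set.indicator_of_mem hx, bE_mem hx]
    · rw [Set.indicator_of_notMem hx, bE_notMem hx, ENNReal.zero_rpow_of_pos hp0]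
  have hgoal : ∫⁻ x in ball (0 : Euc (m + 1)) 1, ‖Jop Θ (fw P w u).1 x‖ₑ ^ pp m ≤
      (D + 1) * (K * Tn P u) ^ pp m := by
    rw [hlp]
    by_cases h0 : Tn P u = 0
    · rw [h0, mul_zero] at hA1 hB1
      have := hfinal 1 one_ne_zero ENNReal.one_ne_top (fun t => (hB1 t).trans zero_le)
      rw [le_antisymm hA1 zero_le] at this
      simp only [mul_zero] at this
      exact this.trans zero_le
    · have hT0 : K * Tn P u ≠ 0 := mul_ne_zero (lt_of_lt_of_le one_pos hK1).ne' h0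
      have hTt : K * Tn P u ≠ ∞ := ENNReal.mul_ne_top hKtop htop
      refine (hfinal (K * Tn P u) hT0 hTt hB1).trans ?_
      refine mul_le_mul' le_self_add ?_
      refine mul_le_of_le_one_right' ?_
      refine (mul_le_mul_right hA1 _).trans ?_
      rw [ENNReal.inv_mul_cancel hT0 hTt]
  unfold lpn
  refine (ENNReal.rpow_le_rpow hgoal (by positivity)).trans ?_
  rw [ENNReal.mul_rpow_of_nonneg _ _ (by positivity), ← ENNReal.rpow_mul, mul_one_div_cancel hp0.ne',
    ENNReal.rpow_one, mul_assoc]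

theorem good_all {k d q : ℕ} (hm1 : 1 ≤ m) (P : Matrix (Fin q) (Fin d) (MvPolynomial (Fin (m + 1)) ℝ))
    (hP : ∀ b a, (P b a).IsHomogeneous (k + 1)) (hell : EllP P) (w : Fin q → ℝ) : GoodW P w := by
  have hspan := alg_span (n := m + 1) (by omega) (by omega) P hP hell
  have hw : w ∈ Submodule.span ℝ {w : Fin q → ℝ | ∃ ξ : Fin (m + 1) → ℝ, ξ ≠ 0 ∧
      ∀ a, ∑ b, w b * eval ξ (P b a) = 0} := by rw [hspan]; trivial
  induction hw using Submodule.span_induction with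
  | mem w hw =>
    obtain ⟨ξ, hξ, hw⟩ := hw
    exact good_gen hm1 P hP hell w ξ hξ hw
  | zero =>
    intro Θ hΘ
    refine ⟨0, ENNReal.zero_ne_top, fun u => ?_⟩
    have h0 : fw P 0 u = (0 : ℝ) • (0 : Sm (m + 1)) := by simp [fw]
    have h1 : Jop Θ (fw P 0 u).1 = fun x => (0:ℝ) * Jop Θ (0 : Sm (m + 1)).1 x := by
      ext x; rw [h0, jop_smul]
    rw [h1, lpn_smul hm1]; simp
  | add v w _ _ hv hw =>
    intro Θ hΘ
    obtain ⟨C1, hC1, hb1⟩ := hv Θ hΘ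
    obtain ⟨C2, hC2, hb2⟩ := hw Θ hΘ
    refine ⟨C1 + C2, ENNReal.add_ne_top.2 ⟨hC1, hC2⟩, fun u => ?_⟩
    have h0 : fw P (v + w) u = fw P v u + fw P w u := by simp [fw, add_smul, Finset.sum_add_distrib]
    rw [add_mul]
    refine (lpn_add_le hm1 (jop_bE_meas hΘ (fw P v u)) (jop_bE_meas hΘ (fw P w u)) fun x _ => ?_).trans
      (add_le_add (hb1 u) (hb2 u))
    rw [h0, jop_add hΘ]
    exact enorm_add_le _ _
  | smul c w _ hw =>
    intro Θ hΘ
    obtain ⟨C1, hC1, hb1⟩ := hw Θ hΘ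
    refine ⟨‖c‖ₑ * C1, ENNReal.mul_ne_top enorm_ne_top hC1, fun u => ?_⟩
    have h0 : fw P (c • w) u = c • fw P w u := by simp [fw, mul_smul, Finset.smul_sum]
    have h1 : Jop Θ (fw P (c • w) u).1 = fun x => c * Jop Θ (fw P w u).1 x := by
      ext x; rw [h0, jop_smul]
    rw [h1, lpn_smul hm1, mul_assoc]
    exact mul_le_mul_right (hb1 u) _

/-- main estimate in coordinates for globally smooth functions -/
theorem main_coord {k d q : ℕ} (hm1 : 1 ≤ m) (P : Matrix (Fin q) (Fin d) (MvPolynomial (Fin (m + 1)) ℝ))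
    (hP : ∀ b a, (P b a).IsHomogeneous (k + 1)) (hell : EllP P) (β : Fin k → Fin (m + 1)) (a : Fin d) :
    ∃ C : ℝ≥0∞, C ≠ ∞ ∧ ∀ u, lpn (dOp (∏ i, X (β i)) (u a)).1 ≤ C * Tn P u := by
  obtain ⟨Θ0, Θ1, h0, h1, hrep⟩ := rep P hP hell (0 : Euc (m + 1)) (r := 1 / 2) (by norm_num) β a
  obtain ⟨C0, hC0, hb0⟩ := ker0 (c := (0 : Euc (m + 1))) (r := 1 / 2) (by norm_num) h0
  have hp := pp_gt hm1
  have hp0 : 0 < pp m := by linarith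
  have hJ : ∀ b, ∃ C : ℝ≥0∞, C ≠ ∞ ∧ ∀ u, lpn (Jop (Θ1 b) (fOp P u b).1) ≤ C * Tn P u := by
    intro b
    obtain ⟨C, hC, hb⟩ := good_all hm1 P hP hell (Pi.single b 1) (Θ1 b) (h1 b)
    refine ⟨C, hC, fun u => ?_⟩
    have : fw P (Pi.single b 1) u = fOp P u b := by
      rw [fw, Finset.sum_eq_single b]
      · simp
      · intro b' _ hb'; simp [hb']
      · simp
    rw [← this]; exact hb u
  choose C1 hC1 hb1 using hJ
  have hsum : ∀ (s : Finset (Fin q)), ∃ C : ℝ≥0∞, C ≠ ∞ ∧ ∀ u,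
      lpn (fun x => (∫ z, Θ0 x z * (u a).1 z) + ∑ b ∈ s, Jop (Θ1 b) (fOp P u b).1 x) ≤ C * Tn P u := by
    intro s
    induction s using Finset.induction_on with
    | empty =>
      refine ⟨C0 * volume (ball (0 : Euc (m + 1)) 1) ^ (1 / pp m), ENNReal.mul_ne_top hC0
        (ENNReal.rpow_ne_top_of_nonneg (by positivity) measure_ball_lt_top.ne), fun u => ?_⟩
      have : lpn (fun x => (∫ z, Θ0 x z * (u a).1 z) + ∑ b ∈ (∅ : Finset (Fin q)), Jop (Θ1 b) (fOp P u b).1 x) ≤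
          (∫⁻ x in ball (0 : Euc (m + 1)) 1, (C0 * Tn P u) ^ pp m) ^ (1 / pp m) := by
        refine ENNReal.rpow_le_rpow (setLIntegral_mono' measurableSet_ball fun x hx =>
          ENNReal.rpow_le_rpow ?_ hp0.le) (by positivity)
        simp only [Finset.sum_empty, add_zero]
        exact (hb0 x hx _).trans (mul_le_mul_right (Tn_u P u a) _)
      refine this.trans (le_of_eq ?_)
      rw [setLIntegral_const, ENNReal.mul_rpow_of_nonneg _ _ (by positivity), ← ENNReal.rpow_mul,
        mul_one_div_cancel hp0.ne', ENNReal.rpow_one]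
      ring
    | insert b s hbs ih =>
      obtain ⟨C, hC, hb⟩ := ih
      refine ⟨C + C1 b, ENNReal.add_ne_top.2 ⟨hC, hC1 b⟩, fun u => ?_⟩
      rw [add_mul]
      refine (lpn_add_le hm1 ?_ (jop_bE_meas (h1 b) (fOp P u b)) fun x _ => ?_).trans
        (add_le_add (hb u) (hb1 b u))
      · refine Measurable.add ?_ (Finset.measurable_sum _ fun b _ => jop_bE_meas (h1 b) (fOp P u b))
        have c1 : Continuous fun w : Euc (m + 1) × Euc (m + 1) => Θ0 w.1 w.2 * (u a).1 w.2 :=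
          (ker_cont2 h0).mul ((sm_cont (u a)).comp continuous_snd)
        exact (c1.stronglyMeasurable.integral_prod_right' (ν := (volume : Measure (Euc (m + 1))))).measurable
      · rw [Finset.sum_insert hbs, add_comm (Jop _ _ _), ← add_assoc]
        exact enorm_add_le _ _
  obtain ⟨C, hC, hb⟩ := hsum Finset.univ
  refine ⟨C, hC, fun u => ?_⟩
  have : (dOp (∏ i, X (β i)) (u a)).1 =
      fun x => (∫ z, Θ0 x z * (u a).1 z) + ∑ b, Jop (Θ1 b) (fOp P u b).1 x := by
    ext x; exact hrep u x
  rw [this]; exact hb u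

end

noncomputable section
open MeasureTheory Metric MvPolynomial
open scoped ENNReal RealInnerProductSpace

theorem dOp_iter {n j : ℕ} (β : Fin j → Fin n) (φ : Sm n) (x : Euc n) :
    (dOp (∏ i, X (β i)) φ).1 x = iteratedFDeriv ℝ j φ.1 x (fun i => ev (β i)) := by
  induction j generalizing x with
  | zero => simp
  | succ j ih =>
    rw [Fin.prod_univ_succ, dOp_mul, dOp_X, pdv_apply, iteratedFDeriv_succ_apply_left]
    have h1 : (dOp (∏ i : Fin j, X (β i.succ)) φ).1 =
        fun x => iteratedFDeriv ℝ j φ.1 x (fun i => ev (β i.succ)) := by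
      ext x; exact ih (fun i => β i.succ) x
    rw [h1]
    have h2 : DifferentiableAt ℝ (iteratedFDeriv ℝ j φ.1) x :=
      ((sm_cd φ).differentiable_iteratedFDeriv (m := j) (by exact_mod_cast ENat.coe_lt_top j)) x
    have h3 := (ContinuousMultilinearMap.apply ℝ (fun _ : Fin j => Euc n) ℝ
      (fun i => ev (β i.succ))).hasFDerivAt.comp x h2.hasFDerivAt
    rw [show (fun x => iteratedFDeriv ℝ j φ.1 x (fun i => ev (β i.succ))) =
      (ContinuousMultilinearMap.apply ℝ (fun _ : Fin j => Euc n) ℝ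
      (fun i => ev (β i.succ))) ∘ iteratedFDeriv ℝ j φ.1 from rfl, h3.fderiv]
    rfl

section coords
variable {n : ℕ} {V W : Type*}
  [NormedAddCommGroup V] [InnerProductSpace ℝ V] [FiniteDimensional ℝ V]
  [NormedAddCommGroup W] [InnerProductSpace ℝ W] [FiniteDimensional ℝ W]

/-- elementary tensors -/
def elT (n k : ℕ) (β : Fin k → Fin n) (v : V) : ContinuousMultilinearMap ℝ (fun _ : Fin k => Euc n) V :=
  (ContinuousMultilinearMap.mkPiRing ℝ (Fin k) v).compContinuousLinearMap
    (fun j => (EuclideanSpace.proj (β j) : Euc n →L[ℝ] ℝ))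

theorem elT_apply (n k : ℕ) (β : Fin k → Fin n) (v : V) (x : Fin k → Euc n) :
    elT n k β v x = (∏ j, x j (β j)) • v := by
  simp [elT]

theorem ml_decomp {k d : ℕ} (b : OrthonormalBasis (Fin d) ℝ V)
    (S : ContinuousMultilinearMap ℝ (fun _ : Fin k => Euc n) V) :
    S = ∑ β : Fin k → Fin n, ∑ a, ⟪b a, S (fun i => ev (β i))⟫ • elT n k β (b a) := by
  apply ContinuousMultilinearMap.toMultilinearMap_injective
  refine Module.Basis.ext_multilinear (fun _ => (EuclideanSpace.basisFun (Fin n) ℝ).toBasis) fun γ => ?_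
  have hb : ∀ i, (EuclideanSpace.basisFun (Fin n) ℝ).toBasis i = ev i := fun i => by simp [ev]
  simp only [hb]
  change S (fun i => ev (γ i)) = (∑ β : Fin k → Fin n, ∑ a, ⟪b a, S (fun i => ev (β i))⟫ • elT n k β (b a))
    (fun i => ev (γ i))
  simp only [ContinuousMultilinearMap.sum_apply, ContinuousMultilinearMap.smul_apply, elT_apply]
  rw [Finset.sum_eq_single γ]
  · simp only [ev]
    simp only [EuclideanSpace.single_apply, if_true, Finset.prod_const_one, one_smul]
    exact (b.sum_repr' _).symm
  · intro β _ hβ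
    obtain ⟨j, hj⟩ := Function.ne_iff.1 hβ
    refine Finset.sum_eq_zero fun a _ => ?_
    rw [Finset.prod_eq_zero (Finset.mem_univ j), zero_smul, smul_zero]
    simp [ev, hj]
  · simp

/-- symbol matrix -/
def symP {k d q : ℕ} (A : OpCoeff n k V W) (b : OrthonormalBasis (Fin d) ℝ V) (c : OrthonormalBasis (Fin q) ℝ W) :
    Matrix (Fin q) (Fin d) (MvPolynomial (Fin n) ℝ) :=
  fun j a => ∑ β : Fin k → Fin n, C ⟪c j, A (elT n k β (b a))⟫ * ∏ i, X (β i)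

theorem symP_hom {k d q : ℕ} (A : OpCoeff n k V W) (b : OrthonormalBasis (Fin d) ℝ V)
    (c : OrthonormalBasis (Fin q) ℝ W) (j a) : (symP A b c j a).IsHomogeneous k := by
  refine IsHomogeneous.sum _ _ _ fun β _ => ?_
  have h1 : (∏ i, X (β i) : MvPolynomial (Fin n) ℝ).IsHomogeneous (∑ _i : Fin k, 1) :=
    IsHomogeneous.prod _ _ _ fun i _ => isHomogeneous_X ℝ (β i)
  have := (isHomogeneous_C (Fin n) ⟪c j, A (elT n k β (b a))⟫).mul h1
  simpa using this

theorem A_decomp {k d q : ℕ} (A : OpCoeff n k V W) (b : OrthonormalBasis (Fin d) ℝ V)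
    (c : OrthonormalBasis (Fin q) ℝ W) (S : ContinuousMultilinearMap ℝ (fun _ : Fin k => Euc n) V) (j) :
    ⟪c j, A S⟫ = ∑ a, ∑ β : Fin k → Fin n, ⟪c j, A (elT n k β (b a))⟫ * ⟪b a, S (fun i => ev (β i))⟫ := by
  conv_lhs => rw [ml_decomp b S]
  simp only [map_sum, map_smul, inner_sum, inner_smul_right]
  rw [Finset.sum_comm]
  refine Finset.sum_congr rfl fun a _ => Finset.sum_congr rfl fun β _ => ?_
  ring

/-- components -/
def vcmp {d : ℕ} (b : OrthonormalBasis (Fin d) ℝ V) (U : Euc n → V) (hU : ContDiff ℝ (⊤ : ℕ∞) U) (a : Fin d) : Sm n :=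
  ⟨fun x => innerSL ℝ (b a) (U x), (innerSL ℝ (b a)).contDiff.comp hU⟩

theorem vcmp_iter {j d : ℕ} (b : OrthonormalBasis (Fin d) ℝ V) (U : Euc n → V) (hU : ContDiff ℝ (⊤ : ℕ∞) U) (a : Fin d)
    (β : Fin j → Fin n) (x : Euc n) :
    (dOp (∏ i, X (β i)) (vcmp b U hU a)).1 x = ⟪b a, iteratedFDeriv ℝ j U x (fun i => ev (β i))⟫ := by
  rw [dOp_iter]
  have := (innerSL ℝ (b a)).iteratedFDeriv_comp_left (hU.contDiffAt (x := x)) (i := j)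
    (by exact_mod_cast le_top)
  change iteratedFDeriv ℝ j (innerSL ℝ (b a) ∘ U) x _ = _
  rw [this]
  rfl

theorem fOp_symP {k d q : ℕ} (A : OpCoeff n k V W) (b : OrthonormalBasis (Fin d) ℝ V)
    (c : OrthonormalBasis (Fin q) ℝ W) (U : Euc n → V) (hU : ContDiff ℝ (⊤ : ℕ∞) U) (j) (x : Euc n) :
    (fOp (symP A b c) (vcmp b U hU) j).1 x = ⟪c j, opApply A U x⟫ := by
  rw [opApply, A_decomp A b c]
  simp only [fOp, symP, dOp_sum, dOp_mul, dOp_C, sm_sum_apply]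
  refine Finset.sum_congr rfl fun a _ => Finset.sum_congr rfl fun β _ => ?_
  rw [← vcmp_iter b U hU]
  rfl

theorem cxK_ev {k : ℕ} (ζ : Fin n → ℂ) (β : Fin k → Fin n) :
    cxKernel n k (WithLp.toLp 2 fun i => (ζ i).re) (WithLp.toLp 2 fun i => (ζ i).im) (fun i => ev (β i)) =
      ∏ i, ζ (β i) := by
  simp only [cxKernel, ContinuousMultilinearMap.compContinuousLinearMap_apply]
  change ContinuousMultilinearMap.mkPiRing ℂ (Fin k) (1 : ℂ) _ = _
  rw [ContinuousMultilinearMap.mkPiRing_apply]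
  simp only [smul_eq_mul, mul_one]
  refine Finset.prod_congr rfl fun i _ => ?_
  simp [ev, EuclideanSpace.inner_single_right]
  rw [mul_comm]
  exact Complex.re_add_im _

theorem symP_ell {k d q : ℕ} (A : OpCoeff n k V W) (hA : IsCElliptic A) (b : OrthonormalBasis (Fin d) ℝ V)
    (c : OrthonormalBasis (Fin q) ℝ W) : EllP (symP A b c) := by
  intro ζ hζ v hv
  set η₁ : Euc n := WithLp.toLp 2 fun i => (ζ i).re with h1
  set η₂ : Euc n := WithLp.toLp 2 fun i => (ζ i).im with h2
  set v₁ : V := ∑ a, (v a).re • b a with hv1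
  set v₂ : V := ∑ a, (v a).im • b a with hv2
  have i1 : ∀ a, ⟪b a, v₁⟫ = (v a).re := fun a => by
    rw [hv1, inner_sum]
    simp [inner_smul_right, orthonormal_iff_ite.1 b.orthonormal]
  have i2 : ∀ a, ⟪b a, v₂⟫ = (v a).im := fun a => by
    rw [hv2, inner_sum]
    simp [inner_smul_right, orthonormal_iff_ite.1 b.orthonormal]
  have key : ∀ j, (⟪c j, A (cxSymTensorRe n k η₁ η₂ v₁ v₂)⟫ : ℂ) +
      ⟪c j, A (cxSymTensorIm n k η₁ η₂ v₁ v₂)⟫ * Complex.I = 0 := by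
    intro j
    rw [← hv j, A_decomp A b c, A_decomp A b c]
    push_cast
    rw [Finset.sum_mul, ← Finset.sum_add_distrib]
    refine Finset.sum_congr rfl fun a _ => ?_
    rw [Finset.sum_mul, ← Finset.sum_add_distrib, symP, map_sum, Finset.sum_mul]
    refine Finset.sum_congr rfl fun β _ => ?_
    simp only [map_mul, map_prod, aeval_X, aeval_C]
    have r1 : ⟪b a, cxSymTensorRe n k η₁ η₂ v₁ v₂ (fun i => ev (β i))⟫ = ((∏ i, ζ (β i)) * v a).re := by
      change ⟪b a, (cxKernel n k η₁ η₂ (fun i => ev (β i))).re • v₁ - (cxKernel n k η₁ η₂ (fun i => ev (β i))).im • v₂⟫ = _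
      rw [cxK_ev, inner_sub_right, inner_smul_right, inner_smul_right, i1, i2, Complex.mul_re]
    have r2 : ⟪b a, cxSymTensorIm n k η₁ η₂ v₁ v₂ (fun i => ev (β i))⟫ = ((∏ i, ζ (β i)) * v a).im := by
      change ⟪b a, (cxKernel n k η₁ η₂ (fun i => ev (β i))).im • v₁ + (cxKernel n k η₁ η₂ (fun i => ev (β i))).re • v₂⟫ = _
      rw [cxK_ev, inner_add_right, inner_smul_right, inner_smul_right, i1, i2, Complex.mul_im]
      ring
    rw [r1, r2]
    have := Complex.re_add_im ((∏ i, ζ (β i)) * v a)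
    rw [Complex.coe_algebraMap, mul_assoc, ← mul_add, this]
    ring
  have k1 : ∀ j, ⟪c j, A (cxSymTensorRe n k η₁ η₂ v₁ v₂)⟫ = 0 := fun j => by
    have := congrArg Complex.re (key j); simpa using this
  have k2 : ∀ j, ⟪c j, A (cxSymTensorIm n k η₁ η₂ v₁ v₂)⟫ = 0 := fun j => by
    have := congrArg Complex.im (key j); simpa using this
  have z : ∀ w : W, (∀ j, ⟪c j, w⟫ = 0) → w = 0 := fun w hw => by
    rw [← c.sum_repr' w]; simp [hw]
  have hη : (η₁, η₂) ≠ 0 := by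
    intro h0
    apply hζ
    ext i
    have e1 := congrArg (fun p : Euc n × Euc n => p.1 i) h0
    have e2 := congrArg (fun p : Euc n × Euc n => p.2 i) h0
    apply Complex.ext
    · simpa [h1] using e1
    · simpa [h2] using e2
  obtain ⟨q1, q2⟩ := hA η₁ η₂ v₁ v₂ hη (z _ k1) (z _ k2)
  ext a
  apply Complex.ext
  · rw [← i1, q1]; simp
  · rw [← i2, q2]; simp
end coords

theorem lpn_sum_le {m : ℕ} (hm1 : 1 ≤ m) {ι : Type*} (s : Finset ι) (f : ι → Euc (m + 1) → ℝ)
    (hf : ∀ i, Measurable (f i)) : lpn (fun x => ∑ i ∈ s, ‖f i x‖) ≤ ∑ i ∈ s, lpn (f i) := by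
  classical
  induction s using Finset.induction_on with
  | empty =>
    have hp := pp_gt hm1
    simp [lpn, show 0 < pp m by linarith]
  | insert i s hi ih =>
    rw [Finset.sum_insert hi]
    refine (lpn_add_le hm1 (hf i) (g := fun x => ∑ i ∈ s, ‖f i x‖)
      (Finset.measurable_sum _ fun i _ => (hf i).norm) fun x _ => ?_).trans (add_le_add le_rfl ih)
    rw [Finset.sum_insert hi]
    refine (enorm_add_le _ _).trans (le_of_eq ?_)
    rw [enorm_norm]

theorem main_smooth_aux {m k d q : ℕ} {V W : Type*}
    [NormedAddCommGroup V] [InnerProductSpace ℝ V] [FiniteDimensional ℝ V]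
    [NormedAddCommGroup W] [InnerProductSpace ℝ W] [FiniteDimensional ℝ W] (hm1 : 1 ≤ m)
    (b : OrthonormalBasis (Fin d) ℝ V) (c : OrthonormalBasis (Fin q) ℝ W)
    (A : OpCoeff (m + 1) (k + 1) V W) (hA : IsCElliptic A) :
    ∃ C : ℝ≥0∞, C ≠ ∞ ∧ ∀ U : Euc (m + 1) → V, ContDiff ℝ (⊤ : ℕ∞) U →
      lpn (fun x => ‖iteratedFDeriv ℝ k U x‖) ≤
        C * ((∫⁻ x in ball (0 : Euc (m + 1)) 1, ‖opApply A U x‖ₑ) + ∫⁻ x in ball (0 : Euc (m + 1)) 1, ‖U x‖ₑ) := by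
  choose Cm hC hb using fun β a => main_coord (k := k) hm1 (symP A b c) (symP_hom A b c) (symP_ell A hA b c) β a
  set K : ℝ≥0∞ := ∑ i : (Fin k → Fin (m + 1)) × Fin d, ‖‖elT (m + 1) k i.1 (b i.2)‖‖ₑ * Cm i.1 i.2 with hK
  refine ⟨K * (q + d : ℝ≥0∞), ENNReal.mul_ne_top (ENNReal.sum_ne_top.2 fun i _ =>
    ENNReal.mul_ne_top enorm_ne_top (hC _ _)) (by simp), fun U hU => ?_⟩
  set R : ℝ≥0∞ := (∫⁻ x in ball (0 : Euc (m + 1)) 1, ‖opApply A U x‖ₑ) + ∫⁻ x in ball (0 : Euc (m + 1)) 1, ‖U x‖ₑ with hR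
  have hp := pp_gt hm1
  have hT : Tn (symP A b c) (vcmp b U hU) ≤ (q + d : ℝ≥0∞) * R := by
    rw [Tn, add_mul]
    refine add_le_add ?_ ?_
    · have : ∀ j ∈ (Finset.univ : Finset (Fin q)), ∫⁻ x in ball (0 : Euc (m + 1)) 1,
          ‖(fOp (symP A b c) (vcmp b U hU) j).1 x‖ₑ ≤ R := by
        intro j _
        refine le_trans (lintegral_mono fun x => ?_) le_self_add
        rw [fOp_symP, ← ofReal_norm, ← ofReal_norm]
        refine ENNReal.ofReal_le_ofReal ((norm_inner_le_norm _ _).trans ?_)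
        rw [c.norm_eq_one, one_mul]
      refine (Finset.sum_le_sum this).trans ?_
      simp
    · have : ∀ j ∈ (Finset.univ : Finset (Fin d)), ∫⁻ x in ball (0 : Euc (m + 1)) 1,
          ‖(vcmp b U hU j).1 x‖ₑ ≤ R := by
        intro j _
        refine le_trans (lintegral_mono fun x => ?_) le_add_self
        rw [← ofReal_norm, ← ofReal_norm]
        refine ENNReal.ofReal_le_ofReal ((norm_inner_le_norm _ _).trans ?_)
        rw [b.norm_eq_one, one_mul]
      refine (Finset.sum_le_sum this).trans ?_
      simp
  set g : (Fin k → Fin (m + 1)) × Fin d → Euc (m + 1) → ℝ := fun i x =>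
    ‖elT (m + 1) k i.1 (b i.2)‖ * (dOp (∏ l, X (i.1 l)) (vcmp b U hU i.2)).1 x with hg
  have hgm : ∀ i, Measurable (g i) := fun i => (sm_cont _).measurable.const_mul _
  have h1 : lpn (fun x => ‖iteratedFDeriv ℝ k U x‖) ≤ lpn (fun x => ∑ i, ‖g i x‖) := by
    refine ENNReal.rpow_le_rpow (lintegral_mono fun x => ENNReal.rpow_le_rpow ?_ (by linarith)) (by positivity)
    rw [Real.enorm_of_nonneg (norm_nonneg _),
      Real.enorm_of_nonneg (Finset.sum_nonneg fun i _ => norm_nonneg _)]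
    refine ENNReal.ofReal_le_ofReal ?_
    conv_lhs => rw [ml_decomp b (iteratedFDeriv ℝ k U x)]
    rw [← Finset.univ_product_univ, Finset.sum_product]
    refine (norm_sum_le _ _).trans (Finset.sum_le_sum fun β _ => (norm_sum_le _ _).trans
      (Finset.sum_le_sum fun a _ => ?_))
    rw [norm_smul, ← vcmp_iter b U hU, hg, norm_mul, norm_norm, mul_comm]
  refine h1.trans ((lpn_sum_le hm1 _ g hgm).trans ?_)
  rw [hK, mul_assoc, Finset.sum_mul]
  refine Finset.sum_le_sum fun i _ => ?_
  rw [hg, lpn_smul hm1, mul_assoc]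
  exact mul_le_mul_right ((hb i.1 i.2 _).trans (mul_le_mul_right hT _)) _

theorem main_smooth {m k : ℕ} {V W : Type*}
    [NormedAddCommGroup V] [InnerProductSpace ℝ V] [FiniteDimensional ℝ V]
    [NormedAddCommGroup W] [InnerProductSpace ℝ W] [FiniteDimensional ℝ W] (hm1 : 1 ≤ m)
    (A : OpCoeff (m + 1) (k + 1) V W) (hA : IsCElliptic A) :
    ∃ C : ℝ≥0∞, C ≠ ∞ ∧ ∀ U : Euc (m + 1) → V, ContDiff ℝ (⊤ : ℕ∞) U →
      lpn (fun x => ‖iteratedFDeriv ℝ k U x‖) ≤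
        C * ((∫⁻ x in ball (0 : Euc (m + 1)) 1, ‖opApply A U x‖ₑ) + ∫⁻ x in ball (0 : Euc (m + 1)) 1, ‖U x‖ₑ) :=
  main_smooth_aux hm1 (stdOrthonormalBasis ℝ V) (stdOrthonormalBasis ℝ W) A hA

end

noncomputable section
open MeasureTheory Metric MvPolynomial
open scoped ENNReal RealInnerProductSpace Topology

theorem scale_ball {m : ℕ} (F : Euc (m + 1) → ℝ≥0∞) {r : ℝ} (hr : 0 < r) :
    ∫⁻ x in ball (0 : Euc (m + 1)) 1, F (r • x) =
      ENNReal.ofReal (r ^ (m + 1))⁻¹ * ∫⁻ x in ball (0 : Euc (m + 1)) r, F x := by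
  have h1 := Measure.map_addHaar_smul (volume : Measure (Euc (m + 1))) hr.ne'
  set f := (ball (0 : Euc (m + 1)) r).indicator F with hf
  have h2 : ∫⁻ x, f x ∂(Measure.map (r • ·) (volume : Measure (Euc (m + 1)))) = ∫⁻ x, f (r • x) :=
    lintegral_map_equiv f (MeasurableEquiv.smul₀ r hr.ne')
  rw [h1, lintegral_smul_measure, abs_of_pos (by positivity), hf, lintegral_indicator measurableSet_ball] at h2
  rw [← lintegral_indicator measurableSet_ball]
  simp only [finrank_euclideanSpace, Fintype.card_fin, smul_eq_mul] at h2
  rw [h2]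
  refine lintegral_congr fun x => ?_
  by_cases hx : x ∈ ball (0 : Euc (m + 1)) 1
  · have : r • x ∈ ball (0 : Euc (m + 1)) r := by
      rw [mem_ball_zero_iff] at hx ⊢
      rw [norm_smul, Real.norm_of_nonneg hr.le]; nlinarith
    rw [Set.indicator_of_mem hx, Set.indicator_of_mem this]
  · have : r • x ∉ ball (0 : Euc (m + 1)) r := by
      rw [mem_ball_zero_iff] at hx ⊢
      rw [norm_smul, Real.norm_of_nonneg hr.le]; intro h; apply hx; nlinarith
    rw [Set.indicator_of_notMem hx, Set.indicator_of_notMem this]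

theorem cutoff {n : ℕ} {V : Type*} [NormedAddCommGroup V] [NormedSpace ℝ V] (u : Euc n → V)
    (hu : ContDiffOn ℝ (⊤ : ℕ∞) u (closedBall 0 1)) {r : ℝ} (hr : 0 < r) (hr1 : r < 1) :
    ∃ U : Euc n → V, ContDiff ℝ (⊤ : ℕ∞) U ∧ Set.EqOn U u (ball 0 r) := by
  let χ : ContDiffBump (0 : Euc n) := ⟨r, (1 + r) / 2, hr, by linarith⟩
  refine ⟨fun x => χ x • u x, ?_, fun x hx => ?_⟩
  · rw [contDiff_iff_contDiffAt]
    intro x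
    by_cases hx : x ∈ ball (0 : Euc n) 1
    · exact χ.contDiff.contDiffAt.smul (hu.contDiffAt (Filter.mem_of_superset (isOpen_ball.mem_nhds hx) ball_subset_closedBall))
    · have hx' : x ∉ tsupport χ := by
        rw [χ.tsupport_eq, mem_closedBall_zero_iff]
        rw [mem_ball_zero_iff] at hx
        change ¬ (‖x‖ ≤ (1 + r) / 2)
        intro h; apply hx; linarith
      have h0 : (fun x => χ x • u x) =ᶠ[𝓝 x] fun _ => 0 := by
        have := notMem_tsupport_iff_eventuallyEq.1 hx'
        filter_upwards [this] with y hy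
        rw [hy]; simp
      exact contDiffAt_const.congr_of_eventuallyEq h0
  · change χ x • u x = u x
    rw [χ.one_of_mem_closedBall (ball_subset_closedBall hx), one_smul]

theorem main_r {m k : ℕ} {V W : Type*}
    [NormedAddCommGroup V] [InnerProductSpace ℝ V] [FiniteDimensional ℝ V]
    [NormedAddCommGroup W] [InnerProductSpace ℝ W] [FiniteDimensional ℝ W] (hm1 : 1 ≤ m)
    (A : OpCoeff (m + 1) (k + 1) V W) (hA : IsCElliptic A) :
    ∃ C : ℝ≥0∞, C ≠ ∞ ∧ ∀ u : Euc (m + 1) → V, ContDiffOn ℝ (⊤ : ℕ∞) u (closedBall 0 1) →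
      ∀ r : ℝ, 1 / 2 ≤ r → r < 1 →
      (∫⁻ x in ball (0 : Euc (m + 1)) r, ‖iteratedFDeriv ℝ k u x‖ₑ ^ pp m) ^ (1 / pp m) ≤
        C * ((∫⁻ x in ball (0 : Euc (m + 1)) 1, ‖opApply A u x‖ₑ) + ∫⁻ x in ball (0 : Euc (m + 1)) 1, ‖u x‖ₑ) := by
  obtain ⟨Cm, hC, hmain⟩ := main_smooth hm1 A hA
  have hp := pp_gt hm1
  refine ⟨‖(2:ℝ) ^ k‖ₑ * (Cm * ENNReal.ofReal (2 ^ (m + 1))), ENNReal.mul_ne_top enorm_ne_top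
    (ENNReal.mul_ne_top hC ENNReal.ofReal_ne_top), fun u hu r hr2 hr1 => ?_⟩
  have hr : 0 < r := by linarith
  obtain ⟨v, hv, huv⟩ := cutoff u hu hr hr1
  set U : Euc (m + 1) → V := fun x => v (r • x) with hU
  have hUs : ContDiff ℝ (⊤ : ℕ∞) U := hv.comp (contDiff_const_smul r)
  have hmem : ∀ x ∈ ball (0 : Euc (m + 1)) 1, r • x ∈ ball (0 : Euc (m + 1)) r := by
    intro x hx
    rw [mem_ball_zero_iff] at hx ⊢
    rw [norm_smul, Real.norm_of_nonneg hr.le]; nlinarith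
  have hd : ∀ j, ∀ x ∈ ball (0 : Euc (m + 1)) 1,
      iteratedFDeriv ℝ j U x = r ^ j • iteratedFDeriv ℝ j u (r • x) := by
    intro j x hx
    have h1 := iteratedFDeriv_comp_const_smul (i := j) (f := v) r (hv.of_le (by exact_mod_cast le_top))
    have h2 : v =ᶠ[𝓝 (r • x)] u := Filter.mem_of_superset (isOpen_ball.mem_nhds (hmem x hx)) huv
    rw [hU, h1, ← (h2.iteratedFDeriv ℝ j).self_of_nhds]
  have hrm : (r ^ (m + 1))⁻¹ ≤ 2 ^ (m + 1) := by
    rw [← inv_pow]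
    refine pow_le_pow_left₀ (by positivity) ?_ _
    rw [inv_le_comm₀ hr (by norm_num)]; linarith
  have hrm' : 1 ≤ (r ^ (m + 1))⁻¹ := (one_le_inv₀ (by positivity)).2 (pow_le_one₀ hr.le hr1.le)
  have hsub : ball (0 : Euc (m + 1)) r ⊆ ball 0 1 := ball_subset_ball hr1.le
  -- right-hand side
  have hR : (∫⁻ x in ball (0 : Euc (m + 1)) 1, ‖opApply A U x‖ₑ) + ∫⁻ x in ball (0 : Euc (m + 1)) 1, ‖U x‖ₑ ≤
      ENNReal.ofReal (2 ^ (m + 1)) * ((∫⁻ x in ball (0 : Euc (m + 1)) 1, ‖opApply A u x‖ₑ) +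
        ∫⁻ x in ball (0 : Euc (m + 1)) 1, ‖u x‖ₑ) := by
    rw [mul_add]
    refine add_le_add ?_ ?_
    · have h1 : ∫⁻ x in ball (0 : Euc (m + 1)) 1, ‖opApply A U x‖ₑ ≤
          ∫⁻ x in ball (0 : Euc (m + 1)) 1, ‖opApply A u (r • x)‖ₑ := by
        refine setLIntegral_mono' measurableSet_ball fun x hx => ?_
        rw [opApply, hd _ x hx, map_smul, enorm_smul]
        refine (mul_le_mul_left ?_ _).trans (one_mul _).le
        rw [Real.enorm_of_nonneg (by positivity)]
        exact ENNReal.ofReal_le_one.2 (pow_le_one₀ hr.le hr1.le)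
      refine h1.trans ?_
      rw [scale_ball (fun x => ‖opApply A u x‖ₑ) hr]
      exact mul_le_mul' (ENNReal.ofReal_le_ofReal hrm) (lintegral_mono_set hsub)
    · have h1 : ∫⁻ x in ball (0 : Euc (m + 1)) 1, ‖U x‖ₑ =
          ∫⁻ x in ball (0 : Euc (m + 1)) 1, ‖u (r • x)‖ₑ := by
        refine setLIntegral_congr_fun measurableSet_ball fun x hx => ?_
        change ‖v (r • x)‖ₑ = _
        rw [huv (hmem x hx)]
      rw [h1, scale_ball (fun x => ‖u x‖ₑ) hr]
      exact mul_le_mul' (ENNReal.ofReal_le_ofReal hrm) (lintegral_mono_set hsub)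
  have hL : (∫⁻ x in ball (0 : Euc (m + 1)) r, ‖iteratedFDeriv ℝ k u x‖ₑ ^ pp m) ^ (1 / pp m) ≤
      lpn (fun x => (2:ℝ) ^ k * ‖iteratedFDeriv ℝ k U x‖) := by
    refine ENNReal.rpow_le_rpow ?_ (by positivity)
    have h1 := scale_ball (fun x => ‖iteratedFDeriv ℝ k u x‖ₑ ^ pp m) hr
    have h2 : ∫⁻ x in ball (0 : Euc (m + 1)) r, ‖iteratedFDeriv ℝ k u x‖ₑ ^ pp m ≤
        ∫⁻ x in ball (0 : Euc (m + 1)) 1, ‖iteratedFDeriv ℝ k u (r • x)‖ₑ ^ pp m := by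
      rw [h1]
      refine (one_mul _).symm.le.trans (mul_le_mul_left ?_ _)
      exact ENNReal.one_le_ofReal.2 hrm'
    refine h2.trans (setLIntegral_mono' measurableSet_ball fun x hx => ENNReal.rpow_le_rpow ?_ (by linarith))
    beta_reduce
    rw [hd _ x hx, norm_smul, ← ofReal_norm, Real.enorm_of_nonneg (by positivity)]
    refine ENNReal.ofReal_le_ofReal ?_
    rw [← mul_assoc, Real.norm_of_nonneg (by positivity), ← mul_pow]
    exact le_mul_of_one_le_left (norm_nonneg _) (one_le_pow₀ (by linarith))
  rw [lpn_smul hm1] at hL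
  refine hL.trans ?_
  rw [mul_assoc, mul_assoc]
  exact mul_le_mul_right ((hmain U hUs).trans (mul_le_mul_right hR _)) _

theorem main_lint {m k : ℕ} {V W : Type*}
    [NormedAddCommGroup V] [InnerProductSpace ℝ V] [FiniteDimensional ℝ V]
    [NormedAddCommGroup W] [InnerProductSpace ℝ W] [FiniteDimensional ℝ W] (hm1 : 1 ≤ m)
    (A : OpCoeff (m + 1) (k + 1) V W) (hA : IsCElliptic A) :
    ∃ C : ℝ≥0∞, C ≠ ∞ ∧ ∀ u : Euc (m + 1) → V, ContDiffOn ℝ (⊤ : ℕ∞) u (closedBall 0 1) →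
      (∫⁻ x in ball (0 : Euc (m + 1)) 1, ‖iteratedFDeriv ℝ k u x‖ₑ ^ pp m) ^ (1 / pp m) ≤
        C * ((∫⁻ x in ball (0 : Euc (m + 1)) 1, ‖opApply A u x‖ₑ) + ∫⁻ x in ball (0 : Euc (m + 1)) 1, ‖u x‖ₑ) := by
  obtain ⟨Cm, hC, hmain⟩ := main_r hm1 A hA
  have hp := pp_gt hm1
  refine ⟨Cm, hC, fun u hu => ?_⟩
  have hun : ball (0 : Euc (m + 1)) 1 = ⋃ j : ℕ, ball (0 : Euc (m + 1)) (1 - 1 / ((j:ℝ) + 2)) := by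
    ext x
    simp only [Set.mem_iUnion, mem_ball_zero_iff]
    constructor
    · intro hx
      obtain ⟨j, hj⟩ := exists_nat_one_div_lt (sub_pos.2 hx)
      refine ⟨j, ?_⟩
      have : 1 / ((j:ℝ) + 2) ≤ 1 / ((j:ℝ) + 1) := one_div_le_one_div_of_le (by positivity) (by linarith)
      linarith
    · rintro ⟨j, hj⟩
      have : 0 < 1 / ((j:ℝ) + 2) := by positivity
      linarith
  have hmono : Monotone fun j : ℕ => ball (0 : Euc (m + 1)) (1 - 1 / ((j:ℝ) + 2)) := by
    intro i j hij
    refine ball_subset_ball (sub_le_sub_left (one_div_le_one_div_of_le (by positivity) ?_) _)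
    have : (i:ℝ) ≤ j := by exact_mod_cast hij
    linarith
  rw [one_div, ENNReal.rpow_inv_le_iff (by linarith)]
  conv_lhs => rw [hun, setLIntegral_iUnion_of_directed _ hmono.directed_le]
  refine iSup_le fun j => ?_
  rw [← ENNReal.rpow_inv_le_iff (by linarith), ← one_div]
  have h0 : 1 / ((j:ℝ) + 2) ≤ 1 / 2 := one_div_le_one_div_of_le (by positivity) (by linarith [(Nat.cast_nonneg j : (0:ℝ) ≤ j)])
  have h1 : 0 < 1 / ((j:ℝ) + 2) := by positivity
  exact hmain u hu _ (by linarith) (by linarith)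

theorem int_of_cd {n k : ℕ} {V W : Type*}
    [NormedAddCommGroup V] [InnerProductSpace ℝ V]
    [NormedAddCommGroup W] [InnerProductSpace ℝ W]
    (A : OpCoeff n k V W) (u : Euc n → V) (hu : ContDiffOn ℝ (⊤ : ℕ∞) u (closedBall 0 1)) :
    IntegrableOn (fun x => opApply A u x) (ball 0 1) := by
  have hud : UniqueDiffOn ℝ (closedBall (0 : Euc n) 1) :=
    uniqueDiffOn_convex (convex_closedBall _ _) ⟨0, by
      exact ball_subset_interior_closedBall (mem_ball_self one_pos)⟩
  have h1 := hu.continuousOn_iteratedFDerivWithin (m := k) (by exact_mod_cast le_top) hud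
  have h2 : ContinuousOn (fun x => A (iteratedFDerivWithin ℝ k u (closedBall 0 1) x)) (closedBall 0 1) :=
    A.continuous.comp_continuousOn h1
  have h3 := (h2.integrableOn_compact (μ := volume) (isCompact_closedBall _ _)).mono_set
    (ball_subset_closedBall)
  refine h3.congr_fun (fun x hx => ?_) measurableSet_ball
  change A _ = A _
  congr 1
  rw [← iteratedFDerivWithin_univ]
  exact iteratedFDerivWithin_congr_set (Filter.eventuallyEq_univ.mpr
    (Filter.mem_of_superset (isOpen_ball.mem_nhds hx) ball_subset_closedBall)) k

theorem final_bd {m k : ℕ} {V W : Type*}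
    [NormedAddCommGroup V] [InnerProductSpace ℝ V] [FiniteDimensional ℝ V]
    [NormedAddCommGroup W] [InnerProductSpace ℝ W] [FiniteDimensional ℝ W] (hm1 : 1 ≤ m)
    (A : OpCoeff (m + 1) (k + 1) V W) (hA : IsCElliptic A) :
    ∃ c : ℝ, 0 < c ∧ ∀ u : Euc (m + 1) → V, ContDiffOn ℝ (⊤ : ℕ∞) u (closedBall 0 1) →
      (∫ x in ball (0 : Euc (m + 1)) 1, ‖iteratedFDeriv ℝ k u x‖ ^ pp m) ^ (1 / pp m) ≤
        c * ((∫ x in ball (0 : Euc (m + 1)) 1, ‖opApply A u x‖) + ∫ x in ball (0 : Euc (m + 1)) 1, ‖u x‖) := by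
  obtain ⟨Cm, hC, hmain⟩ := main_lint hm1 A hA
  have hp := pp_gt hm1
  refine ⟨Cm.toReal + 1, by positivity, fun u hu => ?_⟩
  have hi1 := int_of_cd A u hu
  have hi2 : IntegrableOn u (ball 0 1) :=
    (hu.continuousOn.integrableOn_compact (μ := volume) (isCompact_closedBall _ _)).mono_set
    (ball_subset_closedBall)
  have e1 : ENNReal.ofReal (∫ x in ball (0 : Euc (m + 1)) 1, ‖opApply A u x‖) =
    ∫⁻ x in ball (0 : Euc (m + 1)) 1, ‖opApply A u x‖ₑ := ofReal_integral_norm_eq_lintegral_enorm hi1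
  have e2 : ENNReal.ofReal (∫ x in ball (0 : Euc (m + 1)) 1, ‖u x‖) =
    ∫⁻ x in ball (0 : Euc (m + 1)) 1, ‖u x‖ₑ := ofReal_integral_norm_eq_lintegral_enorm hi2
  have n1 : 0 ≤ ∫ x in ball (0 : Euc (m + 1)) 1, ‖opApply A u x‖ := integral_nonneg fun _ => norm_nonneg _
  have n2 : 0 ≤ ∫ x in ball (0 : Euc (m + 1)) 1, ‖u x‖ := integral_nonneg fun _ => norm_nonneg _
  have n3 : 0 ≤ ∫ x in ball (0 : Euc (m + 1)) 1, ‖iteratedFDeriv ℝ k u x‖ ^ pp m :=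
    integral_nonneg fun _ => by positivity
  have h := hmain u hu
  rw [← e1, ← e2, ← ENNReal.ofReal_add n1 n2] at h
  have e3 : ENNReal.ofReal (∫ x in ball (0 : Euc (m + 1)) 1, ‖iteratedFDeriv ℝ k u x‖ ^ pp m) ≤
      ∫⁻ x in ball (0 : Euc (m + 1)) 1, ‖iteratedFDeriv ℝ k u x‖ₑ ^ pp m := by
    have h1 := enorm_integral_le_lintegral_enorm (μ := volume.restrict (ball (0 : Euc (m + 1)) 1))
      (fun x => ‖iteratedFDeriv ℝ k u x‖ ^ pp m)
    rw [Real.enorm_of_nonneg n3] at h1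
    refine h1.trans (lintegral_mono fun x => ?_)
    rw [Real.enorm_of_nonneg (by positivity), ← ENNReal.ofReal_rpow_of_nonneg (norm_nonneg _) (by linarith), ofReal_norm]
  have h4 : ENNReal.ofReal ((∫ x in ball (0 : Euc (m + 1)) 1, ‖iteratedFDeriv ℝ k u x‖ ^ pp m) ^ (1 / pp m)) ≤
      ENNReal.ofReal (Cm.toReal * ((∫ x in ball (0 : Euc (m + 1)) 1, ‖opApply A u x‖) + ∫ x in ball (0 : Euc (m + 1)) 1, ‖u x‖)) := by
    rw [← ENNReal.ofReal_rpow_of_nonneg n3 (by positivity), ENNReal.ofReal_mul (by positivity), ENNReal.ofReal_toReal hC]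
    exact (ENNReal.rpow_le_rpow e3 (by positivity)).trans h
  have h5 := (ENNReal.ofReal_le_ofReal_iff (by positivity)).1 h4
  nlinarith

theorem st0 {n k : ℕ} {V W : Type*}
    [NormedAddCommGroup V] [InnerProductSpace ℝ V] [FiniteDimensional ℝ V]
    [NormedAddCommGroup W] [InnerProductSpace ℝ W] [FiniteDimensional ℝ W] (hn : 1 < n) (hk : 1 ≤ k) (A : OpCoeff n k V W) (hA : IsCElliptic A) :
    ∃ c : ℝ, 0 < c ∧ ∀ u : Euc n → V, ContDiffOn ℝ (⊤ : ℕ∞) u (closedBall 0 1) →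
      (∫ x in ball (0 : Euc n) 1, ‖iteratedFDeriv ℝ (k - 1) u x‖ ^ ((n : ℝ) / (n - 1))) ^ (((n : ℝ) - 1) / n) ≤
        c * ((∫ x in ball (0 : Euc n) 1, ‖opApply A u x‖) + ∫ x in ball (0 : Euc n) 1, ‖u x‖) := by
  obtain ⟨m, rfl⟩ : ∃ m, n = m + 1 := ⟨n - 1, by omega⟩
  obtain ⟨l, rfl⟩ : ∃ l, k = l + 1 := ⟨k - 1, by omega⟩
  have h := final_bd (show 1 ≤ m by omega) A hA
  have e1 : ((m + 1 : ℕ) : ℝ) / (((m + 1 : ℕ) : ℝ) - 1) = pp m := by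
    rw [pp]; push_cast; rw [add_sub_cancel_right]
  have e2 : (((m + 1 : ℕ) : ℝ) - 1) / ((m + 1 : ℕ) : ℝ) = 1 / pp m := by
    rw [← e1, one_div_div]
  rw [e1, e2]
  exact h
end

/-- If `n > 1` and `𝔸` is a ℂ-elliptic (equivalently, FDN) homogeneous
linear constant-coefficient operator of order `k` from `V` to `W`, then there is `c > 0`
such that for all `u ∈ C^∞(cl B, V)`,
`(∫_B |D^{k-1} u|^{n/(n-1)})^{(n-1)/n} ≤ c (∫_B |𝔸u| + ∫_B |u|)`. -/
theorem statement0 (hn : 1 < n) (hk : 1 ≤ k) (A : OpCoeff n k V W) (hA : IsCElliptic A) :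
    ∃ c : ℝ, 0 < c ∧ ∀ u : Euc n → V, ContDiffOn ℝ (⊤ : ℕ∞) u (closedBall 0 1) →
      (∫ x in ball (0 : Euc n) 1, ‖iteratedFDeriv ℝ (k - 1) u x‖ ^ ((n : ℝ) / (n - 1)))
          ^ (((n : ℝ) - 1) / n)
        ≤ c * ((∫ x in ball (0 : Euc n) 1, ‖opApply A u x‖)
            + ∫ x in ball (0 : Euc n) 1, ‖u x‖) := by
  exact st0 hn hk A hA
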